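/- arXiv:2507.13804 — 2 statements merged into one kernel-verified Lean document; each statement's English description precedes it below -/
import Mathlib

section
/- Let f : ℝⁿ → ℝ be real analytic, and let τ, r ∈ (0,1), ᾱ > 0. For every initial point x₀ ∈ ℝⁿ, the sequence (x_t) generated by stabilized Armijo backtracking gradient descent either leaves every compact subset of ℝⁿ (that is, ‖x_t‖ → ∞) or converges to a point x* ∈ ℝⁿ, in which case ∇f(x*) = 0. Moreover, for almost every ᾱ > 0 and almost every initial point x₀ ∈ ℝⁿ, if the limit point x* exists then additionally the Hessian ∇²f(x*) is positive semidefinite. -/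
open MeasureTheory Filter Topology
open scoped RealInnerProductSpace

noncomputable section

/-- The Armijo sufficient decrease condition for `f` at point `x` with step size `α` and
tolerance `r`. -/
def ArmijoCond {n : ℕ} (f : EuclideanSpace ℝ (Fin n) → ℝ) (r : ℝ)
    (x : EuclideanSpace ℝ (Fin n)) (α : ℝ) : Prop :=
  r * α * ‖gradient f x‖ ^ 2 ≤ f x - f (x - α • gradient f x)

/-- The sequences `(x_t)` and `(α_t)` are generated by stabilized Armijo backtracking
gradient descent with parameters `τ, r`, initial step size `abar` and initial point `x 0`.
Here `a t` denotes `α_{t−1}`, so `a 0 = ᾱ = abar`, and at iteration `t` the accepted step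
size is `a (t+1) = τ^k * a t` with `k` the smallest nonnegative integer such that the
Armijo condition holds. -/
def StabilizedArmijo {n : ℕ} (f : EuclideanSpace ℝ (Fin n) → ℝ) (τ r abar : ℝ)
    (x : ℕ → EuclideanSpace ℝ (Fin n)) (a : ℕ → ℝ) : Prop :=
  a 0 = abar ∧
  ∀ t : ℕ, ∃ k : ℕ,
    a (t + 1) = τ ^ k * a t ∧
    ArmijoCond f r (x t) (τ ^ k * a t) ∧
    (∀ j < k, ¬ ArmijoCond f r (x t) (τ ^ j * a t)) ∧
    x (t + 1) = x t - a (t + 1) • gradient f (x t)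

section Hadamard
variable {V : Type*} [NormedAddCommGroup V] [NormedSpace ℝ V]

/-- the difference-quotient power series -/
def hadSeries (p : FormalMultilinearSeries ℝ V ℝ) (P : V →L[ℝ] V) (e : V) :
    FormalMultilinearSeries ℝ V ℝ := fun n =>
  ∑ j : Fin (n + 1), ((p (n + 1)).curryMid j e).compContinuousLinearMap
    (fun i => if i.castSucc < j then ContinuousLinearMap.id ℝ V else P)

theorem hadSeries_telescope (p : FormalMultilinearSeries ℝ V ℝ) (P : V →L[ℝ] V) (e : V) (c : ℝ) (v : V)
    (hv : v = P v + c • e) (n : ℕ) :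
    p (n + 1) (fun _ => v) = p (n + 1) (fun _ => P v) + c * hadSeries p P e n (fun _ => v) := by
  have key : ∀ j : Fin (n + 1),
      p (n + 1) (fun i => if i.val < j.val + 1 then v else P v) -
      p (n + 1) (fun i => if i.val < j.val then v else P v) =
      c * ((p (n + 1)).curryMid j e).compContinuousLinearMap
    (fun i => if i.castSucc < j then ContinuousLinearMap.id ℝ V else P) (fun _ => v) := by
    intro j
    set m : Fin n → V := fun i => if i.castSucc < j then v else P v with hm
    have hval : ∀ i : Fin n, (j.succAbove i).val < j.val + 1 ↔ i.castSucc < j := by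
      intro i
      unfold Fin.succAbove
      split_ifs with h
      · simp only [h, iff_true]
        have := Fin.lt_def.1 h
        omega
      · simp only [h, iff_false]
        have := Fin.lt_def.not.1 h
        simp at this ⊢
        omega
    have hval2 : ∀ i : Fin n, (j.succAbove i).val < j.val ↔ i.castSucc < j := by
      intro i
      rw [← hval]
      have := Fin.succAbove_ne j i
      have h2 : (j.succAbove i).val ≠ j.val := fun h => this (Fin.ext h)
      omega
    have h1 : (fun i : Fin (n+1) => if i.val < j.val + 1 then v else P v) = j.insertNth (α := fun _ => V) v m := by
      funext i
      refine Fin.succAboveCases j ?_ (fun i => ?_) i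
      · simp
      · simp only [hval, Fin.insertNth_apply_succAbove, hm]
    have h2 : (fun i : Fin (n+1) => if i.val < j.val then v else P v) = j.insertNth (α := fun _ => V) (P v) m := by
      funext i
      refine Fin.succAboveCases j ?_ (fun i => ?_) i
      · simp
      · simp only [hval2, Fin.insertNth_apply_succAbove, hm]
    have h3 : (fun i : Fin n => (if i.castSucc < j then ContinuousLinearMap.id ℝ V else P) v) = m := by
      funext i
      simp only [hm]
      split_ifs <;> simp
    rw [h1, h2, ContinuousMultilinearMap.compContinuousLinearMap_apply, h3,
      ← ContinuousMultilinearMap.curryMid_apply, ← ContinuousMultilinearMap.curryMid_apply]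
    have h4 : (p (n+1)).curryMid j v = (p (n+1)).curryMid j (P v) + c • (p (n+1)).curryMid j e := by
      conv_lhs => rw [hv]
      rw [map_add, map_smul]
    rw [h4]
    simp
  have tel := Finset.sum_range_sub (fun j => p (n + 1) (fun i : Fin (n+1) => if i.val < j then v else P v)) (n+1)
  rw [← Fin.sum_univ_eq_sum_range (fun j => p (n + 1) (fun i : Fin (n+1) => if i.val < j + 1 then v else P v) - p (n + 1) (fun i : Fin (n+1) => if i.val < j then v else P v))] at tel
  simp only [key] at tel
  rw [← Finset.mul_sum] at tel
  have e1 : (fun i : Fin (n+1) => if i.val < n + 1 then v else P v) = fun _ => v := by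
    funext i; rw [if_pos i.isLt]
  have e2 : (fun i : Fin (n+1) => if i.val < 0 then v else P v) = fun _ => P v := by
    funext i; simp
  rw [e1, e2] at tel
  simp only [hadSeries, sum_apply]
  linarith

theorem hadSeries_radius (p : FormalMultilinearSeries ℝ V ℝ) (P : V →L[ℝ] V) (e : V) (hp : 0 < p.radius) :
    0 < (hadSeries p P e).radius := by
  obtain ⟨C, r, hC, hr, hb⟩ := p.le_mul_pow_of_radius_pos hp
  set K : ℝ := 1 + ‖P‖ with hK
  have hKpos : 0 < K := by positivity
  have hbound : ∀ n, ‖hadSeries p P e n‖ ≤ (n + 1) * (C * r ^ (n+1) * ‖e‖ * K ^ n) := by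
    intro n
    unfold hadSeries
    refine (norm_sum_le _ _).trans ?_
    have : ∀ j ∈ (Finset.univ : Finset (Fin (n+1))), ‖((p (n + 1)).curryMid j e).compContinuousLinearMap
          (fun i => if i.castSucc < j then ContinuousLinearMap.id ℝ V else P)‖ ≤ C * r ^ (n+1) * ‖e‖ * K ^ n := by
      intro j _
      refine (ContinuousMultilinearMap.norm_compContinuousLinearMap_le _ _).trans ?_
      have h1 : ‖(p (n + 1)).curryMid j e‖ ≤ C * r ^ (n+1) * ‖e‖ := by
        refine (ContinuousLinearMap.le_opNorm _ _).trans ?_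
        rw [ContinuousMultilinearMap.norm_curryMid]
        gcongr
        exact hb _
      have h2 : (∏ i : Fin n, ‖(if i.castSucc < j then ContinuousLinearMap.id ℝ V else P)‖) ≤ K ^ n := by
        calc _ ≤ ∏ i : Fin n, K := by
              refine Finset.prod_le_prod (fun _ _ => norm_nonneg _) (fun i _ => ?_)
              split_ifs
              · exact ContinuousLinearMap.norm_id_le.trans (by rw [hK]; linarith [norm_nonneg P])
              · rw [hK]; linarith
          _ = K ^ n := by simp
      have h3 : 0 ≤ C * r ^ (n+1) * ‖e‖ := by positivity
      exact mul_le_mul h1 h2 (Finset.prod_nonneg fun _ _ => norm_nonneg _) h3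
    refine (Finset.sum_le_sum this).trans ?_
    simp
  set ρ : NNReal := ⟨1 / (2 * r * K), by positivity⟩ with hρ
  have hρpos : 0 < ρ := by
    rw [← NNReal.coe_pos, hρ]; change 0 < 1 / (2 * r * K); positivity
  refine lt_of_lt_of_le (ENNReal.coe_pos.2 hρpos)
    ((hadSeries p P e).le_radius_of_bound (C * r * ‖e‖) fun n => ?_)
  have hρv : (ρ : ℝ) = 1 / (2 * r * K) := rfl
  rw [hρv]
  calc ‖hadSeries p P e n‖ * (1 / (2 * r * K)) ^ n
      ≤ (n + 1) * (C * r ^ (n+1) * ‖e‖ * K ^ n) * (1 / (2 * r * K)) ^ n := by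
        gcongr
        exact hbound n
    _ = (C * r * ‖e‖) * ((n + 1) / 2 ^ n) := by
        rw [div_pow, mul_pow, mul_pow, one_pow, pow_succ]
        field_simp
    _ ≤ (C * r * ‖e‖) * 1 := by
        gcongr
        rw [div_le_one (by positivity)]
        have := Nat.lt_two_pow_self (n := n)
        exact_mod_cast this
    _ = _ := mul_one _

/-- Hadamard's lemma for analytic functions. -/
theorem hadamard {f : V → ℝ} (hf : AnalyticAt ℝ f 0) (P : V →L[ℝ] V) (l : V →L[ℝ] ℝ) (e : V)
    (hP : ∀ v, v = P v + l v • e) :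
    ∃ H : V → ℝ, AnalyticAt ℝ H 0 ∧ ∀ᶠ v in 𝓝 (0 : V), f v = f (P v) + l v * H v := by
  obtain ⟨p, hp⟩ := hf
  have hq := hadSeries_radius p P e hp.radius_pos
  have hH := (hadSeries p P e).hasFPowerSeriesOnBall hq
  refine ⟨(hadSeries p P e).sum, hH.analyticAt, ?_⟩
  have h1 := hp.eventually_hasSum
  have h2 : ∀ᶠ v in 𝓝 (0 : V), HasSum (fun n : ℕ => p n fun _ : Fin n => P v) (f (0 + P v)) := by
    have : Tendsto P (𝓝 0) (𝓝 0) := by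
      simpa using P.continuous.tendsto 0
    exact this.eventually h1
  have h3 := hH.hasFPowerSeriesAt.eventually_hasSum
  filter_upwards [h1, h2, h3] with v a1 a2 a3
  rw [zero_add] at a1 a2 a3
  have b1 := (hasSum_nat_add_iff' 1).2 a1
  have b2 := (hasSum_nat_add_iff' 1).2 a2
  have b3 := b2.add (a3.mul_left (l v))
  have : (fun n => (p (n + 1)) (fun _ => v)) = fun n => (p (n + 1)) (fun _ => P v) + l v * hadSeries p P e n (fun _ => v) := by
    funext n
    exact hadSeries_telescope p P e (l v) v (hP v) n
  rw [this] at b1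
  have := b1.unique b3
  simp only [Finset.sum_range_one] at this
  have e0 : (p 0 fun _ => v) = p 0 fun _ => P v := by
    congr 1; funext i; exact i.elim0
  rw [e0] at this
  linarith
end Hadamard

/-- coordinate space -/
abbrev RV (n : ℕ) := Fin n → ℝ

/-- monomials -/
def mon {n : ℕ} (α : Fin n → ℕ) (v : RV n) : ℝ := ∏ i, v i ^ α i

theorem mon_analytic {n : ℕ} (α : Fin n → ℕ) (x : RV n) : AnalyticAt ℝ (mon α) x := by
  unfold mon
  refine Finset.analyticAt_fun_prod _ fun i _ => ?_
  exact ((ContinuousLinearMap.proj (R := ℝ) (φ := fun _ : Fin n => ℝ) i).analyticAt x).pow _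

theorem mon_add {n : ℕ} (α β : Fin n → ℕ) (v : RV n) : mon (α + β) v = mon α v * mon β v := by
  simp [mon, pow_add, Finset.prod_mul_distrib]

theorem mon_zero {n : ℕ} (v : RV n) : mon 0 v = 1 := by simp [mon]

theorem mon_smul {n : ℕ} (k : ℕ) (α : Fin n → ℕ) (v : RV n) : mon (k • α) v = mon α v ^ k := by
  simp [mon, pow_mul', Finset.prod_pow]

theorem mon_single {n : ℕ} (i : Fin n) (k : ℕ) (v : RV n) : mon (Pi.single i k) v = v i ^ k := by
  unfold mon
  rw [Finset.prod_eq_single i]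
  · simp
  · intro j _ hj; simp [hj]
  · simp

theorem mon_at_zero {n : ℕ} {α : Fin n → ℕ} (h : α ≠ 0) : mon α (0 : RV n) = 0 := by
  obtain ⟨i, hi⟩ := Function.ne_iff.1 h
  exact Finset.prod_eq_zero (Finset.mem_univ i) (by simpa using hi)

theorem mon_sub {n : ℕ} {α β : Fin n → ℕ} (h : α ≤ β) (v : RV n) :
    mon β v = mon (β - α) v * mon α v := by
  rw [← mon_add, tsub_add_cancel_of_le h]

/-- normal crossings with exponent `α` -/
def NCx {n : ℕ} (F : RV n → ℝ) (α : Fin n → ℕ) : Prop :=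
  ∃ u : RV n → ℝ, AnalyticAt ℝ u 0 ∧ u 0 ≠ 0 ∧ ∀ᶠ v in 𝓝 (0 : RV n), F v = u v * mon α v

def NC {n : ℕ} (F : RV n → ℝ) : Prop := ∃ α, NCx F α

theorem NCx.mul {n : ℕ} {F G : RV n → ℝ} {α β} (hF : NCx F α) (hG : NCx G β) :
    NCx (fun v => F v * G v) (α + β) := by
  obtain ⟨u, hu, hu0, h⟩ := hF
  obtain ⟨w, hw, hw0, h'⟩ := hG
  refine ⟨fun v => u v * w v, hu.mul hw, mul_ne_zero hu0 hw0, ?_⟩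
  filter_upwards [h, h'] with v a b
  rw [a, b, mon_add]; ring

theorem NCx.unit {n : ℕ} {F : RV n → ℝ} (hF : AnalyticAt ℝ F 0) (h : F 0 ≠ 0) : NCx F 0 :=
  ⟨F, hF, h, by simp [mon_zero]⟩

theorem NCx.congr {n : ℕ} {F G : RV n → ℝ} {α} (hF : NCx F α) (h : ∀ᶠ v in 𝓝 (0 : RV n), G v = F v) :
    NCx G α := by
  obtain ⟨u, hu, hu0, h'⟩ := hF
  exact ⟨u, hu, hu0, by filter_upwards [h, h'] with v a b; rw [a, b]⟩

theorem NCx.pow {n : ℕ} {F : RV n → ℝ} {α} (hF : NCx F α) (k : ℕ) :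
    NCx (fun v => F v ^ k) (k • α) := by
  obtain ⟨u, hu, hu0, h⟩ := hF
  refine ⟨fun v => u v ^ k, hu.pow k, pow_ne_zero _ hu0, ?_⟩
  filter_upwards [h] with v a
  rw [a, mon_smul, mul_pow]

theorem NCx.mon' {n : ℕ} (α : Fin n → ℕ) : NCx (mon α) α :=
  ⟨fun _ => 1, analyticAt_const, one_ne_zero, by simp⟩

theorem NCx.coord {n : ℕ} (i : Fin n) : NCx (fun v : RV n => v i) (Pi.single i 1) := by
  refine (NCx.mon' (Pi.single i 1)).congr (Eventually.of_forall fun v => ?_)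
  rw [mon_single, pow_one]

theorem NCx.prod {n : ℕ} {ι : Type*} (s : Finset ι) {F : ι → RV n → ℝ} {α : ι → Fin n → ℕ}
    (h : ∀ i ∈ s, NCx (F i) (α i)) : NCx (fun v => ∏ i ∈ s, F i v) (∑ i ∈ s, α i) := by
  classical
  induction s using Finset.induction_on with
  | empty => simpa using NCx.unit (n := n) (F := fun _ => 1) analyticAt_const one_ne_zero
  | insert a s ha ih =>
    simp only [Finset.prod_insert ha, Finset.sum_insert ha]
    exact (h a (by simp)).mul (ih fun i hi => h i (by simp [hi]))

theorem NCx.analyticAt {n : ℕ} {F : RV n → ℝ} {α} (hF : NCx F α) : AnalyticAt ℝ F 0 := by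
  obtain ⟨u, hu, hu0, h⟩ := hF
  refine (hu.mul (mon_analytic α 0)).congr ?_
  filter_upwards [h] with v a
  rw [a]; rfl

/-- exponent transformation -/
def expT {m n : ℕ} (M : Fin m → Fin n → ℕ) (α : Fin m → ℕ) : Fin n → ℕ := ∑ i, α i • M i

theorem expT_mono {m n : ℕ} (M : Fin m → Fin n → ℕ) {α β : Fin m → ℕ} (h : α ≤ β) :
    expT M α ≤ expT M β := by
  unfold expT
  refine Finset.sum_le_sum fun i _ => ?_
  exact smul_le_smul_of_nonneg_right (h i) (zero_le)

theorem expT_smul {m n : ℕ} (M : Fin m → Fin n → ℕ) (k : ℕ) (α : Fin m → ℕ) :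
    expT M (k • α) = k • expT M α := by
  simp [expT, Finset.smul_sum, mul_smul]

theorem NCx.comp {m n : ℕ} {F : RV m → ℝ} {α} (hF : NCx F α) {π : RV n → RV m}
    (hπ : AnalyticAt ℝ π 0) (h0 : π 0 = 0) {M : Fin m → Fin n → ℕ}
    (hM : ∀ i, NCx (fun v => π v i) (M i)) : NCx (fun v => F (π v)) (expT M α) := by
  obtain ⟨u, hu, hu0, h⟩ := hF
  have h1 : NCx (fun v => u (π v)) 0 :=
    NCx.unit (AnalyticAt.comp (by rwa [h0]) hπ) (by rwa [h0])
  have h2 : NCx (fun v => ∏ i, (π v i) ^ α i) (∑ i, α i • M i) :=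
    NCx.prod _ fun i _ => (hM i).pow _
  have h3 := h1.mul h2
  rw [zero_add] at h3
  refine h3.congr ?_
  have : Tendsto π (𝓝 0) (𝓝 0) := by simpa [h0] using hπ.continuousAt.tendsto
  exact this.eventually h

/-- `x = π(y)` along the ultrafilter. -/
structure Chart {m n : ℕ} (U : Ultrafilter ℕ) (x : ℕ → RV m) (y : ℕ → RV n) (π : RV n → RV m) : Prop where
  an : AnalyticAt ℝ π 0
  zero : π 0 = 0
  tend : Tendsto y U (𝓝 0)
  eq : ∀ᶠ k in (U : Filter ℕ), π (y k) = x k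

theorem Chart.tends {m n : ℕ} {U : Ultrafilter ℕ} {x : ℕ → RV m} {y : ℕ → RV n} {π : RV n → RV m}
    (h : Chart U x y π) : Tendsto π (𝓝 0) (𝓝 0) := by
  simpa [h.zero] using h.an.continuousAt.tendsto

theorem Chart.comp {l m n : ℕ} {U : Ultrafilter ℕ} {x : ℕ → RV l} {y : ℕ → RV m} {z : ℕ → RV n}
    {π : RV m → RV l} {ρ : RV n → RV m} (h : Chart U x y π) (h' : Chart U y z ρ) :
    Chart U x z (fun v => π (ρ v)) where
  an := AnalyticAt.comp (by rw [h'.zero]; exact h.an) h'.an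
  zero := by rw [h'.zero, h.zero]
  tend := h'.tend
  eq := by
    filter_upwards [h.eq, h'.eq] with k a b
    rw [b, a]

theorem Chart.refl {n : ℕ} {U : Ultrafilter ℕ} {x : ℕ → RV n} (hx : Tendsto x U (𝓝 0)) :
    Chart U x x (fun v => v) :=
  ⟨analyticAt_id, rfl, hx, by simp⟩

/-- A chart all of whose coordinates are normal crossings. -/
structure Toric {m n : ℕ} (U : Ultrafilter ℕ) (x : ℕ → RV m) (y : ℕ → RV n) (π : RV n → RV m)
    (M : Fin m → Fin n → ℕ) : Prop extends Chart U x y π where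
  nc : ∀ i, NCx (fun v => π v i) (M i)

theorem Toric.comp {l m n : ℕ} {U : Ultrafilter ℕ} {x : ℕ → RV l} {y : ℕ → RV m} {z : ℕ → RV n}
    {π : RV m → RV l} {ρ : RV n → RV m} {M N} (h : Toric U x y π M) (h' : Toric U y z ρ N) :
    Toric U x z (fun v => π (ρ v)) (fun i => expT N (M i)) where
  toChart := h.toChart.comp h'.toChart
  nc i := (h.nc i).comp h'.an h'.zero h'.nc

theorem Toric.refl {n : ℕ} {U : Ultrafilter ℕ} {x : ℕ → RV n} (hx : Tendsto x U (𝓝 0)) :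
    Toric U x x (fun v => v) (fun i => Pi.single i 1) where
  toChart := Chart.refl hx
  nc i := NCx.coord i

theorem expT_single {n : ℕ} (α : Fin n → ℕ) : expT (fun i : Fin n => Pi.single i 1) α = α := by
  funext j
  simp [expT, Finset.sum_apply, Pi.single_apply]

theorem expT_expT {l m n : ℕ} (M : Fin l → Fin m → ℕ) (N : Fin m → Fin n → ℕ) (α : Fin l → ℕ) :
    expT (fun i => expT N (M i)) α = expT N (expT M α) := by
  funext j
  simp only [expT, Finset.sum_apply, Pi.smul_apply, smul_eq_mul, Finset.mul_sum, Finset.sum_mul]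
  rw [Finset.sum_comm]
  simp only [mul_assoc]

/-- ultrafilter limits of bounded sequences -/
theorem ultra_lim {U : Ultrafilter ℕ} {w : ℕ → ℝ} {C : ℝ} (h : ∀ᶠ k in (U : Filter ℕ), |w k| ≤ C) :
    ∃ c, |c| ≤ C ∧ Tendsto w U (𝓝 c) := by
  have hc : IsCompact (Set.Icc (-C) C) := isCompact_Icc
  obtain ⟨c, hc, hle⟩ := hc.ultrafilter_le_nhds' (U.map w) (by
    change ∀ᶠ k in (U : Filter ℕ), w k ∈ Set.Icc (-C) C
    filter_upwards [h] with k hk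
    exact abs_le.1 hk)
  exact ⟨c, abs_le.2 hc, hle⟩

theorem ultra_sign {U : Ultrafilter ℕ} (w : ℕ → ℝ) :
    ∃ s : ℝ, (s = 1 ∨ s = -1) ∧ ∀ᶠ k in (U : Filter ℕ), w k = s * |w k| := by
  rcases U.eventually_or.1 (Eventually.of_forall (f := (U : Filter ℕ)) fun k => le_total 0 (w k)) with h | h
  · exact ⟨1, Or.inl rfl, by filter_upwards [h] with k hk; rw [abs_of_nonneg hk]; ring⟩
  · exact ⟨-1, Or.inr rfl, by filter_upwards [h] with k hk; rw [abs_of_nonpos hk]; ring⟩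

theorem germ_domain {V : Type*} [NormedAddCommGroup V] [NormedSpace ℝ V] {F G : V → ℝ} {x : V}
    (hF : AnalyticAt ℝ F x) (hG : AnalyticAt ℝ G x) (h : ∀ᶠ v in 𝓝 x, F v * G v = 0) :
    (∀ᶠ v in 𝓝 x, F v = 0) ∨ (∀ᶠ v in 𝓝 x, G v = 0) := by
  have := (hF.eventually_analyticAt.and hG.eventually_analyticAt).and h
  obtain ⟨ε, hε, hb⟩ := Metric.eventually_nhds_iff_ball.1 this
  by_cases hz : ∀ v ∈ Metric.ball x ε, F v = 0
  · left
    exact Metric.eventually_nhds_iff_ball.2 ⟨ε, hε, hz⟩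
  · right
    push Not at hz
    obtain ⟨v, hv, hFv⟩ := hz
    have hGa : AnalyticOnNhd ℝ G (Metric.ball x ε) := fun w hw => (hb w hw).1.2
    have hGz : G =ᶠ[𝓝 v] 0 := by
      have h1 : ∀ᶠ w in 𝓝 v, F w ≠ 0 := (hb v hv).1.1.continuousAt.eventually_ne hFv
      filter_upwards [h1, Metric.isOpen_ball.mem_nhds hv] with w hw hw2
      exact (mul_eq_zero.1 (hb w hw2).2).resolve_left hw
    have := hGa.eqOn_zero_of_preconnected_of_eventuallyEq_zero (convex_ball x ε).isPreconnected hv hGz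
    exact Metric.eventually_nhds_iff_ball.2 ⟨ε, hε, fun w hw => this hw⟩

/-- the projection killing coordinate `i` -/
def killP {n : ℕ} (i : Fin n) : RV n →L[ℝ] RV n :=
  ContinuousLinearMap.id ℝ (RV n) -
    (ContinuousLinearMap.proj (R := ℝ) (φ := fun _ : Fin n => ℝ) i).smulRight (Pi.single i (1 : ℝ))

theorem killP_apply {n : ℕ} (i : Fin n) (v : RV n) : killP i v = v - v i • Pi.single i 1 := by
  simp [killP]

theorem hadamard_coord {n : ℕ} {f : RV n → ℝ} (hf : AnalyticAt ℝ f 0) (i : Fin n) :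
    ∃ H : RV n → ℝ, AnalyticAt ℝ H 0 ∧ ∀ᶠ v in 𝓝 (0 : RV n), f v = f (killP i v) + v i * H v :=
  hadamard hf (killP i) (ContinuousLinearMap.proj (R := ℝ) (φ := fun _ : Fin n => ℝ) i) (Pi.single i 1)
    (fun v => by rw [killP_apply]; simp)

theorem coord_analytic {n : ℕ} (i : Fin n) (x : RV n) : AnalyticAt ℝ (fun v : RV n => v i) x :=
  (ContinuousLinearMap.proj (R := ℝ) (φ := fun _ : Fin n => ℝ) i).analyticAt x

theorem coord_not_zero {n : ℕ} (i : Fin n) : ¬ ∀ᶠ v in 𝓝 (0 : RV n), v i = 0 := by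
  intro h
  have ht : Tendsto (fun t : ℝ => (Pi.single i t : RV n)) (𝓝 0) (𝓝 0) := by
    have : Continuous (fun t : ℝ => (Pi.single i t : RV n)) := by
      refine continuous_pi fun j => ?_
      by_cases hj : j = i
      · subst hj; simp only [Pi.single_eq_same]; exact continuous_id
      · simpa [hj] using continuous_const
    simpa using this.tendsto 0
  have h2 := ht.eventually h
  simp only [Pi.single_eq_same] at h2
  obtain ⟨ε, hε, hb⟩ := Metric.eventually_nhds_iff_ball.1 h2
  have := hb (ε / 2) (by simp [abs_of_pos hε, hε])
  linarith

theorem factor_NC {n : ℕ} (N : ℕ) : ∀ (α : Fin n → ℕ), ∑ i, α i = N → ∀ (F G : RV n → ℝ),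
    AnalyticAt ℝ F 0 → AnalyticAt ℝ G 0 → NCx (fun v => F v * G v) α → NC F := by
  induction N with
  | zero =>
    intro α hα F G hF hG h
    have : α = 0 := by
      funext i
      have := (Finset.sum_eq_zero_iff.1 hα) i (Finset.mem_univ i)
      simpa using this
    subst this
    obtain ⟨u, hu, hu0, h⟩ := h
    have := h.self_of_nhds
    rw [mon_zero, mul_one] at this
    exact ⟨0, NCx.unit hF (fun h0 => hu0 (by rw [← this]; simp only [h0, zero_mul]))⟩
  | succ N ih =>
    intro α hα F G hF hG h
    obtain ⟨i, hi⟩ : ∃ i, α i ≠ 0 := by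
      by_contra hc
      push Not at hc
      simp [hc] at hα
    obtain ⟨u, hu, hu0, h⟩ := h
    set β : Fin n → ℕ := α - Pi.single i 1 with hβ
    have hle : (Pi.single i 1 : Fin n → ℕ) ≤ α := by
      intro j
      by_cases hj : j = i
      · subst hj; simp; omega
      · simp [hj]
    have hsum : ∑ j, β j = N := by
      have : ∑ j, (β + (Pi.single i 1 : Fin n → ℕ)) j = N + 1 := by rw [hβ, tsub_add_cancel_of_le hle, hα]
      simp [Finset.sum_add_distrib] at this
      omega
    have hmon : ∀ v, mon α v = v i * mon β v := by
      intro v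
      rw [mon_sub hle, mon_single, pow_one, ← hβ, mul_comm]
    have hPt : Tendsto (killP i) (𝓝 (0 : RV n)) (𝓝 0) := by
      simpa using (killP i).continuous.tendsto 0
    have hPi : ∀ v : RV n, (killP i v) i = 0 := by intro v; rw [killP_apply]; simp
    have hz : ∀ᶠ v in 𝓝 (0 : RV n), F (killP i v) * G (killP i v) = 0 := by
      filter_upwards [hPt.eventually h] with v hv
      rw [hv, hmon, hPi]; ring
    have hcomp : ∀ {F : RV n → ℝ}, AnalyticAt ℝ F 0 → AnalyticAt ℝ (fun v => F (killP i v)) 0 := by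
      intro F hF
      exact AnalyticAt.comp (by simpa using hF) ((killP i).analyticAt 0)
    have cancel : ∀ {A : RV n → ℝ}, AnalyticAt ℝ A 0 →
        (∀ᶠ v in 𝓝 (0 : RV n), v i * A v = u v * mon α v) → NCx A β := by
      intro A hA h
      refine ⟨u, hu, hu0, ?_⟩
      have := germ_domain (coord_analytic i 0) (hA.sub (hu.mul (mon_analytic β 0))) (by
        filter_upwards [h] with v hv
        simp only [Pi.sub_apply, Pi.mul_apply]
        rw [mul_sub, hv, hmon]; ring)
      rcases this with h | h
      · exact absurd h (coord_not_zero i)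
      · filter_upwards [h] with v hv
        simp only [Pi.sub_apply, Pi.mul_apply] at hv
        linarith
    rcases germ_domain (hcomp hF) (hcomp hG) hz with h0 | h0
    · obtain ⟨H, hH, hHe⟩ := hadamard_coord hF i
      have hNC : NCx (fun v => H v * G v) β := by
        refine cancel (hH.mul hG) ?_
        filter_upwards [h, h0, hHe] with v a b c
        simp only [Pi.mul_apply, ← a]
        rw [c, b]; ring
      obtain ⟨γ, hγ⟩ := ih β hsum H G hH hG hNC
      refine ⟨_, ((NCx.coord i).mul hγ).congr ?_⟩
      filter_upwards [h0, hHe] with v b c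
      rw [c, b]; ring
    · obtain ⟨H, hH, hHe⟩ := hadamard_coord hG i
      have hNC : NCx (fun v => F v * H v) β := by
        refine cancel (hF.mul hH) ?_
        filter_upwards [h, h0, hHe] with v a b c
        simp only [Pi.mul_apply, ← a]
        rw [c, b]; ring
      exact ih β hsum F H hF hH hNC

theorem NC.of_mul {n : ℕ} {F G : RV n → ℝ} (hF : AnalyticAt ℝ F 0) (hG : AnalyticAt ℝ G 0)
    (h : NC (fun v => F v * G v)) : NC F := by
  obtain ⟨α, hα⟩ := h
  exact factor_NC _ α rfl F G hF hG hα

theorem NC.of_prod {n : ℕ} {ι : Type*} (s : Finset ι) {F : ι → RV n → ℝ}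
    (hF : ∀ i ∈ s, AnalyticAt ℝ (F i) 0) (h : NC (fun v => ∏ i ∈ s, F i v)) : ∀ i ∈ s, NC (F i) := by
  classical
  intro i hi
  refine NC.of_mul (G := fun v => ∏ j ∈ s.erase i, F j v) (hF i hi)
    (Finset.analyticAt_fun_prod _ fun j hj => hF j (Finset.mem_of_mem_erase hj)) ?_
  have e : (fun v => F i v * ∏ j ∈ s.erase i, F j v) = fun v => ∏ j ∈ s, F j v := by
    funext v
    exact Finset.mul_prod_erase s (fun j => F j v) hi
  rw [e]; exact h

theorem prod_not_zero {V : Type*} [NormedAddCommGroup V] [NormedSpace ℝ V] {ι : Type*} (s : Finset ι) {F : ι → V → ℝ} {x : V}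
    (hF : ∀ i ∈ s, AnalyticAt ℝ (F i) x) (h : ∀ i ∈ s, ¬ ∀ᶠ v in 𝓝 x, F i v = 0) :
    ¬ ∀ᶠ v in 𝓝 x, ∏ i ∈ s, F i v = 0 := by
  classical
  induction s using Finset.induction_on with
  | empty => intro h; simpa using h.self_of_nhds
  | insert a s ha ih =>
    simp only [Finset.prod_insert ha]
    intro hc
    rcases germ_domain (hF a (by simp)) (Finset.analyticAt_fun_prod s fun j hj => hF j (by simp [hj])) hc with h1 | h1
    · exact h a (by simp) h1
    · exact ih (fun i hi => hF i (by simp [hi])) (fun i hi => h i (by simp [hi])) h1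

/-- The basic toric step. -/
theorem toric_step {n : ℕ} {U : Ultrafilter ℕ} {x : ℕ → RV n} (hx : Tendsto x U (𝓝 0))
    {i j : Fin n} (hij : i ≠ j) {p q : ℕ} (hp : 0 < p) (hq : 0 < q)
    (h : ∀ᶠ k in (U : Filter ℕ), |x k i| ^ p ≤ |x k j| ^ q) :
    ∃ (y : ℕ → RV n) (π : RV n → RV n) (M : Fin n → Fin n → ℕ), Toric U x y π M ∧
      M j = Pi.single j p ∧ (M i = Pi.single j q ∨ M i = Pi.single i 1 + Pi.single j q) ∧
      ∀ k, k ≠ i → k ≠ j → M k = Pi.single k 1 := by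
  classical
  obtain ⟨s, hs, hsx⟩ := ultra_sign (U := U) (fun k => x k j)
  have hs0 : s ≠ 0 := by rcases hs with h | h <;> rw [h] <;> norm_num
  set wj : ℕ → ℝ := fun k => |x k j| ^ ((p : ℝ)⁻¹) with hwj
  have hwjp : ∀ k, wj k ^ p = |x k j| := fun k => Real.rpow_inv_natCast_pow (abs_nonneg _) hp.ne'
  have hwj0 : ∀ k, 0 ≤ wj k := fun k => Real.rpow_nonneg (abs_nonneg _) _
  set wi : ℕ → ℝ := fun k => x k i / wj k ^ q with hwi
  have hle : ∀ᶠ k in (U : Filter ℕ), |x k i| ≤ wj k ^ q := by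
    filter_upwards [h] with k hk
    rw [← hwjp k, ← pow_mul, mul_comm, pow_mul] at hk
    exact le_of_pow_le_pow_left₀ hp.ne' (pow_nonneg (hwj0 k) _) hk
  have hbd : ∀ᶠ k in (U : Filter ℕ), |wi k| ≤ 1 := by
    filter_upwards [hle] with k hk
    rw [hwi]; simp only
    rw [abs_div, abs_of_nonneg (pow_nonneg (hwj0 k) q)]
    exact div_le_one_of_le₀ hk (pow_nonneg (hwj0 k) q)
  have hxi : ∀ᶠ k in (U : Filter ℕ), x k i = wi k * wj k ^ q := by
    filter_upwards [hle] with k hk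
    rw [hwi]; simp only
    by_cases h0 : wj k ^ q = 0
    · rw [h0] at hk ⊢
      simpa using hk
    · field_simp
  obtain ⟨c, -, hc⟩ := ultra_lim hbd
  have hxj0 : Tendsto (fun k => x k j) U (𝓝 0) := by simpa using (tendsto_pi_nhds.1 hx) j
  have hwjt : Tendsto wj U (𝓝 0) := by
    have h1 : Tendsto (fun k => |x k j|) U (𝓝 0) := by simpa using hxj0.abs
    have h2 := h1.rpow_const (p := (p : ℝ)⁻¹) (Or.inr (by positivity))
    rwa [Real.zero_rpow (by positivity)] at h2
  set y : ℕ → RV n := fun k l => if l = i then wi k - c else if l = j then wj k else x k l with hy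
  set π : RV n → RV n := fun v l => if l = i then (c + v i) * v j ^ q else if l = j then s * v j ^ p else v l with hπ
  have hπi : ∀ v, π v i = (c + v i) * v j ^ q := by intro v; simp [hπ]
  have hπj : ∀ v, π v j = s * v j ^ p := by intro v; simp [hπ, hij.symm]
  have hπk : ∀ v k, k ≠ i → k ≠ j → π v k = v k := by intro v k h1 h2; simp [hπ, h1, h2]
  have hjp : ∀ p : ℕ, NCx (fun v : RV n => v j ^ p) (Pi.single j p) := by
    intro p
    have := (NCx.coord (n := n) j).pow p
    rwa [← Pi.single_smul, smul_eq_mul, mul_one] at this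
  have nci : ∃ m : Fin n → ℕ, NCx (fun v => π v i) m ∧ (m = Pi.single j q ∨ m = Pi.single i 1 + Pi.single j q) := by
    simp only [hπi]
    by_cases hc0 : c = 0
    · refine ⟨_, ?_, Or.inr rfl⟩
      simp only [hc0, zero_add]
      exact (NCx.coord i).mul (hjp q)
    · refine ⟨_, ?_, Or.inl rfl⟩
      have h1 : NCx (fun v : RV n => c + v i) 0 :=
        NCx.unit (analyticAt_const.add (coord_analytic i 0)) (by simpa using hc0)
      simpa using h1.mul (hjp q)
  obtain ⟨m, hm, hm'⟩ := nci
  have ncj : NCx (fun v => π v j) (Pi.single j p) := by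
    simp only [hπj]
    have h1 : NCx (fun v : RV n => s) 0 := NCx.unit analyticAt_const hs0
    simpa using h1.mul (hjp p)
  have hnc : ∀ l, NCx (fun v => π v l) (if l = i then m else if l = j then Pi.single j p else Pi.single l 1) := by
    intro l
    by_cases h1 : l = i
    · subst h1; simpa using hm
    · by_cases h2 : l = j
      · subst h2; simpa [h1] using ncj
      · simp only [h1, h2, if_false, hπk _ l h1 h2]
        exact NCx.coord l
  refine ⟨y, π, fun l => if l = i then m else if l = j then Pi.single j p else Pi.single l 1,
    ⟨⟨?_, ?_, ?_, ?_⟩, hnc⟩, ?_, ?_, ?_⟩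
  · rw [analyticAt_pi_iff]
    exact fun l => (hnc l).analyticAt
  · funext l
    by_cases h1 : l = i
    · subst h1; rw [hπi]; simp [hq.ne']
    · by_cases h2 : l = j
      · subst h2; rw [hπj]; simp [hp.ne']
      · rw [hπk _ _ h1 h2]
  · rw [tendsto_pi_nhds]
    intro l
    by_cases h1 : l = i
    · simp only [hy, h1, if_true]
      simpa using hc.sub_const c
    · by_cases h2 : l = j
      · simp only [hy, h1, h2, if_false, if_true, hij.symm]
        exact hwjt
      · simp only [hy, h1, h2, if_false]
        exact (tendsto_pi_nhds.1 hx) l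
  · filter_upwards [hxi, hsx] with k a b
    funext l
    have hyi : y k i = wi k - c := by simp [hy]
    have hyj : y k j = wj k := by simp [hy, hij.symm]
    by_cases h1 : l = i
    · subst h1; rw [hπi, hyi, hyj, a]; ring
    · by_cases h2 : l = j
      · subst h2; rw [hπj, hyj, hwjp]; exact b.symm
      · rw [hπk _ _ h1 h2]; simp [hy, h1, h2]
  · simp [hij.symm]
  · simpa using hm'
  · intro k h1 h2; simp [h1, h2]

theorem expT_apply {m n : ℕ} (M : Fin m → Fin n → ℕ) (α : Fin m → ℕ) (k : Fin n) :
    expT M α k = ∑ i, α i * M i k := by simp [expT]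

theorem step_exp {n : ℕ} {i j : Fin n} (hij : i ≠ j) {p q : ℕ} {M : Fin n → Fin n → ℕ}
    (hj : M j = Pi.single j p) (hi : M i = Pi.single j q ∨ M i = Pi.single i 1 + Pi.single j q)
    (hk : ∀ k, k ≠ i → k ≠ j → M k = Pi.single k 1) :
    (∀ α k, k ≠ i → k ≠ j → expT M α k = α k) ∧ (∀ α, expT M α j = α i * q + α j * p) ∧
    ((∀ α, expT M α i = 0) ∨ (∀ α, expT M α i = α i)) := by
  refine ⟨?_, ?_, ?_⟩
  · intro α k hki hkj
    rw [expT_apply, Finset.sum_eq_single k]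
    · simp [hk k hki hkj]
    · intro l _ hl
      by_cases h1 : l = i
      · subst h1; rcases hi with h | h <;> simp [h, hki, hkj]
      by_cases h2 : l = j
      · subst h2; simp [hj, hkj]
      simp [hk l h1 h2, Ne.symm hl]
    · simp
  · intro α
    rw [expT_apply, Finset.sum_eq_add i j hij]
    · rcases hi with h | h <;> simp [h, hj, hij.symm]
    · intro l _ hl
      simp [hk l hl.1 hl.2, Ne.symm hl.2]
    · simp
    · simp
  · rcases hi with h | h
    · left
      intro α
      rw [expT_apply]
      refine Finset.sum_eq_zero fun l _ => ?_
      by_cases h1 : l = i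
      · subst h1; simp [h, hij]
      by_cases h2 : l = j
      · subst h2; simp [hj, hij]
      simp [hk l h1 h2, Ne.symm h1]
    · right
      intro α
      rw [expT_apply, Finset.sum_eq_single i]
      · simp [h, hij]
      · intro l _ h1
        by_cases h2 : l = j
        · subst h2; simp [hj, hij]
        simp [hk l h1 h2, Ne.symm h1]
      · simp

theorem toric_compare {n : ℕ} {U : Ultrafilter ℕ} (N : ℕ) : ∀ {x : ℕ → RV n}, Tendsto x U (𝓝 0) →
    ∀ α β : Fin n → ℕ, (Finset.univ.filter fun k => α k ≠ β k).card = N →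
    ∃ (y : ℕ → RV n) (π : RV n → RV n) (M : Fin n → Fin n → ℕ), Toric U x y π M ∧
      (expT M α ≤ expT M β ∨ expT M β ≤ expT M α) := by
  induction N using Nat.strong_induction_on with
  | _ N ih =>
  intro x hx α β hN
  by_cases hle : α ≤ β ∨ β ≤ α
  · exact ⟨x, _, _, Toric.refl hx, by simpa only [expT_single] using hle⟩
  push Not at hle
  obtain ⟨h1, h2⟩ := hle
  -- key claim
  have key : ∀ (α β : Fin n → ℕ) (i j : Fin n), β i < α i → α j < β j →
      (Finset.univ.filter fun k => α k ≠ β k).card = N →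
      (∀ᶠ k in (U : Filter ℕ), |x k i| ^ (α i - β i) ≤ |x k j| ^ (β j - α j)) →
      ∃ (y : ℕ → RV n) (π : RV n → RV n) (M : Fin n → Fin n → ℕ), Toric U x y π M ∧
      (expT M α ≤ expT M β ∨ expT M β ≤ expT M α) := by
    intro α β i j hi hj hN h
    have hij : i ≠ j := by rintro rfl; omega
    obtain ⟨y, π, M, ht, h1, h2, h3⟩ := toric_step hx hij (by omega : 0 < α i - β i) (by omega : 0 < β j - α j) h
    obtain ⟨e1, e2, e3⟩ := step_exp hij h1 h2 h3
    have hj' : expT M α j = expT M β j := by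
      rw [e2, e2]
      obtain ⟨p, hp⟩ := Nat.exists_eq_add_of_lt hi
      obtain ⟨q, hq⟩ := Nat.exists_eq_add_of_lt hj
      have a1 : α i - β i = p + 1 := by omega
      have a2 : β j - α j = q + 1 := by omega
      rw [a1, a2, hp, hq]; ring
    have hcard : (Finset.univ.filter fun k => expT M α k ≠ expT M β k).card < N := by
      rw [← hN]
      refine Finset.card_lt_card ⟨?_, ?_⟩
      · intro k hk
        simp only [Finset.mem_filter, Finset.mem_univ, true_and] at hk ⊢
        by_cases hki : k = i
        · subst hki; omega
        by_cases hkj : k = j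
        · subst hkj; omega
        rwa [e1 _ _ hki hkj, e1 _ _ hki hkj] at hk
      · intro hc
        have := hc (by simp; omega : j ∈ _)
        simp at this
        exact this hj'
    obtain ⟨z, ρ, M', ht', hc⟩ := ih _ hcard ht.tend _ _ rfl
    exact ⟨z, _, _, ht.comp ht', by simpa only [expT_expT] using hc⟩
  obtain ⟨i, hi⟩ := not_forall.1 h1
  obtain ⟨j, hj⟩ := not_forall.1 h2
  push Not at hi hj
  rcases U.eventually_or.1 (Eventually.of_forall (f := (U : Filter ℕ)) fun k =>
    le_total (|x k i| ^ (α i - β i)) (|x k j| ^ (β j - α j))) with h | h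
  · exact key α β i j hi hj hN h
  · obtain ⟨y, π, M, ht, hc⟩ := key β α j i hj hi (by rw [← hN]; simp only [ne_comm]) h
    exact ⟨y, π, M, ht, hc.symm⟩

/-- Make finitely many exponents pairwise comparable. -/
theorem toric_compare_list {n : ℕ} {U : Ultrafilter ℕ} (L : List ((Fin n → ℕ) × (Fin n → ℕ))) :
    ∀ {x : ℕ → RV n}, Tendsto x U (𝓝 0) →
    ∃ (y : ℕ → RV n) (π : RV n → RV n) (M : Fin n → Fin n → ℕ), Toric U x y π M ∧
      ∀ p ∈ L, (expT M p.1 ≤ expT M p.2 ∨ expT M p.2 ≤ expT M p.1) := by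
  induction L with
  | nil => intro x hx; exact ⟨x, _, _, Toric.refl hx, by simp⟩
  | cons p L ih =>
    intro x hx
    obtain ⟨y, π, M, ht, h⟩ := ih hx
    obtain ⟨z, ρ, M', ht', h'⟩ := toric_compare _ ht.tend (expT M p.1) (expT M p.2) rfl
    refine ⟨z, _, _, ht.comp ht', ?_⟩
    intro q hq
    simp only [expT_expT]
    rcases List.mem_cons.1 hq with rfl | hq
    · exact h'
    · exact (h q hq).imp (fun a => expT_mono _ a) (fun a => expT_mono _ a)

theorem toric_min {n : ℕ} {U : Ultrafilter ℕ} {x : ℕ → RV n} (hx : Tendsto x U (𝓝 0))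
    (S : Finset ℕ) (hS : S.Nonempty) (β : ℕ → Fin n → ℕ) :
    ∃ (y : ℕ → RV n) (π : RV n → RV n) (M : Fin n → Fin n → ℕ), Toric U x y π M ∧
      ∃ j₀ ∈ S, ∀ j ∈ S, expT M (β j₀) ≤ expT M (β j) := by
  obtain ⟨y, π, M, ht, h⟩ := toric_compare_list ((S ×ˢ S).toList.map fun p => (β p.1, β p.2)) hx
  refine ⟨y, π, M, ht, ?_⟩
  obtain ⟨j₀, hj₀, hmin⟩ := S.exists_min_image (fun j => ∑ k, expT M (β j) k) hS
  refine ⟨j₀, hj₀, fun j hj => ?_⟩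
  have := h (β j₀, β j) (List.mem_map.2 ⟨(j₀, j), by simp [hj, hj₀], rfl⟩)
  rcases this with h1 | h1
  · exact h1
  · intro k
    have h2 := (Finset.sum_eq_sum_iff_of_le (s := Finset.univ) (fun k _ => h1 k)).1
      (le_antisymm (Finset.sum_le_sum fun k _ => h1 k) (hmin j hj)) k (Finset.mem_univ k)
    exact h2.ge

theorem toric_power {n : ℕ} {U : Ultrafilter ℕ} {x : ℕ → RV n} (hx : Tendsto x U (𝓝 0))
    (D : ℕ) (hD : D ≠ 0) :
    ∃ (y : ℕ → RV n) (π : RV n → RV n), Toric U x y π (fun i => Pi.single i D) := by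
  choose s hs hsx using fun i : Fin n => ultra_sign (U := U) (fun k => x k i)
  have hs0 : ∀ i, s i ≠ 0 := by
    intro i; rcases hs i with h | h <;> rw [h] <;> norm_num
  refine ⟨fun k i => |x k i| ^ ((D : ℝ)⁻¹), fun v i => s i * v i ^ D, ⟨?_, ?_, ?_, ?_⟩, ?_⟩
  · refine AnalyticAt.pi fun i => analyticAt_const.mul ((coord_analytic i 0).pow D)
  · funext i; simp [hD]
  · rw [tendsto_pi_nhds] at hx ⊢
    intro i
    have h1 : Tendsto (fun k => |x k i|) U (𝓝 0) := by simpa using (hx i).abs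
    have h2 : Continuous (fun t : ℝ => t ^ ((D : ℝ)⁻¹)) :=
      Real.continuous_rpow_const (by positivity)
    have h3 := (h2.tendsto 0).comp h1
    rw [Real.zero_rpow (by positivity)] at h3
    exact h3
  · have : ∀ᶠ k in (U : Filter ℕ), ∀ i, x k i = s i * |x k i| := eventually_all.2 hsx
    filter_upwards [this] with k hk
    funext i
    rw [Real.rpow_inv_natCast_pow (abs_nonneg _) hD, ← hk i]
  · intro i
    refine ⟨fun _ => s i, analyticAt_const, hs0 i, Eventually.of_forall fun v => ?_⟩
    rw [mon_single]

theorem expT_power {n : ℕ} (D : ℕ) (α : Fin n → ℕ) : expT (fun i : Fin n => Pi.single i D) α = D • α := by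
  funext j
  simp [expT, Finset.sum_apply, Pi.single_apply, mul_comm]

theorem toric_gamma {n : ℕ} {U : Ultrafilter ℕ} {x : ℕ → RV n} (hx : Tendsto x U (𝓝 0)) (d : ℕ)
    (S : Finset ℕ) (hS : S.Nonempty) (hSd : ∀ j ∈ S, j < d) (α : ℕ → Fin n → ℕ) :
    ∃ (y : ℕ → RV n) (π : RV n → RV n) (M : Fin n → Fin n → ℕ) (γ : Fin n → ℕ), Toric U x y π M ∧
      (∃ j₀ ∈ S, expT M (α j₀) = (d - j₀) • γ) ∧ ∀ j ∈ S, (d - j) • γ ≤ expT M (α j) := by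
  obtain ⟨y, π, M, ht, j₀, hj₀, hmin⟩ := toric_min hx S hS (fun j => (d.factorial / (d - j)) • α j)
  obtain ⟨z, ρ, ht'⟩ := toric_power ht.tend d.factorial (Nat.factorial_ne_zero d)
  have key : ∀ j ∈ S, expT (fun i => expT (fun i : Fin n => Pi.single i d.factorial) (M i)) (α j) =
      (d - j) • expT M ((d.factorial / (d - j)) • α j) := by
    intro j hj
    rw [expT_expT, expT_power, expT_smul, ← mul_smul, Nat.mul_div_cancel']
    have := hSd j hj
    exact Nat.dvd_factorial (by omega) (by omega)
  refine ⟨z, _, _, expT M ((d.factorial / (d - j₀)) • α j₀), ht.comp ht', ⟨j₀, hj₀, key j₀ hj₀⟩, ?_⟩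
  intro j hj
  rw [key j hj]
  intro k
  exact Nat.mul_le_mul_left _ (hmin j hj k)

/-- tail and cons -/
def tl {n : ℕ} (v : RV (n+1)) : RV n := fun i => v i.succ
def cn {n : ℕ} (z : ℝ) (y : RV n) : RV (n+1) := Fin.cons z y

@[simp] theorem cn_zero {n : ℕ} (z : ℝ) (y : RV n) : cn z y 0 = z := rfl
@[simp] theorem cn_succ {n : ℕ} (z : ℝ) (y : RV n) (i : Fin n) : cn z y i.succ = y i := rfl
@[simp] theorem tl_cn {n : ℕ} (z : ℝ) (y : RV n) : tl (cn z y) = y := rfl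
@[simp] theorem cn_tl {n : ℕ} (v : RV (n+1)) : cn (v 0) (tl v) = v := Fin.cons_self_tail v
@[simp] theorem tl_zero {n : ℕ} : tl (0 : RV (n+1)) = 0 := rfl
@[simp] theorem cn_zz {n : ℕ} : cn 0 (0 : RV n) = 0 := by
  have := cn_tl (0 : RV (n+1)); simpa using this
theorem tl_apply {n : ℕ} (v : RV (n+1)) (i : Fin n) : tl v i = v i.succ := rfl

theorem tl_analytic {n : ℕ} (x : RV (n+1)) : AnalyticAt ℝ (tl : RV (n+1) → RV n) x :=
  AnalyticAt.pi fun i => coord_analytic i.succ x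

theorem cn_analytic {E : Type*} [NormedAddCommGroup E] [NormedSpace ℝ E] {n : ℕ} {f : E → ℝ} {g : E → RV n} {x : E} (hf : AnalyticAt ℝ f x)
    (hg : AnalyticAt ℝ g x) : AnalyticAt ℝ (fun v => cn (f v) (g v)) x := by
  refine AnalyticAt.pi fun i => ?_
  refine Fin.cases ?_ (fun i => ?_) i
  · exact hf
  · exact (coord_analytic i (g x)).comp hg

theorem cn_tendsto {n : ℕ} {ι : Type*} {l : Filter ι} {f : ι → ℝ} {g : ι → RV n} (hf : Tendsto f l (𝓝 0))
    (hg : Tendsto g l (𝓝 0)) : Tendsto (fun k => cn (f k) (g k)) l (𝓝 0) := by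
  rw [tendsto_pi_nhds] at hg ⊢
  intro i
  refine Fin.cases ?_ (fun i => ?_) i
  · exact hf
  · exact hg i

theorem tl_tendsto {n : ℕ} {ι : Type*} {l : Filter ι} {f : ι → RV (n+1)} (hf : Tendsto f l (𝓝 0)) :
    Tendsto (fun k => tl (f k)) l (𝓝 0) := by
  rw [tendsto_pi_nhds] at hf ⊢
  intro i
  exact hf i.succ

theorem hd_tendsto {n : ℕ} {ι : Type*} {l : Filter ι} {f : ι → RV (n+1)} (hf : Tendsto f l (𝓝 0)) :
    Tendsto (fun k => f k 0) l (𝓝 0) := by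
  rw [tendsto_pi_nhds] at hf
  exact hf 0

/-- conclusion of the main inductive statement -/
def Good {n : ℕ} (U : Ultrafilter ℕ) (F : RV (n+1) → ℝ) (x : ℕ → RV (n+1)) : Prop :=
  ∃ (y : ℕ → RV (n+1)) (π : RV (n+1) → RV (n+1)), Chart U x y π ∧ NC (fun v => F (π v)) ∧
    ∀ i : Fin n, NC (fun v => π v i.succ)

theorem NC.comp_tl {m n : ℕ} {G : RV m → ℝ} (hG : NC G) {ρ : RV n → RV (m+1)} (hρ : AnalyticAt ℝ ρ 0)
    (h0 : ρ 0 = 0) (h : ∀ i : Fin m, NC (fun v => ρ v i.succ)) : NC (fun v => G (tl (ρ v))) := by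
  obtain ⟨α, hα⟩ := hG
  choose M hM using h
  exact ⟨_, hα.comp (π := fun v => tl (ρ v)) ((tl_analytic _).comp hρ) (by simp [h0]) hM⟩

theorem NC.congr {n : ℕ} {F G : RV n → ℝ} (hF : NC F) (h : ∀ᶠ v in 𝓝 (0 : RV n), G v = F v) :
    NC G := by
  obtain ⟨α, hα⟩ := hF
  exact ⟨α, hα.congr h⟩

theorem NC.mul {n : ℕ} {F G : RV n → ℝ} (hF : NC F) (hG : NC G) : NC (fun v => F v * G v) := by
  obtain ⟨α, hα⟩ := hF
  obtain ⟨β, hβ⟩ := hG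
  exact ⟨_, hα.mul hβ⟩

theorem Good.lift {n : ℕ} {U : Ultrafilter ℕ} {F : RV (n+1) → ℝ} {x x' : ℕ → RV (n+1)}
    {π : RV (n+1) → RV (n+1)} (hC : Chart U x x' π) (p : RV n → RV n) (hp : ∀ i, NC (fun v => p v i))
    (h : ∀ᶠ v in 𝓝 (0 : RV (n+1)), ∀ i : Fin n, π v i.succ = p (tl v) i)
    (hG : Good U (fun v => F (π v)) x') : Good U F x := by
  obtain ⟨y, ρ, hρ, h1, h2⟩ := hG
  refine ⟨y, _, hC.comp hρ, h1, fun i => ?_⟩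
  refine ((hp i).comp_tl hρ.an hρ.zero h2).congr ?_
  filter_upwards [hρ.tends.eventually h] with v hv
  exact hv i

theorem Good.congr {n : ℕ} {U : Ultrafilter ℕ} {F G : RV (n+1) → ℝ} {x : ℕ → RV (n+1)}
    (h : Good U F x) (hFG : ∀ᶠ v in 𝓝 (0 : RV (n+1)), G v = F v) : Good U G x := by
  obtain ⟨y, ρ, hρ, h1, h2⟩ := h
  exact ⟨y, ρ, hρ, h1.congr (hρ.tends.eventually hFG), h2⟩

/-- charts in the tail variables -/
theorem Chart.lift {n : ℕ} {U : Ultrafilter ℕ} {x : ℕ → RV (n+1)} (hx : Tendsto x U (𝓝 0))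
    {y : ℕ → RV n} {π : RV n → RV n} (h : Chart U (fun k => tl (x k)) y π) :
    Chart U x (fun k => cn (x k 0) (y k)) (fun v => cn (v 0) (π (tl v))) where
  an := cn_analytic (coord_analytic 0 0) (AnalyticAt.comp (f := tl) (g := π) (by simpa using h.an) (tl_analytic 0))
  zero := by simp [h.zero]
  tend := cn_tendsto (hd_tendsto hx) h.tend
  eq := by
    filter_upwards [h.eq] with k hk
    simp [hk]

theorem implicit_analytic {n : ℕ} {A : RV (n+1) → ℝ} (hA : AnalyticAt ℝ A 0) (hA0 : A 0 = 0) {c : ℝ}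
    (hc : c ≠ 0) (hd : HasDerivAt (fun s => A (cn s 0)) c 0) :
    ∃ φ : RV n → ℝ, AnalyticAt ℝ φ 0 ∧ φ 0 = 0 ∧ ∀ᶠ y in 𝓝 (0 : RV n), A (cn (φ y) y) = 0 := by
  set f : RV n × ℝ → ℝ := fun p => A (cn p.2 p.1) with hf
  have hfa : AnalyticAt ℝ f 0 := by
    refine AnalyticAt.comp (f := fun p : RV n × ℝ => cn p.2 p.1) (g := A) ?_ (cn_analytic analyticAt_snd analyticAt_fst)
    simpa using hA
  have cd : ContDiffAt ℝ ⊤ f 0 := hfa.contDiffAt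
  have hinv : (fderiv ℝ f 0 ∘L .inr ℝ (RV n) ℝ).IsInvertible := by
    refine ⟨ContinuousLinearEquiv.unitsEquivAut ℝ (Units.mk0 c hc), ?_⟩
    ext
    have h1 : HasDerivAt (fun s : ℝ => f (0, s)) (fderiv ℝ f 0 (0, 1)) 0 := by
      have h2 : HasDerivAt (fun s : ℝ => ((0 : RV n), s)) (0, 1) 0 :=
        (hasDerivAt_const (0:ℝ) (0 : RV n)).prodMk (hasDerivAt_id _)
      exact (hfa.differentiableAt.hasFDerivAt (x := (0, 0))).comp_hasDerivAt (0 : ℝ) h2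
    simpa using (hd.unique h1)
  refine ⟨cd.implicitFunction (by simp) hinv, ?_, ?_, ?_⟩
  · exact (cd.contDiffAt_implicitFunction (by simp) hinv).analyticAt
  · exact cd.implicitFunction_apply_self (by simp) hinv
  · have := cd.eventually_apply_implicitFunction (by simp) hinv
    filter_upwards [this] with y hy
    have e : f 0 = 0 := by simp [hf, hA0]
    rw [e] at hy
    exact hy

theorem coef_lemma {g u : ℝ → ℝ} (d : ℕ) (c : ℕ → ℝ) (hu : AnalyticAt ℝ u 0)
    (h : ∀ᶠ z in 𝓝 (0 : ℝ), g z = ∑ j ∈ Finset.range d, c j * z ^ j + z ^ d * u z) :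
    ∀ j < d, iteratedDeriv j g 0 = j.factorial * c j := by
  intro j hj
  have h1 : iteratedDeriv j g 0 =
      iteratedDeriv j (fun z => ∑ j ∈ Finset.range d, c j * z ^ j + z ^ d * u z) 0 :=
    Filter.EventuallyEq.iteratedDeriv_eq j h
  have ha : AnalyticAt ℝ (fun z : ℝ => ∑ j ∈ Finset.range d, c j * z ^ j) 0 := by
    refine Finset.analyticAt_fun_sum _ fun i hi ↦ ?_
    fun_prop
  have hb : AnalyticAt ℝ (fun z : ℝ => z ^ d * u z) 0 := by fun_prop
  have h2 : iteratedDeriv j (fun z : ℝ => z ^ d * u z) 0 = 0 := by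
    refine (natCast_le_analyticOrderAt_iff_iteratedDeriv_eq_zero hb).1 ?_ j hj
    rw [natCast_le_analyticOrderAt hb]
    exact ⟨u, hu, by simp⟩
  rw [h1, iteratedDeriv_fun_add ha.contDiffAt hb.contDiffAt, h2, add_zero]
  rw [iteratedDeriv_fun_sum]
  · have e : ∀ i, iteratedDeriv j (fun z : ℝ => c i * z ^ i) 0 = c i * (if j = i then (i.factorial : ℝ) else 0) := by
      intro i
      rw [iteratedDeriv_const_mul_field, iteratedDeriv_fun_pow_zero]
      split_ifs <;> simp
    simp only [e, mul_ite, mul_zero, Finset.sum_ite_eq, Finset.mem_range, hj, if_true]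
    ring
  · intro i hi
    fun_prop

theorem killP_cn {n : ℕ} (v : RV (n+1)) : killP 0 v = cn 0 (tl v) := by
  rw [killP_apply]
  funext i
  refine Fin.cases ?_ (fun i => ?_) i
  · simp
  · simp [tl]

theorem expand {n : ℕ} (d : ℕ) {F : RV (n+1) → ℝ} (hF : AnalyticAt ℝ F 0) :
    ∃ (a : ℕ → RV n → ℝ) (u : RV (n+1) → ℝ), (∀ j, AnalyticAt ℝ (a j) 0) ∧ AnalyticAt ℝ u 0 ∧
      ∀ᶠ v in 𝓝 (0 : RV (n+1)), F v = ∑ j ∈ Finset.range d, a j (tl v) * v 0 ^ j + v 0 ^ d * u v := by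
  induction d with
  | zero => exact ⟨fun _ _ => 0, F, fun _ => analyticAt_const, hF, by simp⟩
  | succ d ih =>
    obtain ⟨a, u, ha, hu, h⟩ := ih
    obtain ⟨H, hH, hH'⟩ := hadamard_coord hu 0
    refine ⟨fun j => if j = d then fun y => u (cn 0 y) else a j, H, ?_, hH, ?_⟩
    · intro j
      by_cases hj : j = d
      · simp only [hj, if_true]
        exact AnalyticAt.comp (by simpa using hu) (cn_analytic analyticAt_const analyticAt_id)
      · simpa [hj] using ha j
    · filter_upwards [h, hH'] with v h1 h2
      rw [h1, Finset.sum_range_succ, h2, killP_cn]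
      have : ∀ j ∈ Finset.range d, (if j = d then (fun y => u (cn 0 y)) else a j) (tl v) * v 0 ^ j = a j (tl v) * v 0 ^ j := by
        intro j hj
        rw [if_neg (Finset.mem_range.1 hj).ne]
      rw [Finset.sum_congr rfl this]
      simp only [if_true]
      ring

theorem cn_continuous {n : ℕ} (y : RV n) : Continuous (fun z : ℝ => cn z y) := by
  refine continuous_pi fun i => ?_
  refine Fin.cases ?_ (fun i => ?_) i
  · exact continuous_id
  · exact continuous_const

theorem cn_continuous' {n : ℕ} (z : ℝ) : Continuous (fun y : RV n => cn z y) := by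
  refine continuous_pi fun i => ?_
  refine Fin.cases ?_ (fun i => ?_) i
  · exact continuous_const
  · exact continuous_apply i

theorem tschirn {n : ℕ} {F : RV (n+1) → ℝ} (hF : AnalyticAt ℝ F 0) {d : ℕ} (hd : 0 < d)
    (ho : analyticOrderAt (fun z => F (cn z 0)) 0 = d) :
    ∃ (φ : RV n → ℝ) (a : ℕ → RV n → ℝ) (u : RV (n+1) → ℝ), AnalyticAt ℝ φ 0 ∧ φ 0 = 0 ∧
      (∀ j, AnalyticAt ℝ (a j) 0) ∧ AnalyticAt ℝ u 0 ∧ (∀ j < d, a j 0 = 0) ∧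
      (∀ᶠ y in 𝓝 (0 : RV n), a (d-1) y = 0) ∧ u 0 ≠ 0 ∧
      ∀ᶠ v in 𝓝 (0 : RV (n+1)), F (cn (v 0 + φ (tl v)) (tl v)) =
        ∑ j ∈ Finset.range d, a j (tl v) * v 0 ^ j + v 0 ^ d * u v := by
  set g : ℝ → ℝ := fun z => F (cn z 0) with hg
  have hga : AnalyticAt ℝ g 0 :=
    AnalyticAt.comp (g := F) (f := fun z : ℝ => cn z 0) (by simpa using hF) (cn_analytic analyticAt_id analyticAt_const)
  set G : RV (n+2) → ℝ := fun w => F (cn (w 0 + w 1) (tl (tl w))) with hG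
  have hGa : AnalyticAt ℝ G 0 := by
    refine AnalyticAt.comp (g := F) (f := fun w : RV (n+2) => cn (w 0 + w 1) (tl (tl w))) (by simpa using hF) ?_
    refine cn_analytic ((coord_analytic 0 0).add (coord_analytic 1 0)) ?_
    exact (tl_analytic _).comp (tl_analytic _)
  obtain ⟨A, R, hA, hR, hexp⟩ := expand d hGa
  have hev : ∀ᶠ s in 𝓝 (0 : ℝ), (∀ᶠ z in 𝓝 (0:ℝ), g (z + s) =
      ∑ j ∈ Finset.range d, A j (cn s 0) * z ^ j + z ^ d * R (cn z (cn s 0))) ∧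
      AnalyticAt ℝ (fun z => R (cn z (cn s 0))) 0 := by
    have h1 := hexp.eventually_nhds.and hR.eventually_analyticAt
    have ht : Tendsto (fun s : ℝ => cn 0 (cn s (0 : RV n))) (𝓝 0) (𝓝 0) := by
      have := ((cn_continuous' 0).comp (cn_continuous (0 : RV n))).tendsto 0
      simpa [Function.comp_def] using this
    filter_upwards [ht.eventually h1] with s ⟨hs1, hs2⟩
    refine ⟨?_, ?_⟩
    · filter_upwards [((cn_continuous (cn s (0 : RV n))).tendsto 0).eventually hs1] with z hz
      simpa [hG, hg, show cn z (cn s (0 : RV n)) 1 = s from rfl] using hz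
    · exact AnalyticAt.comp (g := R) (f := fun z : ℝ => cn z (cn s 0)) hs2 (cn_analytic analyticAt_id analyticAt_const)
  have hcoef : ∀ᶠ s in 𝓝 (0 : ℝ), ∀ j < d, iteratedDeriv j g s = j.factorial * A j (cn s 0) := by
    filter_upwards [hev] with s ⟨hs1, hs2⟩ j hj
    rw [← coef_lemma d _ hs2 hs1 j hj, iteratedDeriv_comp_add_const]
    simp
  obtain ⟨o1, o2⟩ := (analyticOrderAt_eq_nat_iff_iteratedDeriv_eq_zero hga).1 ho
  have hA0 : ∀ j < d, A j 0 = 0 := by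
    intro j hj
    have := hcoef.self_of_nhds j hj
    rw [o1 j hj, cn_zz] at this
    have h3 : (j.factorial : ℝ) ≠ 0 := by exact_mod_cast j.factorial_ne_zero
    rcases mul_eq_zero.1 this.symm with h | h
    · exact absurd h h3
    · exact h
  have hfac : ((d-1).factorial : ℝ) ≠ 0 := by exact_mod_cast (d-1).factorial_ne_zero
  have hder : HasDerivAt (fun s => A (d-1) (cn s 0)) (((d-1).factorial : ℝ)⁻¹ * iteratedDeriv d g 0) 0 := by
    have h1 : HasDerivAt (iteratedDeriv (d-1) g) (iteratedDeriv d g 0) 0 := by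
      have : d = (d-1) + 1 := by omega
      conv => enter [2]; rw [this, iteratedDeriv_succ]
      have := hga.iterated_deriv (d-1)
      rw [← iteratedDeriv_eq_iterate] at this
      exact this.differentiableAt.hasDerivAt
    refine (h1.const_mul _).congr_of_eventuallyEq ?_
    filter_upwards [hcoef] with s hs
    rw [hs (d-1) (by omega), inv_mul_cancel_left₀ hfac]
  obtain ⟨φ, hφ, hφ0, hφA⟩ := implicit_analytic (hA (d-1)) (hA0 _ (by omega))
    (mul_ne_zero (inv_ne_zero hfac) o2) hder
  have hR0 : R 0 ≠ 0 := by
    obtain ⟨h1, h2⟩ := hev.self_of_nhds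
    have e : (fun z => F (cn z 0)) =ᶠ[𝓝 0] ((fun z : ℝ => z ^ d) * fun z => R (cn z (cn 0 0))) := by
      filter_upwards [h1] with z hz
      simp only [add_zero] at hz
      rw [show F (cn z 0) = g z from rfl, hz, Finset.sum_eq_zero, zero_add]
      · rfl
      · intro j hj
        rw [cn_zz, hA0 j (Finset.mem_range.1 hj), zero_mul]
    rw [analyticOrderAt_congr e, analyticOrderAt_mul (by fun_prop) h2] at ho
    intro hc
    have h3 : analyticOrderAt (fun z : ℝ => R (cn z (cn 0 0))) 0 ≠ 0 := by
      rw [h2.analyticOrderAt_ne_zero]; simpa using hc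
    have h4 : analyticOrderAt (fun z : ℝ => z ^ d) 0 = d := by
      have := analyticOrderAt_centeredMonomial (𝕜 := ℝ) (z₀ := 0) (n := d)
      simpa [Pi.pow_def] using this
    rw [h4] at ho
    apply h3
    have : (d : ℕ∞) + analyticOrderAt (fun z : ℝ => R (cn z (cn 0 0))) 0 = d + 0 := by rw [ho, add_zero]
    exact ENat.add_right_injective_of_ne_top (ENat.natCast_ne_top d) this
  have hcφ : AnalyticAt ℝ (fun y : RV n => cn (φ y) y) 0 := cn_analytic hφ analyticAt_id
  have hcφ0 : cn (φ 0) (0 : RV n) = 0 := by rw [hφ0, cn_zz]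
  have hψ : AnalyticAt ℝ (fun v : RV (n+1) => cn (v 0) (cn (φ (tl v)) (tl v))) 0 := by
    refine cn_analytic (coord_analytic 0 0) (AnalyticAt.comp (g := fun y : RV n => cn (φ y) y) (f := tl) ?_ (tl_analytic 0))
    simpa using hcφ
  have hψ0 : cn ((0 : RV (n+1)) 0) (cn (φ (tl (0 : RV (n+1)))) (tl (0 : RV (n+1)))) = 0 := by
    simp [hφ0]
  refine ⟨φ, fun j y => A j (cn (φ y) y), fun v => R (cn (v 0) (cn (φ (tl v)) (tl v))), hφ, hφ0, ?_, ?_, ?_, hφA, ?_, ?_⟩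
  · intro j
    exact AnalyticAt.comp (g := A j) (f := fun y : RV n => cn (φ y) y) (by rw [hcφ0]; exact hA j) hcφ
  · exact AnalyticAt.comp (g := R) (by rw [hψ0]; exact hR) hψ
  · intro j hj
    simp only [hcφ0]; exact hA0 j hj
  · simpa [hφ0] using hR0
  · have ht : Tendsto (fun v : RV (n+1) => cn (v 0) (cn (φ (tl v)) (tl v))) (𝓝 0) (𝓝 0) := by
      have := hψ.continuousAt.tendsto
      rwa [hψ0] at this
    filter_upwards [ht.eventually hexp] with v hv
    simpa [hG, show cn (v 0) (cn (φ (tl v)) (tl v)) 1 = φ (tl v) from rfl] using hv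

theorem order_lt {d : ℕ} (hd : 0 < d) (b : ℕ → ℝ) (hb : b (d-1) = 0) {j₀ : ℕ} (hj₀ : j₀ < d) (hbj : b j₀ ≠ 0)
    {u0 : ℝ} (hu : u0 ≠ 0) (c : ℝ) :
    analyticOrderAt (fun z : ℝ => ∑ j ∈ Finset.range d, b j * (c + z) ^ j + (c + z) ^ d * u0) 0 < d := by
  by_contra hcon
  push Not at hcon
  set g : ℝ → ℝ := fun z : ℝ => ∑ j ∈ Finset.range d, b j * (c + z) ^ j + (c + z) ^ d * u0 with hg
  have hga : AnalyticAt ℝ g 0 := by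
    have : AnalyticAt ℝ (fun z : ℝ => ∑ j ∈ Finset.range d, b j * (c + z) ^ j) 0 := by
      refine Finset.analyticAt_fun_sum _ fun i hi ↦ ?_
      fun_prop
    rw [hg]
    exact this.add (by fun_prop)
  rw [natCast_le_analyticOrderAt_iff_iteratedDeriv_eq_zero hga] at hcon
  set P : Polynomial ℝ := ∑ j ∈ Finset.range d, Polynomial.C (b j) * Polynomial.X ^ j + Polynomial.C u0 * Polynomial.X ^ d with hP
  have hPc : ∀ k < d, P.coeff k = b k := by
    intro k hk
    simp [hP, Polynomial.finsetSum_coeff, Polynomial.coeff_X_pow, hk, hk.ne]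
  have hPd : P.coeff d = u0 := by
    simp [hP, Polynomial.finsetSum_coeff, Polynomial.coeff_X_pow]
  have hPdeg : P.natDegree ≤ d := by
    rw [Polynomial.natDegree_le_iff_coeff_eq_zero]
    intro N hN
    simp only [hP, Polynomial.coeff_add, Polynomial.finsetSum_coeff, Polynomial.coeff_C_mul, Polynomial.coeff_X_pow]
    rw [Finset.sum_eq_zero, if_neg hN.ne']
    · simp
    · intro j hj
      have := Finset.mem_range.1 hj
      rw [if_neg (by omega)]; simp
  set Q := P.comp (Polynomial.X + Polynomial.C c) with hQ
  have hQdeg : Q.natDegree ≤ d := by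
    refine Polynomial.natDegree_comp_le.trans ?_
    rw [Polynomial.natDegree_X_add_C, mul_one]; exact hPdeg
  have hgQ : ∀ z, g z = Q.eval z := by
    intro z
    simp [hg, hQ, hP, Polynomial.eval_finsetSum, add_comm c z, mul_comm u0]
  have hQexp : ∀ᶠ z in 𝓝 (0 : ℝ), g z = ∑ j ∈ Finset.range d, Q.coeff j * z ^ j + z ^ d * Q.coeff d := by
    refine Eventually.of_forall fun z => ?_
    rw [hgQ, Polynomial.eval_eq_sum_range' (n := d+1) (by omega), Finset.sum_range_succ, mul_comm (z ^ d)]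
  have hQ0 : ∀ j < d, Q.coeff j = 0 := by
    intro j hj
    have := coef_lemma (u := fun _ => Q.coeff d) d _ analyticAt_const hQexp j hj
    rw [hcon j hj] at this
    have h3 : (j.factorial : ℝ) ≠ 0 := by exact_mod_cast j.factorial_ne_zero
    rcases mul_eq_zero.1 this.symm with h | h
    · exact absurd h h3
    · exact h
  have hQeq : Q = Polynomial.C (Q.coeff d) * Polynomial.X ^ d := by
    ext k
    rw [Polynomial.coeff_C_mul, Polynomial.coeff_X_pow]
    rcases lt_trichotomy k d with h | h | h
    · rw [hQ0 k h, if_neg h.ne, mul_zero]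
    · subst h; simp
    · rw [if_neg h.ne', mul_zero, Polynomial.coeff_eq_zero_of_natDegree_lt (by omega)]
  have hPeq : P = Polynomial.C (Q.coeff d) * (Polynomial.X + Polynomial.C (-c)) ^ d := by
    have : P = Q.comp (Polynomial.X + Polynomial.C (-c)) := by
      rw [hQ, Polynomial.comp_assoc]
      simp
    rw [this, hQeq]
    simp
  have e1 : u0 = Q.coeff d := by
    rw [← hPd, hPeq, Polynomial.coeff_C_mul, Polynomial.coeff_X_add_C_pow]; simp
  have e2 : 0 = Q.coeff d * (-c * d) := by
    have h0 := hPc (d-1) (by omega)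
    rw [hb, hPeq, Polynomial.coeff_C_mul, Polynomial.coeff_X_add_C_pow] at h0
    have a1 : d - (d-1) = 1 := by omega
    have a2 : d.choose (d-1) = d := by
      rw [Nat.choose_symm (n := d) (k := 1) (by omega)]; simp
    rw [a1, a2, pow_one] at h0
    exact h0.symm
  have hdR : (d : ℝ) ≠ 0 := by exact_mod_cast hd.ne'
  have hc : c = 0 := by
    rw [← e1] at e2
    have := mul_eq_zero.1 e2.symm
    rcases this with h | h
    · exact absurd h hu
    · rcases mul_eq_zero.1 h with h | h
      · linarith
      · exact absurd h hdR
  apply hbj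
  rw [← hPc j₀ hj₀, hPeq, hc, Polynomial.coeff_C_mul, Polynomial.coeff_X_add_C_pow]
  rw [neg_zero, zero_pow (by omega)]; simp

theorem Good.mul_tl {n : ℕ} {U : Ultrafilter ℕ} {G : RV (n+1) → ℝ} {x : ℕ → RV (n+1)}
    (h : Good U G x) {m : RV n → ℝ} (hm : NC m) : Good U (fun v => m (tl v) * G v) x := by
  obtain ⟨y, ρ, hρ, h1, h2⟩ := h
  exact ⟨y, ρ, hρ, (hm.comp_tl hρ.an hρ.zero h2).mul h1, h2⟩

theorem caseA {n : ℕ} {U : Ultrafilter ℕ} {d : ℕ} (hd : 0 < d)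
    (ih : ∀ d' < d, ∀ (G : RV (n+1) → ℝ), AnalyticAt ℝ G 0 → analyticOrderAt (fun z => G (cn z 0)) 0 = d' →
      ∀ x : ℕ → RV (n+1), Tendsto x U (𝓝 0) → Good U G x)
    {F : RV (n+1) → ℝ} {b : ℕ → RV n → ℝ} {u : RV (n+1) → ℝ} {γ : Fin n → ℕ} (hγ : γ ≠ 0)
    (hb : ∀ j, AnalyticAt ℝ (b j) 0) (hbd : b (d-1) 0 = 0) {j₀ : ℕ} (hj₀ : j₀ < d) (hbj : b j₀ 0 ≠ 0)
    (hu : AnalyticAt ℝ u 0) (hu0 : u 0 ≠ 0)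
    (hF : ∀ᶠ v in 𝓝 (0 : RV (n+1)), F v =
      ∑ j ∈ Finset.range d, b j (tl v) * mon ((d - j) • γ) (tl v) * v 0 ^ j + v 0 ^ d * u v)
    {x : ℕ → RV (n+1)} (hx : Tendsto x U (𝓝 0)) {C : ℝ}
    (hC : ∀ᶠ k in (U : Filter ℕ), |x k 0| ≤ C * |mon γ (tl (x k))|) : Good U F x := by
  have hw : ∀ᶠ k in (U : Filter ℕ), |x k 0 / mon γ (tl (x k))| ≤ |C| := by
    filter_upwards [hC] with k hk
    rw [abs_div]
    refine div_le_of_le_mul₀ (abs_nonneg _) (abs_nonneg _) (hk.trans ?_)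
    exact mul_le_mul_of_nonneg_right (le_abs_self C) (abs_nonneg _)
  obtain ⟨c, -, hc⟩ := ultra_lim hw
  set π : RV (n+1) → RV (n+1) := fun v => cn (mon γ (tl v) * (c + v 0)) (tl v) with hπ
  have hmon : AnalyticAt ℝ (fun v : RV (n+1) => mon γ (tl v)) 0 :=
    AnalyticAt.comp (g := mon γ) (f := tl) (mon_analytic γ _) (tl_analytic 0)
  have hch : Chart U x (fun k => cn (x k 0 / mon γ (tl (x k)) - c) (tl (x k))) π := by
    refine ⟨?_, ?_, ?_, ?_⟩
    · exact cn_analytic (hmon.mul (analyticAt_const.add (coord_analytic 0 0))) (tl_analytic 0)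
    · simp [hπ, mon_at_zero hγ]
    · refine cn_tendsto ?_ (tl_tendsto hx)
      have := hc.sub_const c
      simpa using this
    · filter_upwards [hC] with k hk
      simp only [hπ, tl_cn, cn_zero]
      have : mon γ (tl (x k)) * (c + (x k 0 / mon γ (tl (x k)) - c)) = x k 0 := by
        by_cases h0 : mon γ (tl (x k)) = 0
        · rw [h0] at hk ⊢
          simp at hk
          simp [hk]
        · field_simp; ring
      rw [this, cn_tl]
  set G : RV (n+1) → ℝ := fun v => ∑ j ∈ Finset.range d, b j (tl v) * (c + v 0) ^ j + (c + v 0) ^ d * u (π v) with hG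
  have hGa : AnalyticAt ℝ G 0 := by
    have hc0 : AnalyticAt ℝ (fun v : RV (n+1) => c + v 0) 0 := analyticAt_const.add (coord_analytic 0 0)
    refine AnalyticAt.add (Finset.analyticAt_fun_sum _ fun j _ => ?_) ?_
    · refine AnalyticAt.mul ?_ (hc0.pow j)
      exact AnalyticAt.comp (g := b j) (f := tl) (by simpa using hb j) (tl_analytic 0)
    · exact (hc0.pow d).mul (AnalyticAt.comp (by rw [hch.zero]; exact hu) hch.an)
  have hord : analyticOrderAt (fun z => G (cn z 0)) 0 < d := by
    have e : (fun z => G (cn z 0)) = fun z : ℝ => ∑ j ∈ Finset.range d, b j 0 * (c + z) ^ j + (c + z) ^ d * u 0 := by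
      funext z
      simp only [hG, hπ, tl_cn, cn_zero, mon_at_zero hγ, zero_mul, cn_zz]
    rw [e]
    exact order_lt hd (fun j => b j 0) hbd hj₀ hbj hu0 c
  obtain ⟨d', hd'⟩ := ENat.ne_top_iff_exists.1 hord.ne_top
  have hd'' : d' < d := by rw [← hd'] at hord; exact_mod_cast hord
  have hgood := ih d' hd'' G hGa hd'.symm _ hch.tend
  have h2 := hgood.mul_tl (m := mon (d • γ)) ⟨_, NCx.mon' _⟩
  refine Good.lift hch (fun y => y) (fun i => ⟨_, NCx.coord i⟩) (by simp [hπ]) ?_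
  refine h2.congr ?_
  filter_upwards [hch.tends.eventually hF] with v hv
  rw [hv]
  simp only [hG]
  have e0 : tl (π v) = tl v := rfl
  have e1 : π v 0 = mon γ (tl v) * (c + v 0) := rfl
  rw [e0, e1, mul_add (mon (d • γ) (tl v)), Finset.mul_sum, mon_smul]
  congr 1
  · refine Finset.sum_congr rfl fun j hj => ?_
    have hj' := Finset.mem_range.1 hj
    have : d = (d - j) + j := by omega
    rw [mon_smul, mul_pow]
    conv_rhs => rw [this, pow_add]
    ring
  · rw [mul_pow]; ring

theorem mon_cons {n : ℕ} (γ : Fin n → ℕ) (v : RV (n+1)) : mon (Fin.cons 0 γ : Fin (n+1) → ℕ) v = mon γ (tl v) := by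
  simp [mon, Fin.prod_univ_succ, tl]

theorem caseB {n : ℕ} {U : Ultrafilter ℕ} {d : ℕ}
    {F : RV (n+1) → ℝ} {b : ℕ → RV n → ℝ} {u : RV (n+1) → ℝ} {γ : Fin n → ℕ}
    (hb : ∀ j, AnalyticAt ℝ (b j) 0)
    (hu : AnalyticAt ℝ u 0) (hu0 : u 0 ≠ 0)
    (hF : ∀ᶠ v in 𝓝 (0 : RV (n+1)), F v =
      ∑ j ∈ Finset.range d, b j (tl v) * mon ((d - j) • γ) (tl v) * v 0 ^ j + v 0 ^ d * u v)
    {x : ℕ → RV (n+1)} (hx : Tendsto x U (𝓝 0))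
    (hC : ¬ ∃ C : ℝ, ∀ᶠ k in (U : Filter ℕ), |x k 0| ≤ C * |mon γ (tl (x k))|) : Good U F x := by
  obtain ⟨y, π, M, ht, hcmp⟩ := toric_compare _ hx (Pi.single 0 1) (Fin.cons 0 γ) rfl
  have hA := (NCx.mon' (Pi.single (0 : Fin (n+1)) 1)).comp ht.an ht.zero ht.nc
  have hB := (NCx.mon' (Fin.cons 0 γ : Fin (n+1) → ℕ)).comp ht.an ht.zero ht.nc
  simp only [mon_single, pow_one] at hA
  simp only [mon_cons] at hB
  have hA' := hA
  obtain ⟨u1, hu1, hu10, h1⟩ := hA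
  obtain ⟨u2, hu2, hu20, h2⟩ := hB
  have hu1ev : ∀ᶠ v in 𝓝 (0 : RV (n+1)), u1 v ≠ 0 := hu1.continuousAt.eventually_ne hu10
  have hu2ev : ∀ᶠ v in 𝓝 (0 : RV (n+1)), u2 v ≠ 0 := hu2.continuousAt.eventually_ne hu20
  -- contradiction from a bounded quotient
  have hcontra : ∀ H : RV (n+1) → ℝ, AnalyticAt ℝ H 0 →
      (∀ᶠ v in 𝓝 (0 : RV (n+1)), π v 0 = H v * mon γ (tl (π v))) → False := by
    intro H hH hev
    apply hC
    refine ⟨|H 0| + 1, ?_⟩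
    have hb : ∀ᶠ v in 𝓝 (0 : RV (n+1)), |H v| < |H 0| + 1 :=
      hH.continuousAt.abs.eventually_lt_const (by linarith)
    filter_upwards [ht.tend.eventually hev, ht.tend.eventually hb, ht.eq] with k a1 a2 a3
    rw [a3] at a1
    rw [a1, abs_mul]
    exact mul_le_mul_of_nonneg_right a2.le (abs_nonneg _)
  set A := expT M (Pi.single (0 : Fin (n+1)) 1) with hAdef
  set B := expT M (Fin.cons 0 γ : Fin (n+1) → ℕ) with hBdef
  rcases hcmp with hle | hle
  swap
  · exfalso
    refine hcontra (fun v => u1 v / u2 v * mon (A - B) v) ((hu1.div hu2 hu20).mul (mon_analytic _ _)) ?_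
    filter_upwards [h1, h2, hu2ev] with v a1 a2 a3
    rw [a1, a2, mon_sub hle]
    field_simp
  by_cases hAB : A = B
  · exfalso
    refine hcontra (fun v => u1 v / u2 v) (hu1.div hu2 hu20) ?_
    filter_upwards [h1, h2, hu2ev] with v a1 a2 a3
    rw [a1, a2, hAB]
    field_simp
  set h : RV (n+1) → ℝ := fun v => u2 v / u1 v * mon (B - A) v with hh
  have hha : AnalyticAt ℝ h 0 := (hu2.div hu1 hu10).mul (mon_analytic _ _)
  have hh0 : h 0 = 0 := by
    have : B - A ≠ 0 := by
      intro h0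
      apply hAB
      exact le_antisymm hle (tsub_eq_zero_iff_le.1 h0)
    simp [hh, mon_at_zero this]
  have hhev : ∀ᶠ v in 𝓝 (0 : RV (n+1)), mon γ (tl (π v)) = h v * π v 0 := by
    filter_upwards [h1, h2, hu1ev] with v a1 a2 a3
    rw [a1, a2, mon_sub hle]
    simp only [hh]
    field_simp
  set E : RV (n+1) → ℝ := fun v => ∑ j ∈ Finset.range d, b j (tl (π v)) * h v ^ (d - j) + u (π v) with hE
  have hEa : AnalyticAt ℝ E 0 := by
    refine AnalyticAt.add (Finset.analyticAt_fun_sum _ fun j _ => ?_) ?_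
    · refine AnalyticAt.mul ?_ (hha.pow _)
      refine AnalyticAt.comp (g := b j) (f := fun v => tl (π v)) (by simpa [ht.zero] using hb j) ?_
      exact (tl_analytic _).comp ht.an
    · exact AnalyticAt.comp (by rw [ht.zero]; exact hu) ht.an
  have hE0 : E 0 ≠ 0 := by
    have : E 0 = u 0 := by
      simp only [hE, hh0, ht.zero]
      rw [Finset.sum_eq_zero, zero_add]
      intro j hj
      have := Finset.mem_range.1 hj
      rw [zero_pow (by omega), mul_zero]
    rwa [this]
  refine ⟨y, π, ht.toChart, ?_, fun i => ⟨_, ht.nc i.succ⟩⟩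
  refine ⟨_, ((hA'.pow d).mul (NCx.unit hEa hE0)).congr ?_⟩
  filter_upwards [ht.tends.eventually hF, hhev] with v a1 a2
  rw [a1]
  simp only [hE]
  rw [mul_add, Finset.mul_sum]
  congr 1
  refine Finset.sum_congr rfl fun j hj => ?_
  have hj' := Finset.mem_range.1 hj
  have : d = (d - j) + j := by omega
  rw [mon_smul, a2, mul_pow]
  conv_rhs => rw [this, pow_add]
  rw [← this]
  ring

def PN (U : Ultrafilter ℕ) (n : ℕ) : Prop := ∀ F : RV n → ℝ, AnalyticAt ℝ F 0 →
  (¬ ∀ᶠ v in 𝓝 (0 : RV n), F v = 0) → ∀ x : ℕ → RV n, Tendsto x U (𝓝 0) →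
  ∃ (y : ℕ → RV n) (π : RV n → RV n), Chart U x y π ∧ NC (fun v => F (π v))

theorem prep {n : ℕ} {U : Ultrafilter ℕ} (hP : PN U n) {d : ℕ} (S : Finset ℕ) (hS : S.Nonempty)
    (hSd : ∀ j ∈ S, j < d) {a : ℕ → RV n → ℝ} (ha : ∀ j, AnalyticAt ℝ (a j) 0)
    (hnz : ∀ j ∈ S, ¬ ∀ᶠ v in 𝓝 (0 : RV n), a j v = 0) (ha0 : ∀ j < d, a j 0 = 0)
    {x : ℕ → RV n} (hx : Tendsto x U (𝓝 0)) :
    ∃ (y : ℕ → RV n) (π : RV n → RV n) (γ : Fin n → ℕ) (b : ℕ → RV n → ℝ),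
      Chart U x y π ∧ (∀ i, NC (fun v => π v i)) ∧ γ ≠ 0 ∧ (∀ j, AnalyticAt ℝ (b j) 0) ∧
      (∃ j₀ ∈ S, b j₀ 0 ≠ 0) ∧
      (∀ j ∈ S, ∀ᶠ v in 𝓝 (0 : RV n), a j (π v) = b j v * mon ((d - j) • γ) v) ∧ (∀ j ∉ S, b j = 0) := by
  classical
  have hA1 : AnalyticAt ℝ (fun v => ∏ j ∈ S, a j v) 0 := Finset.analyticAt_fun_prod _ fun j _ => ha j
  have hA2 : AnalyticAt ℝ (fun v : RV n => ∏ i, v i) 0 := Finset.analyticAt_fun_prod _ fun j _ => coord_analytic j 0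
  obtain ⟨y, π, hch, hnc⟩ := hP (fun v => (∏ j ∈ S, a j v) * ∏ i, v i) (hA1.mul hA2) (by
    intro h
    rcases germ_domain hA1 hA2 h with h | h
    · exact prod_not_zero S (fun j _ => ha j) hnz h
    · exact prod_not_zero Finset.univ (fun j _ => coord_analytic j 0) (fun j _ => coord_not_zero j) h) x hx
  have hcomp : ∀ G : RV n → ℝ, AnalyticAt ℝ G 0 → AnalyticAt ℝ (fun v => G (π v)) 0 := fun G hG =>
    AnalyticAt.comp (by rw [hch.zero]; exact hG) hch.an
  have n1 : NC (fun v => ∏ j ∈ S, a j (π v)) := NC.of_mul (hcomp _ hA1) (hcomp _ hA2) hnc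
  have n2 : NC (fun v => ∏ i, (π v) i) := by
    refine NC.of_mul (hcomp _ hA2) (hcomp _ hA1) ?_
    convert hnc using 2
    exact mul_comm _ _
  have n3 := NC.of_prod S (F := fun j v => a j (π v)) (fun j _ => hcomp _ (ha j)) n1
  have n4 := NC.of_prod Finset.univ (F := fun i v => (π v) i) (fun j _ => hcomp _ (coord_analytic j 0)) n2
  choose! α hα using n3
  choose N hN using fun i => n4 i (Finset.mem_univ i)
  obtain ⟨z, ρ, M, γ, ht, ⟨j₀, hj₀, hj₀e⟩, hle⟩ := toric_gamma hch.tend d S hS hSd α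
  have hNC : ∀ j ∈ S, NCx (fun v => a j (π (ρ v))) (expT M (α j)) := fun j hj =>
    (hα j hj).comp ht.an ht.zero ht.nc
  choose! c hc hc0 hce using hNC
  refine ⟨z, _, γ, fun j => if j ∈ S then fun v => c j v * mon (expT M (α j) - (d - j) • γ) v else 0,
    hch.comp ht.toChart, fun i => ⟨_, (hN i).comp ht.an ht.zero ht.nc⟩, ?_, ?_, ⟨j₀, hj₀, ?_⟩, ?_, ?_⟩
  · rintro rfl
    have h1 := (hce j₀ hj₀).self_of_nhds
    beta_reduce at h1
    rw [ht.zero, hch.zero, ha0 _ (hSd _ hj₀), hj₀e, smul_zero, mon_zero, mul_one] at h1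
    exact hc0 j₀ hj₀ h1.symm
  · intro j
    by_cases hj : j ∈ S
    · simp only [hj, if_true]
      exact (hc j hj).mul (mon_analytic _ _)
    · simp only [hj, if_false]
      exact analyticAt_const
  · simp only [hj₀, if_true, hj₀e, tsub_self, mon_zero, mul_one]
    exact hc0 j₀ hj₀
  · intro j hj
    filter_upwards [hce j hj] with v hv
    simp only [hj, if_true]
    rw [hv, mul_assoc, ← mon_sub (hle j hj)]
  · intro j hj
    simp [hj]

theorem QN {n : ℕ} {U : Ultrafilter ℕ} (hP : PN U n) (d : ℕ) : ∀ (G : RV (n+1) → ℝ), AnalyticAt ℝ G 0 →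
      analyticOrderAt (fun z => G (cn z 0)) 0 = d →
      ∀ x : ℕ → RV (n+1), Tendsto x U (𝓝 0) → Good U G x := by
  classical
  induction d using Nat.strong_induction_on with
  | _ d ih =>
  intro F hF hord x hx
  have hga : AnalyticAt ℝ (fun z => F (cn z 0)) 0 :=
    AnalyticAt.comp (g := F) (f := fun z : ℝ => cn z 0) (by simpa using hF) (cn_analytic analyticAt_id analyticAt_const)
  rcases Nat.eq_zero_or_pos d with hd | hd
  · subst hd
    rw [Nat.cast_zero, hga.analyticOrderAt_eq_zero] at hord
    refine ⟨x, _, Chart.refl hx, ⟨_, NCx.unit hF (by simpa using hord)⟩, fun i => ⟨_, NCx.coord i.succ⟩⟩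
  obtain ⟨φ, a, u, hφ, hφ0, ha, hu, ha0, had, hu0, hexp⟩ := tschirn hF hd hord
  -- translation chart
  have hφt : Tendsto φ (𝓝 0) (𝓝 0) := by simpa [hφ0] using hφ.continuousAt.tendsto
  have hch : Chart U x (fun k => cn (x k 0 - φ (tl (x k))) (tl (x k)))
      (fun v => cn (v 0 + φ (tl v)) (tl v)) := by
    refine ⟨?_, ?_, ?_, ?_⟩
    · refine cn_analytic ((coord_analytic 0 0).add ?_) (tl_analytic 0)
      exact AnalyticAt.comp (g := φ) (f := tl) (by simpa using hφ) (tl_analytic 0)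
    · simp [hφ0]
    · refine cn_tendsto ?_ (tl_tendsto hx)
      simpa using (hd_tendsto hx).sub (hφt.comp (tl_tendsto hx))
    · refine Eventually.of_forall fun k => ?_
      simp
  refine Good.lift hch (fun y => y) (fun i => ⟨_, NCx.coord i⟩) (by simp) ?_
  have hx1 := hch.tend
  generalize (fun k => cn (x k 0 - φ (tl (x k))) (tl (x k))) = x1 at hx1 ⊢
  set S := (Finset.range d).filter fun j => ¬ ∀ᶠ v in 𝓝 (0 : RV n), a j v = 0 with hSdef
  have hSd : ∀ j ∈ S, j < d := fun j hj => Finset.mem_range.1 (Finset.mem_filter.1 hj).1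
  have hnS : ∀ᶠ v in 𝓝 (0 : RV n), ∀ j ∈ Finset.range d, j ∉ S → a j v = 0 := by
    rw [Finset.eventually_all]
    intro j hj
    by_cases hjS : j ∈ S
    · simp [hjS]
    · have : ∀ᶠ v in 𝓝 (0 : RV n), a j v = 0 := by
        by_contra hcon
        exact hjS (Finset.mem_filter.2 ⟨hj, hcon⟩)
      filter_upwards [this] with v hv _ using hv
  have htl : Tendsto (tl : RV (n+1) → RV n) (𝓝 0) (𝓝 0) := tl_tendsto tendsto_id
  rcases S.eq_empty_or_nonempty with hSe | hSne
  · refine ⟨x1, _, Chart.refl hx1, ⟨_, (((NCx.coord 0).pow d).mul (NCx.unit hu hu0)).congr ?_⟩,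
      fun i => ⟨_, NCx.coord i.succ⟩⟩
    filter_upwards [hexp, htl.eventually hnS] with v h1 h2
    rw [h1, Finset.sum_eq_zero, zero_add]
    intro j hj
    rw [h2 j hj (by simp [hSe]), zero_mul]
  obtain ⟨y, π, γ, b, hch2, hnc2, hγ, hb, ⟨j₀, hj₀, hbj₀⟩, hab, hbS⟩ :=
    prep hP S hSne hSd ha (fun j hj => (Finset.mem_filter.1 hj).2) ha0 (tl_tendsto hx1)
  have hch3 := Chart.lift hx1 hch2
  refine Good.lift hch3 π hnc2 (by simp) ?_
  have hx2 := hch3.tend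
  generalize (fun k => cn (x1 k 0) (y k)) = x2 at hx2 ⊢
  have hbd : b (d-1) 0 = 0 := by
    rw [hbS (d-1) (by
      intro h
      exact (Finset.mem_filter.1 h).2 had)]
    rfl
  set u' : RV (n+1) → ℝ := fun v => u (cn (v 0) (π (tl v))) with hu'
  have hu'a : AnalyticAt ℝ u' 0 :=
    AnalyticAt.comp (g := u) (by rw [hch3.zero]; exact hu) hch3.an
  have hu'0 : u' 0 ≠ 0 := by simpa [hu', hch2.zero] using hu0
  have hab' : ∀ᶠ v in 𝓝 (0 : RV n), ∀ j ∈ S, a j (π v) = b j v * mon ((d - j) • γ) v := by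
    rw [Finset.eventually_all]; exact hab
  have hexp2 : ∀ᶠ v in 𝓝 (0 : RV (n+1)), (fun v => F (cn ((cn (v 0) (π (tl v))) 0 + φ (tl (cn (v 0) (π (tl v))))) (tl (cn (v 0) (π (tl v)))))) v =
      ∑ j ∈ Finset.range d, b j (tl v) * mon ((d - j) • γ) (tl v) * v 0 ^ j + v 0 ^ d * u' v := by
    filter_upwards [hch3.tends.eventually hexp, htl.eventually hab', htl.eventually (hch2.tends.eventually hnS)] with v h1 h2 h3
    rw [h1]
    simp only [tl_cn, cn_zero, hu']
    congr 1
    refine Finset.sum_congr rfl fun j hj => ?_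
    by_cases hjS : j ∈ S
    · rw [h2 j hjS]
    · rw [h3 j hj hjS, hbS j hjS]; simp
  by_cases hC : ∃ C : ℝ, ∀ᶠ k in (U : Filter ℕ), |x2 k 0| ≤ C * |mon γ (tl (x2 k))|
  · obtain ⟨C, hC⟩ := hC
    exact caseA hd ih hγ hb hbd (hSd _ hj₀) hbj₀ hu'a hu'0 hexp2 hx2 hC
  · exact caseB hb hu'a hu'0 hexp2 hx2 hC

theorem PN_all (U : Ultrafilter ℕ) (n : ℕ) : PN U n := by
  induction n with
  | zero =>
    intro F hF hnz x hx
    refine ⟨x, _, Chart.refl hx, ⟨_, NCx.unit hF ?_⟩⟩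
    intro h0
    apply hnz
    refine Eventually.of_forall fun v => ?_
    rw [Subsingleton.elim v 0, h0]
  | succ n ih =>
    intro F hF hnz x hx
    obtain ⟨ε, hε, hb⟩ := Metric.eventually_nhds_iff_ball.1 hF.eventually_analyticAt
    -- point off the zero set
    obtain ⟨v, hvb, hv⟩ : ∃ v ∈ Metric.ball (0 : RV (n+1)) ε, F v ≠ 0 := by
      by_contra hcon
      push Not at hcon
      exact hnz (Metric.eventually_nhds_iff_ball.2 ⟨ε, hε, hcon⟩)
    by_cases hF0 : F 0 ≠ 0
    · exact ⟨x, _, Chart.refl hx, ⟨_, NCx.unit hF hF0⟩⟩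
    push Not at hF0
    have hv0 : v ≠ 0 := by rintro rfl; exact hv hF0
    have he : (cn 1 0 : RV (n+1)) ≠ 0 := by
      intro h
      have := congrFun h 0
      simp at this
    obtain ⟨L, hL⟩ := SeparatingDual.exists_continuousLinearEquiv_apply_eq (R := ℝ) he hv0
    have hLa : ∀ w, AnalyticAt ℝ (fun w => L w) w := fun w => (L : RV (n+1) →L[ℝ] RV (n+1)).analyticAt w
    have hLia : ∀ w, AnalyticAt ℝ (fun w => L.symm w) w := fun w => (L.symm : RV (n+1) →L[ℝ] RV (n+1)).analyticAt w
    have hLz : ∀ z : ℝ, L (cn z 0) = z • v := by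
      intro z
      rw [← hL, ← map_smul]
      congr 1
      funext i
      refine Fin.cases ?_ (fun i => ?_) i <;> simp
    have hGa : AnalyticAt ℝ (fun w => F (L w)) 0 := AnalyticAt.comp (by simpa using hF) (hLa 0)
    have hord : analyticOrderAt (fun z => F (L (cn z 0))) 0 ≠ ⊤ := by
      intro htop
      rw [analyticOrderAt_eq_top] at htop
      simp only [hLz] at htop
      -- identity theorem on a segment
      have hpre : IsPreconnected ((fun z : ℝ => z • v) ⁻¹' Metric.ball 0 ε) := by
        have : Convex ℝ ((fun z : ℝ => z • v) ⁻¹' Metric.ball 0 ε) := by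
          have := (convex_ball (0 : RV (n+1)) ε).linear_preimage (LinearMap.toSpanSingleton ℝ (RV (n+1)) v)
          exact this
        exact this.isPreconnected
      have han : AnalyticOnNhd ℝ (fun z : ℝ => F (z • v)) ((fun z : ℝ => z • v) ⁻¹' Metric.ball 0 ε) := by
        intro z hz
        exact AnalyticAt.comp (g := F) (f := fun z : ℝ => z • v) (hb _ hz) (analyticAt_id.smul analyticAt_const)
      have := han.eqOn_zero_of_preconnected_of_eventuallyEq_zero hpre (z₀ := 0) (by simpa using hε) htop
        (x := 1) (by simpa using hvb)
      simp at this
      exact hv this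
    obtain ⟨d, hd⟩ := ENat.ne_top_iff_exists.1 hord
    have hy : Tendsto (fun k => L.symm (x k)) U (𝓝 0) := by
      have := (L.symm.continuous.tendsto 0).comp hx
      simpa [Function.comp_def] using this
    obtain ⟨y, π, hch, hnc, -⟩ := QN ih d (fun w => F (L w)) hGa hd.symm _ hy
    refine ⟨y, fun v => L (π v), ⟨?_, ?_, hch.tend, ?_⟩, hnc⟩
    · exact AnalyticAt.comp (hLa _) hch.an
    · simp [hch.zero]
    · filter_upwards [hch.eq] with k hk
      rw [hk]; simp

theorem mon_curve {n : ℕ} (α : Fin n → ℕ) (v : RV n) (i : Fin n) (t : ℝ) :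
    mon α (v + t • (Pi.single i (v i) : RV n)) = (1 + t) ^ α i * mon α v := by
  unfold mon
  rw [← Finset.mul_prod_erase _ _ (Finset.mem_univ i),
    ← Finset.mul_prod_erase Finset.univ (fun j => v j ^ α j) (Finset.mem_univ i), ← mul_assoc, ← mul_pow]
  congr 1
  · congr 1; simp; ring
  · refine Finset.prod_congr rfl fun j hj => ?_
    have : j ≠ i := (Finset.mem_erase.1 hj).1
    simp [this]

theorem mon_fderiv {n : ℕ} (α : Fin n → ℕ) (v : RV n) (i : Fin n) :
    fderiv ℝ (mon α) v (Pi.single i (v i)) = α i * mon α v := by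
  have h1 : HasDerivAt (fun t : ℝ => mon α (v + t • (Pi.single i (v i) : RV n)))
      (fderiv ℝ (mon α) v (Pi.single i (v i))) 0 := by
    have := (mon_analytic α v).differentiableAt.hasFDerivAt.hasLineDerivAt (Pi.single i (v i))
    exact this
  have h2 : HasDerivAt (fun t : ℝ => (1 + t) ^ α i * mon α v) (α i * mon α v) 0 := by
    have := (((hasDerivAt_id (0 : ℝ)).const_add 1).pow (α i)).mul_const (mon α v)
    simpa using this
  simp only [mon_curve] at h1
  exact h1.unique h2

theorem NC_loj {n : ℕ} {G : RV n → ℝ} {α : Fin n → ℕ} (hG : NCx G α) (hα : α ≠ 0) :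
    ∃ c > 0, ∀ᶠ v in 𝓝 (0 : RV n), G v ≠ 0 → ∀ q : ℝ, 0 ≤ q → q ^ (∑ i, α i) = |G v| →
      c * q ^ ((∑ i, α i) - 1) ≤ ‖fderiv ℝ G v‖ := by
  classical
  obtain ⟨u, hu, hu0, he⟩ := hG
  have hU : 0 < |u 0| := abs_pos.2 hu0
  set K := max 1 (2 / |u 0|) with hK
  have hK1 : 1 ≤ K := le_max_left _ _
  have hK2 : 2 / |u 0| ≤ K := le_max_right _ _
  set M := ∑ i, α i with hM
  have hMpos : M ≠ 0 := by
    intro h0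
    apply hα
    funext i
    have := Finset.sum_eq_zero_iff.1 h0 i (Finset.mem_univ i)
    simpa using this
  refine ⟨1 / (4 * K), by positivity, ?_⟩
  have hc1 : ContinuousAt (fun v => |u v|) 0 := hu.continuousAt.abs
  have e1 : ∀ᶠ v in 𝓝 (0 : RV n), 3 / 4 * |u 0| < |u v| :=
    hc1.eventually (lt_mem_nhds (by linarith))
  have e2 : ∀ᶠ v in 𝓝 (0 : RV n), |u v| < 2 * |u 0| :=
    hc1.eventually (gt_mem_nhds (by linarith))
  have hc2 : ContinuousAt (fun v : RV n => ‖v‖ * ‖fderiv ℝ u v‖) 0 :=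
    continuousAt_id.norm.mul hu.fderiv.continuousAt.norm
  have e3 : ∀ᶠ v in 𝓝 (0 : RV n), ‖v‖ * ‖fderiv ℝ u v‖ < |u 0| / 4 :=
    hc2.eventually (gt_mem_nhds (by simpa using hU))
  filter_upwards [e1, e2, e3, he.eventually_nhds, hu.eventually_analyticAt] with v h1 h2 h3 h4 h5 hne q hq hqM
  have hGv : G v = u v * mon α v := h4.self_of_nhds
  have hfd : fderiv ℝ G v = fderiv ℝ (fun v => u v * mon α v) v := Filter.EventuallyEq.fderiv_eq h4
  have hfd2 : fderiv ℝ G v = u v • fderiv ℝ (mon α) v + mon α v • fderiv ℝ u v := by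
    rw [hfd]
    exact fderiv_fun_mul h5.differentiableAt (mon_analytic α v).differentiableAt
  have hkey : ∀ i, α i ≠ 0 → |G v| / 4 ≤ ‖fderiv ℝ G v‖ * |v i| := by
    intro i hi
    have hn : ‖(Pi.single i (v i) : RV n)‖ = |v i| := by
      rw [Pi.norm_single]; rfl
    have hle : |fderiv ℝ G v (Pi.single i (v i))| ≤ ‖fderiv ℝ G v‖ * |v i| := by
      rw [← hn]; exact (fderiv ℝ G v).le_opNorm _
    refine le_trans ?_ hle
    rw [hfd2]
    simp only [add_apply, smul_apply, smul_eq_mul, mon_fderiv]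
    have hdu : |fderiv ℝ u v (Pi.single i (v i))| ≤ |u 0| / 4 := by
      have := (fderiv ℝ u v).le_opNorm (Pi.single i (v i))
      rw [hn] at this
      have hvi : |v i| ≤ ‖v‖ := norm_le_pi_norm v i
      have := mul_le_mul_of_nonneg_left hvi (norm_nonneg (fderiv ℝ u v))
      rw [Real.norm_eq_abs] at *
      linarith
    have hai : (1 : ℝ) ≤ α i := by exact_mod_cast Nat.one_le_iff_ne_zero.2 hi
    have : u v * (α i * mon α v) + mon α v * fderiv ℝ u v (Pi.single i (v i)) =
      mon α v * (u v * α i + fderiv ℝ u v (Pi.single i (v i))) := by ring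
    rw [this, abs_mul, hGv, abs_mul]
    have h6 : |u 0| / 2 ≤ |u v * α i + fderiv ℝ u v (Pi.single i (v i))| := by
      have a1 : |u v * α i| ≤ |u v * α i + fderiv ℝ u v (Pi.single i (v i))| + |fderiv ℝ u v (Pi.single i (v i))| := by
        have := abs_sub (u v * α i + fderiv ℝ u v (Pi.single i (v i))) (fderiv ℝ u v (Pi.single i (v i)))
        simpa using this
      have a2 : |u v| ≤ |u v * α i| := by
        rw [abs_mul, abs_of_nonneg (by linarith : (0 : ℝ) ≤ α i)]
        nlinarith [abs_nonneg (u v)]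
      linarith
    nlinarith [abs_nonneg (mon α v), mul_le_mul_of_nonneg_left h6 (abs_nonneg (mon α v)),
      mul_le_mul_of_nonneg_left h2.le (abs_nonneg (mon α v))]
  obtain ⟨i₀, hi₀⟩ := Function.ne_iff.1 hα
  obtain ⟨i, hi, hmin⟩ := Finset.exists_min_image (Finset.univ.filter fun i => α i ≠ 0) (fun i => |v i|)
    ⟨i₀, by simpa using hi₀⟩
  simp only [Finset.mem_filter, Finset.mem_univ, true_and] at hi hmin
  have hvM : |v i| ^ M ≤ |mon α v| := by
    rw [hM, ← Finset.prod_pow_eq_pow_sum, mon, Finset.abs_prod]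
    refine Finset.prod_le_prod (fun _ _ => by positivity) fun j _ => ?_
    rw [abs_pow]
    by_cases hj : α j = 0
    · simp [hj]
    · exact pow_le_pow_left₀ (abs_nonneg _) (hmin j hj) _
  have hmG : |mon α v| ≤ K * |G v| := by
    rw [hGv, abs_mul]
    have : 1 ≤ K * |u v| := by
      calc 1 ≤ 2 / |u 0| * (3 / 4 * |u 0|) := by field_simp; norm_num
        _ ≤ K * |u v| := by gcongr
    nlinarith [abs_nonneg (mon α v)]
  have hvq : |v i| ≤ K * q := by
    by_contra hcon
    push Not at hcon
    have h7 : (K * q) ^ M < |v i| ^ M := pow_lt_pow_left₀ hcon (by positivity) hMpos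
    have h8 : K ≤ K ^ M := le_self_pow₀ hK1 hMpos
    rw [mul_pow, hqM] at h7
    have := mul_le_mul_of_nonneg_right h8 (abs_nonneg (G v))
    linarith
  have hGpos : 0 < |G v| := abs_pos.2 hne
  have hqpos : 0 < q := by
    rcases hq.eq_or_lt with h | h
    · rw [← h, zero_pow hMpos] at hqM; linarith
    · exact h
  have h9 := hkey i hi
  have h10 : q ^ M = q ^ (M - 1) * q := by rw [← pow_succ]; congr 1; omega
  rw [← hqM, h10] at h9
  have h11 : q ^ (M - 1) * q / 4 ≤ ‖fderiv ℝ G v‖ * (K * q) :=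
    h9.trans (mul_le_mul_of_nonneg_left hvq (norm_nonneg _))
  have h12 : q ^ (M - 1) / 4 ≤ ‖fderiv ℝ G v‖ * K := by
    refine le_of_mul_le_mul_right ?_ hqpos
    nlinarith
  rw [div_mul_eq_mul_div, one_mul, div_le_iff₀ (by positivity)]
  linarith

theorem loj_RV {n : ℕ} {F : RV n → ℝ} (hF : AnalyticAt ℝ F 0) (hF0 : F 0 = 0) :
    ∃ N : ℕ, ∀ᶠ x in 𝓝 (0 : RV n), F x ≠ 0 → ∀ p : ℝ, 0 ≤ p → p ^ (N + 1) = |F x| →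
      p ^ N ≤ (N + 1 : ℝ) * ‖fderiv ℝ F x‖ := by
  by_contra hcon
  push Not at hcon
  have hsm : ∀ᶠ x in 𝓝 (0 : RV n), |F x| < 1 :=
    hF.continuousAt.abs.eventually (gt_mem_nhds (by simp [hF0]))
  have hx : ∀ k : ℕ, ∃ x : RV n, ‖x‖ < 1 / (k + 1 : ℝ) ∧ |F x| < 1 ∧ F x ≠ 0 ∧ ∃ p : ℝ, 0 ≤ p ∧
      p ^ (k + 1) = |F x| ∧ (k + 1 : ℝ) * ‖fderiv ℝ F x‖ < p ^ k := by
    intro k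
    have hball : ∀ᶠ x in 𝓝 (0 : RV n), ‖x‖ < 1 / (k + 1 : ℝ) :=
      continuousAt_id.norm.eventually (gt_mem_nhds (by simp; positivity))
    obtain ⟨x, ⟨h1, p, h2, h3, h4⟩, h5, h6⟩ := ((hcon k).and_eventually (hball.and hsm)).exists
    exact ⟨x, h5, h6, h1, p, h2, h3, h4⟩
  choose x hx1 hx2 hx3 p hp1 hp2 hp3 using hx
  have hxt : Tendsto x atTop (𝓝 0) := by
    rw [tendsto_zero_iff_norm_tendsto_zero]
    exact squeeze_zero (fun _ => norm_nonneg _) (fun k => (hx1 k).le) tendsto_one_div_add_atTop_nhds_zero_nat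
  set U : Ultrafilter ℕ := hyperfilter ℕ
  have hU : (U : Filter ℕ) ≤ atTop := by
    rw [← Nat.cofinite_eq_atTop]; exact hyperfilter_le_cofinite
  have hnz : ¬ ∀ᶠ v in 𝓝 (0 : RV n), F v = 0 := by
    intro h
    obtain ⟨k, hk⟩ := (hxt.eventually h).exists
    exact hx3 k hk
  obtain ⟨y, π, hch, α, hα⟩ := PN_all U n F hF hnz x (hxt.mono_left hU)
  have hα0 : α ≠ 0 := by
    rintro rfl
    obtain ⟨u, hu, hu0, he⟩ := hα
    have := he.self_of_nhds
    beta_reduce at this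
    rw [hch.zero, hF0, mon_zero, mul_one] at this
    exact hu0 this.symm
  obtain ⟨c, hc, hloj⟩ := NC_loj hα hα0
  set M := ∑ i, α i with hM
  have hMpos : M ≠ 0 := by
    intro h0
    apply hα0
    funext i
    have := Finset.sum_eq_zero_iff.1 h0 i (Finset.mem_univ i)
    simpa using this
  obtain ⟨B, hB⟩ : ∃ B : ℝ, ‖fderiv ℝ π 0‖ < B := exists_gt _
  have hBe : ∀ᶠ v in 𝓝 (0 : RV n), ‖fderiv ℝ π v‖ < B :=
    hch.an.fderiv.continuousAt.norm.eventually (gt_mem_nhds hB)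
  have hB0 : 0 < B := (norm_nonneg _).trans_lt hB
  have hFd : ∀ᶠ v in 𝓝 (0 : RV n), AnalyticAt ℝ F (π v) := hch.tends.eventually hF.eventually_analyticAt
  have hbig : ∀ᶠ k in atTop, M ≤ k + 1 ∧ B / c ≤ (k : ℝ) := by
    refine ((eventually_ge_atTop M).mono fun k hk => by omega).and ?_
    exact tendsto_natCast_atTop_atTop.eventually (eventually_ge_atTop (B / c))
  obtain ⟨k, h1, ⟨h2, h3⟩, h4, h5, h6, h7⟩ := (hch.eq.and ((hbig.filter_mono hU).and ((hch.tend.eventually hloj).and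
    ((hch.tend.eventually hBe).and ((hch.tend.eventually hFd).and
      (hch.tend.eventually hch.an.eventually_analyticAt)))))).exists
  have hFpos : 0 < |F (x k)| := abs_pos.2 (hx3 k)
  set q := |F (x k)| ^ ((M : ℝ)⁻¹) with hq
  have hqpos : 0 < q := Real.rpow_pos_of_pos hFpos _
  have hqM : q ^ M = |F (x k)| := Real.rpow_inv_natCast_pow hFpos.le hMpos
  have h8 := h4 (by rw [h1]; exact hx3 k) q hqpos.le (by rw [h1]; exact hqM)
  have hfd : fderiv ℝ (fun v => F (π v)) (y k) = (fderiv ℝ F (x k)).comp (fderiv ℝ π (y k)) := by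
    rw [← h1]
    exact fderiv_comp _ h6.differentiableAt h7.differentiableAt
  have h9 : ‖fderiv ℝ (fun v => F (π v)) (y k)‖ ≤ ‖fderiv ℝ F (x k)‖ * B := by
    rw [hfd]
    exact (ContinuousLinearMap.opNorm_comp_le _ _).trans (mul_le_mul_of_nonneg_left h5.le (norm_nonneg _))
  have hppos : 0 < p k := by
    rcases (hp1 k).eq_or_lt with h | h
    · have := hp2 k
      rw [← h, zero_pow (by omega)] at this; linarith
    · exact h
  have hp1' : p k ≤ 1 := by
    by_contra hcon
    push Not at hcon
    have := one_lt_pow₀ hcon (n := k + 1) (by omega)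
    rw [hp2] at this
    linarith [hx2 k]
  have hpq : q ≤ p k := by
    by_contra hcon
    push Not at hcon
    have a1 : p k ^ M < q ^ M := pow_lt_pow_left₀ hcon hppos.le hMpos
    have a2 : p k ^ (k + 1) ≤ p k ^ M := pow_le_pow_of_le_one hppos.le hp1' h2
    rw [hqM, ← hp2 k] at a1
    linarith
  have hpk : p k ^ k ≤ q ^ (M - 1) := by
    have a1 : p k ^ k * p k = q ^ (M - 1) * q := by
      rw [← pow_succ, ← pow_succ, hp2, ← hqM]; congr 1; omega
    by_contra hcon
    push Not at hcon
    have : q ^ (M - 1) * q < p k ^ k * p k :=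
      mul_lt_mul hcon hpq hqpos (by positivity)
    linarith
  have h10 := hp3 k
  rw [div_le_iff₀ hc] at h3
  have h11 : c * p k ^ k ≤ ‖fderiv ℝ F (x k)‖ * B := (mul_le_mul_of_nonneg_left hpk hc.le).trans (h8.trans h9)
  have h12 : c * ((k + 1 : ℝ) * ‖fderiv ℝ F (x k)‖) < c * p k ^ k := mul_lt_mul_of_pos_left h10 hc
  nlinarith [norm_nonneg (fderiv ℝ F (x k)), mul_le_mul_of_nonneg_left h3 (norm_nonneg (fderiv ℝ F (x k))),
    mul_nonneg hc.le (norm_nonneg (fderiv ℝ F (x k)))]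

/-- The Łojasiewicz gradient inequality. -/
theorem loj {n : ℕ} {f : EuclideanSpace ℝ (Fin n) → ℝ} {z : EuclideanSpace ℝ (Fin n)} (hf : AnalyticAt ℝ f z) :
    ∃ N : ℕ, ∃ C > 0, ∀ᶠ x in 𝓝 z, f x ≠ f z → ∀ p : ℝ, 0 ≤ p → p ^ (N + 1) = |f x - f z| →
      p ^ N ≤ C * ‖gradient f x‖ := by
  let L : RV n ≃L[ℝ] EuclideanSpace ℝ (Fin n) := (EuclideanSpace.equiv (Fin n) ℝ).symm
  have hLa : AnalyticAt ℝ (fun v => z + L v) 0 :=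
    analyticAt_const.add ((L : RV n →L[ℝ] EuclideanSpace ℝ (Fin n)).analyticAt 0)
  set F : RV n → ℝ := fun v => f (z + L v) - f z with hFdef
  have hF : AnalyticAt ℝ F 0 :=
    (AnalyticAt.comp (g := f) (f := fun v => z + L v) (by simpa using hf) hLa).sub analyticAt_const
  obtain ⟨N, hN⟩ := loj_RV hF (by simp [hFdef])
  refine ⟨N, (N + 1) * (‖(L : RV n →L[ℝ] EuclideanSpace ℝ (Fin n))‖ + 1), by positivity, ?_⟩
  have ht : Tendsto (fun x => L.symm (x - z)) (𝓝 z) (𝓝 0) := by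
    have : ContinuousAt (fun x => L.symm (x - z)) z := by fun_prop
    simpa [ContinuousAt] using this
  filter_upwards [ht.eventually hN, hf.eventually_analyticAt] with x h1 h2 hne p hp hpe
  have hx : z + L (L.symm (x - z)) = x := by simp
  have hFx : F (L.symm (x - z)) = f x - f z := by simp only [hFdef, hx]
  rw [hFx] at h1
  refine (h1 (sub_ne_zero.2 hne) p hp hpe).trans ?_
  rw [mul_assoc]
  refine mul_le_mul_of_nonneg_left ?_ (by positivity)
  have hd : HasFDerivAt F ((fderiv ℝ f x).comp (L : RV n →L[ℝ] EuclideanSpace ℝ (Fin n))) (L.symm (x - z)) := by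
    refine HasFDerivAt.sub_const _ (HasFDerivAt.comp (g := f) (f := fun v => z + L v) _ ?_ ?_)
    · rw [hx]; exact h2.differentiableAt.hasFDerivAt
    · exact (L.hasFDerivAt).const_add z
  rw [hd.fderiv]
  have hg : ‖gradient f x‖ = ‖fderiv ℝ f x‖ := by
    simp [gradient]
  rw [hg, mul_comm]
  refine (ContinuousLinearMap.opNorm_comp_le _ _).trans ?_
  exact mul_le_mul_of_nonneg_left (by linarith) (norm_nonneg _)

abbrev EV (n : ℕ) := EuclideanSpace ℝ (Fin n)

theorem fderiv_gradient {n : ℕ} (f : EV n → ℝ) (y v : EV n) :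
    fderiv ℝ f y v = ⟪gradient f y, v⟫ := by
  rw [gradient, InnerProductSpace.toDual_symm_apply]

/-- the inverse Riesz map, as a real linear map -/
def rieszInv (n : ℕ) : (EV n →L[ℝ] ℝ) →L[ℝ] EV n :=
  LinearMap.mkContinuous
    { toFun := fun l => (InnerProductSpace.toDual ℝ (EV n)).symm l
      map_add' := fun l m => by simp
      map_smul' := fun c l => by simp } 1 (fun l => by simp)

theorem gradient_analytic {n : ℕ} {f : EV n → ℝ} {z : EV n} (hf : AnalyticAt ℝ f z) :
    AnalyticAt ℝ (gradient f) z := by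
  have : gradient f = fun x => rieszInv n (fderiv ℝ f x) := rfl
  rw [this]
  exact ((rieszInv n).analyticAt _).comp hf.fderiv

theorem step_lower {n : ℕ} {f : EV n → ℝ} (hf : ∀ x, AnalyticAt ℝ f x) {r : ℝ} (hr : r < 1) (z : EV n) :
    ∃ δ > 0, ∃ α₀ > 0, ∀ x ∈ Metric.ball z δ, ∀ α, 0 < α → α ≤ α₀ → ArmijoCond f r x α := by
  obtain ⟨K, t, ht, hK⟩ := ((gradient_analytic (hf z)).contDiffAt (n := 1)).exists_lipschitzOnWith
  obtain ⟨ε, hε, hεt⟩ := Metric.mem_nhds_iff.1 ht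
  set δ := ε / 2 with hδ
  set G := ‖gradient f z‖ + K * ε with hG
  have hG0 : 0 ≤ G := by positivity
  refine ⟨δ, by positivity, min (δ / (G + 1)) ((1 - r) / (K + 1)), lt_min (by positivity)
    (div_pos (by linarith) (by positivity)), ?_⟩
  intro x hx α hα hα₀
  have hα1 : α * (G + 1) ≤ δ := (le_div_iff₀ (by positivity)).1 (hα₀.trans (min_le_left _ _))
  have hα2 : α * (K + 1) ≤ 1 - r := (le_div_iff₀ (by positivity)).1 (hα₀.trans (min_le_right _ _))
  set g := gradient f x with hg
  have hxt : x ∈ t := hεt (Metric.ball_subset_ball (by linarith) hx)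
  have hzt : z ∈ t := hεt (Metric.mem_ball_self hε)
  have hgG : ‖g‖ ≤ G := by
    have h1 := hK.dist_le_mul x hxt z hzt
    have h2 : dist x z ≤ ε := by have := Metric.mem_ball.1 hx; linarith
    have h3 : ‖g‖ ≤ ‖gradient f z‖ + dist g (gradient f z) := by
      rw [dist_eq_norm]
      have := norm_add_le (gradient f z) (g - gradient f z)
      simpa using this
    have := mul_le_mul_of_nonneg_left h2 K.coe_nonneg
    linarith
  have hd : ∀ s : ℝ, HasDerivAt (fun s : ℝ => f (x - (s * α) • g)) (-α * ⟪gradient f (x - (s * α) • g), g⟫) s := by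
    intro s
    have h1 : HasDerivAt (fun s : ℝ => x - (s * α) • g) (-(α • g)) s := by
      have := (((hasDerivAt_id s).mul_const α).smul_const g).const_sub x
      simpa using this
    have h2 := (hf (x - (s * α) • g)).differentiableAt.hasFDerivAt.comp_hasDerivAt s h1
    refine h2.congr_deriv ?_
    rw [map_neg, map_smul, fderiv_gradient]
    simp
  obtain ⟨s, hs, hse⟩ := exists_hasDerivAt_eq_slope (fun s : ℝ => f (x - (s * α) • g)) _ (zero_lt_one)
    (fun s _ => (hd s).continuousAt.continuousWithinAt) (fun s _ => hd s)
  simp only [zero_mul, one_mul, zero_smul, sub_zero, div_one] at hse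
  have hmv : ‖(s * α) • g‖ ≤ α * ‖g‖ := by
    rw [norm_smul, Real.norm_of_nonneg (mul_nonneg hs.1.le hα.le)]
    have := mul_le_mul_of_nonneg_right hs.2.le (mul_nonneg hα.le (norm_nonneg g))
    linarith
  have hyt : x - (s * α) • g ∈ t := by
    apply hεt
    rw [Metric.mem_ball]
    have h1 : dist (x - (s * α) • g) x ≤ δ := by
      rw [dist_eq_norm]
      simp only [sub_sub_cancel_left, norm_neg]
      refine hmv.trans (le_trans ?_ hα1)
      exact mul_le_mul_of_nonneg_left (by linarith) hα.le
    have := dist_triangle (x - (s * α) • g) x z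
    have := Metric.mem_ball.1 hx
    linarith
  have hlip := hK.dist_le_mul _ hyt x hxt
  rw [dist_eq_norm, dist_eq_norm] at hlip
  simp only [sub_sub_cancel_left, norm_neg] at hlip
  have hlip2 : ‖gradient f (x - (s * α) • g) - g‖ ≤ K * (α * ‖g‖) :=
    hlip.trans (mul_le_mul_of_nonneg_left hmv K.coe_nonneg)
  have hin : ⟪gradient f (x - (s * α) • g), g⟫ = ‖g‖ ^ 2 + ⟪gradient f (x - (s * α) • g) - g, g⟫ := by
    rw [inner_sub_left, real_inner_self_eq_norm_sq]; ring
  have hcs : -(K * (α * ‖g‖) * ‖g‖) ≤ ⟪gradient f (x - (s * α) • g) - g, g⟫ := by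
    have h1 := abs_real_inner_le_norm (gradient f (x - (s * α) • g) - g) g
    have h2 := mul_le_mul_of_nonneg_right hlip2 (norm_nonneg g)
    have h3 := neg_abs_le (⟪gradient f (x - (s * α) • g) - g, g⟫)
    linarith
  rw [ArmijoCond, ← hg]
  have h5 : f x - f (x - α • g) = α * ⟪gradient f (x - (s * α) • g), g⟫ := by linarith
  rw [h5, hin]
  have h6 : r * ‖g‖ ^ 2 ≤ ‖g‖ ^ 2 + ⟪gradient f (x - (s * α) • g) - g, g⟫ := by
    have : α * K ≤ 1 - r := by nlinarith
    nlinarith [mul_le_mul_of_nonneg_right this (sq_nonneg ‖g‖)]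
  nlinarith [mul_le_mul_of_nonneg_left h6 hα.le]

section
variable {n : ℕ} {f : EV n → ℝ} {τ r abar : ℝ} {x : ℕ → EV n} {a : ℕ → ℝ}

theorem SA.pos (hτ : τ ∈ Set.Ioo (0 : ℝ) 1) (ha : 0 < abar) (h : StabilizedArmijo f τ r abar x a) (t : ℕ) :
    0 < a t := by
  induction t with
  | zero => rw [h.1]; exact ha
  | succ t ih =>
    obtain ⟨k, hk, -⟩ := h.2 t
    rw [hk]; have := hτ.1; positivity

theorem SA.step (h : StabilizedArmijo f τ r abar x a) (t : ℕ) :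
    x (t + 1) = x t - a (t + 1) • gradient f (x t) := by
  obtain ⟨k, -, -, -, hk⟩ := h.2 t
  exact hk

theorem SA.dec (h : StabilizedArmijo f τ r abar x a) (t : ℕ) :
    r * a (t + 1) * ‖gradient f (x t)‖ ^ 2 ≤ f (x t) - f (x (t + 1)) := by
  obtain ⟨k, h1, h2, -, hk⟩ := h.2 t
  rw [← h1] at h2
  rw [hk]
  exact h2

/-- exponents -/
theorem SA.exps (h : StabilizedArmijo f τ r abar x a) :
    ∃ m : ℕ → ℕ, Monotone m ∧ ∀ t, a t = τ ^ m t * abar := by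
  choose k hk _ _ _ using h.2
  refine ⟨fun t => ∑ s ∈ Finset.range t, k s, ?_, ?_⟩
  · refine monotone_nat_of_le_succ fun t => ?_
    rw [Finset.sum_range_succ]; omega
  · intro t
    induction t with
    | zero => simp [h.1]
    | succ t ih =>
      beta_reduce at ih ⊢
      rw [hk, ih, Finset.sum_range_succ, pow_add]; ring

theorem SA.lower (hf : ∀ x, AnalyticAt ℝ f x) (hτ : τ ∈ Set.Ioo (0 : ℝ) 1) (hr : r < 1) (ha : 0 < abar)
    (h : StabilizedArmijo f τ r abar x a) {z : EV n} (hz : Tendsto x atTop (𝓝 z)) :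
    ∃ β > 0, ∀ᶠ t in atTop, β ≤ a t := by
  obtain ⟨δ, hδ, α₀, hα₀, hA⟩ := step_lower hf hr z
  obtain ⟨T, hT⟩ := eventually_atTop.1 (hz.eventually (Metric.ball_mem_nhds z hδ))
  have hpos := SA.pos hτ ha h
  refine ⟨min (a T) (τ * α₀), lt_min (hpos T) (mul_pos hτ.1 hα₀), eventually_atTop.2 ⟨T, fun t ht => ?_⟩⟩
  induction t, ht using Nat.le_induction with
  | base => exact min_le_left _ _
  | succ t ht ih =>
    obtain ⟨k, h1, -, h3, -⟩ := h.2 t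
    rcases k with _ | k
    · rw [h1]; simpa using ih
    · have h4 := h3 k (by omega)
      have : α₀ < τ ^ k * a t := by
        by_contra hcon
        push Not at hcon
        exact h4 (hA _ (hT t ht) _ (mul_pos (pow_pos hτ.1 _) (hpos t)) hcon)
      refine (min_le_right _ _).trans ?_
      rw [h1, pow_succ]
      nlinarith [hτ.1]

theorem SA.const (hf : ∀ x, AnalyticAt ℝ f x) (hτ : τ ∈ Set.Ioo (0 : ℝ) 1) (hr : r < 1) (ha : 0 < abar)
    (h : StabilizedArmijo f τ r abar x a) {z : EV n} (hz : Tendsto x atTop (𝓝 z)) :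
    ∃ m T : ℕ, ∀ t ≥ T, a t = τ ^ m * abar := by
  obtain ⟨m, hm, hma⟩ := SA.exps h
  obtain ⟨β, hβ, hb⟩ := SA.lower hf hτ hr ha h hz
  obtain ⟨T, hT⟩ := eventually_atTop.1 hb
  obtain ⟨M, hM⟩ := exists_pow_lt_of_lt_one (div_pos hβ ha) hτ.2
  rw [lt_div_iff₀ ha] at hM
  have hbd : BddAbove (Set.range m) := by
    refine ⟨M, ?_⟩
    rintro _ ⟨t, rfl⟩
    by_contra hcon
    push Not at hcon
    have h1 : M ≤ m (max t T) := hcon.le.trans (hm (le_max_left _ _))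
    have h2 := hT (max t T) (le_max_right _ _)
    rw [hma] at h2
    have h3 : τ ^ m (max t T) ≤ τ ^ M := pow_le_pow_of_le_one hτ.1.le hτ.2.le h1
    have := mul_le_mul_of_nonneg_right h3 ha.le
    linarith
  obtain ⟨T', hT'⟩ := Nat.sSup_mem (Set.range_nonempty m) hbd
  refine ⟨m T', T', fun t ht => ?_⟩
  rw [hma]
  congr 2
  refine le_antisymm ?_ (hm ht)
  rw [hT']
  exact le_csSup hbd ⟨t, rfl⟩

theorem pow_diff {p q : ℝ} (hq : 0 ≤ q) (hpq : q ≤ p) (N : ℕ) :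
    p ^ (N + 1) - q ^ (N + 1) ≤ (N + 1) * p ^ N * (p - q) := by
  induction N with
  | zero => simp
  | succ N ih =>
    have h1 : q ^ (N + 1) ≤ p ^ (N + 1) := pow_le_pow_left₀ hq hpq _
    have h2 := mul_le_mul_of_nonneg_left ih (hq.trans hpq)
    have h3 := mul_le_mul_of_nonneg_right h1 (sub_nonneg.2 hpq)
    push_cast
    calc p ^ (N + 1 + 1) - q ^ (N + 1 + 1) = p * (p ^ (N + 1) - q ^ (N + 1)) + q ^ (N + 1) * (p - q) := by ring
      _ ≤ p * ((N + 1) * p ^ N * (p - q)) + p ^ (N + 1) * (p - q) := add_le_add h2 h3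
      _ = _ := by ring

theorem SA.grad_zero (hf : ∀ x, AnalyticAt ℝ f x) (hτ : τ ∈ Set.Ioo (0 : ℝ) 1) (hr : r < 1) (ha : 0 < abar)
    (h : StabilizedArmijo f τ r abar x a) {z : EV n} (hz : Tendsto x atTop (𝓝 z)) : gradient f z = 0 := by
  obtain ⟨m, T, hT⟩ := SA.const hf hτ hr ha h hz
  have hg : Tendsto (fun t => gradient f (x t)) atTop (𝓝 (gradient f z)) :=
    (gradient_analytic (hf z)).continuousAt.tendsto.comp hz
  have h1 : Tendsto (fun t => x t - (τ ^ m * abar) • gradient f (x t)) atTop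
      (𝓝 (z - (τ ^ m * abar) • gradient f z)) := hz.sub (hg.const_smul _)
  have h2 : Tendsto (fun t => x t - (τ ^ m * abar) • gradient f (x t)) atTop (𝓝 z) := by
    refine ((tendsto_add_atTop_iff_nat 1).2 hz).congr' ?_
    filter_upwards [eventually_ge_atTop T] with t ht
    rw [SA.step h t, hT (t + 1) (by omega)]
  have h3 := tendsto_nhds_unique h1 h2
  have h4 : (τ ^ m * abar) • gradient f z = 0 := by simpa using h3
  rcases smul_eq_zero.1 h4 with h5 | h5
  · exact absurd h5 (mul_pos (pow_pos hτ.1 _) ha).ne'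
  · exact h5

theorem SA.conv (hf : ∀ x, AnalyticAt ℝ f x) (hτ : τ ∈ Set.Ioo (0 : ℝ) 1) (hr : r ∈ Set.Ioo (0 : ℝ) 1) (ha : 0 < abar)
    (h : StabilizedArmijo f τ r abar x a) (hn : ¬ Tendsto (fun t => ‖x t‖) atTop atTop) :
    ∃ z, Tendsto x atTop (𝓝 z) := by
  rw [tendsto_atTop] at hn
  push Not at hn
  obtain ⟨R, hR⟩ := hn
  obtain ⟨z, -, hz⟩ := (isCompact_closedBall (0 : EV n) R).exists_mapClusterPt_of_frequently (f := x) (l := atTop)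
    (hR.mono fun t ht => by simpa using ht.le)
  refine ⟨z, ?_⟩
  have hpos := SA.pos hτ ha h
  have hdec := SA.dec h
  have hfa : Antitone fun t => f (x t) := by
    refine antitone_nat_of_succ_le fun t => ?_
    have : 0 ≤ r * a (t + 1) * ‖gradient f (x t)‖ ^ 2 := by
      have := hr.1; have := hpos (t + 1); positivity
    linarith [hdec t]
  have hfz : ∀ t, f z ≤ f (x t) := by
    intro s
    by_contra hcon
    push Not at hcon
    have h1 : ∀ᶠ y in 𝓝 z, f (x s) < f y := (hf z).continuousAt.eventually (lt_mem_nhds hcon)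
    obtain ⟨t, ht, hts⟩ := ((mapClusterPt_iff_frequently.1 hz _ h1).and_eventually (eventually_ge_atTop s)).exists
    have h2 : f (x s) < f (x t) := ht
    exact absurd (hfa hts) (not_le.2 h2)
  obtain ⟨N, C, hC, hloj⟩ := loj (hf z)
  obtain ⟨ε, hε, hloj⟩ := Metric.eventually_nhds_iff_ball.1 hloj
  set P : EV n → ℝ := fun y => |f y - f z| ^ (((N + 1 : ℕ) : ℝ)⁻¹) with hP
  have hP0 : ∀ y, 0 ≤ P y := fun y => by positivity
  have hPN : ∀ y, P y ^ (N + 1) = |f y - f z| := fun y =>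
    Real.rpow_inv_natCast_pow (abs_nonneg _) (by omega)
  have hPc : ContinuousAt P z := by
    refine ContinuousAt.rpow_const ?_ (Or.inr (by positivity))
    exact ((hf z).continuousAt.sub continuousAt_const).abs
  have hPz : P z = 0 := by
    simp only [hP, sub_self, abs_zero]
    exact Real.zero_rpow (by positivity)
  have hPx : ∀ t, P (x t) ^ (N + 1) = f (x t) - f z := fun t => by
    rw [hPN, abs_of_nonneg (sub_nonneg.2 (hfz t))]
  have hPa : ∀ t, P (x (t + 1)) ≤ P (x t) := by
    intro t
    by_contra hcon
    push Not at hcon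
    have := pow_lt_pow_left₀ hcon (hP0 _) (n := N + 1) (by omega)
    rw [hPx, hPx] at this
    have := hfa (Nat.le_succ t)
    simp only [Nat.succ_eq_add_one] at this
    linarith
  set K := (N + 1) * C / r with hKd
  have hr0 := hr.1
  have hK : 0 < K := by positivity
  have hstep : ∀ t, x t ∈ Metric.ball z ε → ‖x (t + 1) - x t‖ ≤ K * (P (x t) - P (x (t + 1))) := by
    intro t ht
    have hst : ‖x (t + 1) - x t‖ = a (t + 1) * ‖gradient f (x t)‖ := by
      rw [SA.step h t]
      simp only [sub_sub_cancel_left, norm_neg, norm_smul]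
      rw [Real.norm_of_nonneg (hpos (t + 1)).le]
    have hnn : 0 ≤ K * (P (x t) - P (x (t + 1))) := mul_nonneg hK.le (sub_nonneg.2 (hPa t))
    rcases eq_or_ne (gradient f (x t)) 0 with hg | hg
    · rw [hst, hg]; simpa using hnn
    have hgp : 0 < ‖gradient f (x t)‖ := norm_pos_iff.2 hg
    have hne : f (x t) ≠ f z := by
      intro he
      have h1 := hdec t
      have h2 := hfz (t + 1)
      have : 0 < r * a (t + 1) * ‖gradient f (x t)‖ ^ 2 := by have := hpos (t + 1); positivity
      linarith
    have hl := hloj _ ht hne (P (x t)) (hP0 _) (hPN _)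
    have h1 := hdec t
    have h2 := pow_diff (hP0 (x (t + 1))) (hPa t) N
    rw [hPx, hPx] at h2
    have h3 : (N + 1) * P (x t) ^ N * (P (x t) - P (x (t + 1))) ≤
        (N + 1) * (C * ‖gradient f (x t)‖) * (P (x t) - P (x (t + 1))) := by
      refine mul_le_mul_of_nonneg_right ?_ (sub_nonneg.2 (hPa t))
      exact mul_le_mul_of_nonneg_left hl (by positivity)
    rw [hst]
    have h4 : r * (a (t + 1) * ‖gradient f (x t)‖) ≤ (N + 1) * C * (P (x t) - P (x (t + 1))) := by
      refine le_of_mul_le_mul_right ?_ hgp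
      nlinarith
    rw [hKd, div_mul_eq_mul_div, le_div_iff₀ hr0]
    linarith
  rw [Metric.tendsto_atTop']
  intro η hη
  set ρ := min η ε with hρ
  have hρ0 : 0 < ρ := lt_min hη hε
  have e1 : ∀ᶠ y in 𝓝 z, y ∈ Metric.ball z (ρ / 2) := Metric.ball_mem_nhds z (by positivity)
  have e2 : ∀ᶠ y in 𝓝 z, P y < ρ / (2 * K) := hPc.eventually (gt_mem_nhds (by rw [hPz]; positivity))
  obtain ⟨T, hT1, hT2⟩ := (mapClusterPt_iff_frequently.1 hz _ (e1.and e2)).exists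
  have hT3 : K * P (x T) < ρ / 2 := by
    rw [lt_div_iff₀ (by positivity)] at hT2
    linarith
  have hT1' := Metric.mem_ball.1 hT1
  have main : ∀ t ≥ T, dist (x t) z ≤ dist (x T) z + K * (P (x T) - P (x t)) := by
    intro t ht
    induction t, ht using Nat.le_induction with
    | base => simp
    | succ t ht ih =>
      have hin : x t ∈ Metric.ball z ε := by
        rw [Metric.mem_ball]
        have := mul_nonneg hK.le (hP0 (x t))
        have : ρ ≤ ε := min_le_right _ _
        linarith
      have h1 := hstep t hin
      have h2 := dist_triangle (x (t + 1)) (x t) z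
      rw [dist_eq_norm (x (t + 1)) (x t)] at h2
      linarith
  refine ⟨T, fun t ht => ?_⟩
  have h1 := main t ht.le
  have := mul_nonneg hK.le (hP0 (x t))
  have : ρ ≤ η := min_le_left _ _
  linarith
end

theorem hess_symm {n : ℕ} {f : EV n → ℝ} {z : EV n} (hf : AnalyticAt ℝ f z) (v w : EV n) :
    ⟪fderiv ℝ (gradient f) z v, w⟫ = ⟪v, fderiv ℝ (gradient f) z w⟫ := by
  have hd : HasFDerivAt (gradient f) ((rieszInv n).comp (fderiv ℝ (fderiv ℝ f) z)) z := by
    have : gradient f = fun x => rieszInv n (fderiv ℝ f x) := rfl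
    rw [this]
    exact (rieszInv n).hasFDerivAt.comp z hf.fderiv.differentiableAt.hasFDerivAt
  have hr : ∀ (l : EV n →L[ℝ] ℝ) (w : EV n), ⟪rieszInv n l, w⟫ = l w := by
    intro l w
    exact InnerProductSpace.toDual_symm_apply
  have hs : IsSymmSndFDerivAt ℝ f z := (hf.contDiffAt (n := 2)).isSymmSndFDerivAt (by simp)
  rw [hd.fderiv]
  rw [real_inner_comm _ v]
  simp only [ContinuousLinearMap.comp_apply, hr]
  exact hs v w

/-- diagonal map in an orthonormal basis -/
def dg {n : ℕ} (b : OrthonormalBasis (Fin n) ℝ (EV n)) (c : Fin n → ℝ) (d : EV n) : EV n :=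
  b.repr.symm (WithLp.toLp 2 fun i => c i * b.repr d i)

theorem dg_norm {n : ℕ} (b : OrthonormalBasis (Fin n) ℝ (EV n)) (c : Fin n → ℝ) (d : EV n) :
    ‖dg b c d‖ ^ 2 = ∑ i, (c i * b.repr d i) ^ 2 := by
  rw [dg, LinearIsometryEquiv.norm_map, EuclideanSpace.norm_sq_eq]
  exact Finset.sum_congr rfl fun i _ => sq_abs _

theorem dg_repr {n : ℕ} (b : OrthonormalBasis (Fin n) ℝ (EV n)) (c : Fin n → ℝ) (d : EV n) (i : Fin n) :
    b.repr (dg b c d) i = c i * b.repr d i := by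
  simp [dg]

theorem dg_sub {n : ℕ} (b : OrthonormalBasis (Fin n) ℝ (EV n)) (c : Fin n → ℝ) (d e : EV n) :
    dg b c (d - e) = dg b c d - dg b c e := by
  apply b.repr.injective
  ext i
  rw [map_sub]
  simp only [PiLp.sub_apply, dg_repr, map_sub]
  ring

theorem dg_le {n : ℕ} (b : OrthonormalBasis (Fin n) ℝ (EV n)) {c c' : Fin n → ℝ} {d d' : EV n}
    (h : ∀ i, |c i * b.repr d i| ≤ |c' i * b.repr d' i|) : ‖dg b c d‖ ≤ ‖dg b c' d'‖ := by
  refine le_of_sq_le_sq ?_ (norm_nonneg _)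
  rw [dg_norm, dg_norm]
  exact Finset.sum_le_sum fun i _ => sq_le_sq.2 (h i)

theorem dg_one {n : ℕ} (b : OrthonormalBasis (Fin n) ℝ (EV n)) (d : EV n) : dg b (fun _ => 1) d = d := by
  apply b.repr.injective
  ext i
  rw [dg_repr, one_mul]

/-- hyperbolic splitting for `1 - α H` -/
theorem splitting {n : ℕ} (H : EV n →L[ℝ] EV n) (hH : ∀ v w, ⟪H v, w⟫ = ⟪v, H w⟫) {v : EV n} (hv : ⟪v, H v⟫ < 0)
    {α : ℝ} (hα : 0 < α) :
    ∃ (P S : EV n → EV n) (μ : ℝ) (e : EV n), 1 < μ ∧ P e = e ∧ S e = 0 ∧ e ≠ 0 ∧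
      (∀ d, P d + S d = d) ∧ (∀ d, ‖P d‖ ≤ ‖d‖) ∧ (∀ d, ‖S d‖ ≤ ‖d‖) ∧
      (∀ d e, P (d - e) = P d - P e) ∧ (∀ d e, S (d - e) = S d - S e) ∧
      (∀ d, μ * ‖P d‖ ≤ ‖P (d - α • H d)‖) ∧ (∀ d, ‖S (d - α • H d)‖ ≤ ‖S d‖) ∧
      (∀ s : ℝ, P (s • e) = s • e) ∧ (∀ s : ℝ, S (s • e) = 0) := by
  classical
  have hsym : (H : EV n →ₗ[ℝ] EV n).IsSymmetric := fun v w => hH v w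
  have hn : Module.finrank ℝ (EV n) = n := finrank_euclideanSpace_fin
  set b := hsym.eigenvectorBasis hn with hb
  set l := hsym.eigenvalues hn with hl
  have hHr : ∀ d i, b.repr (H d) i = l i * b.repr d i := fun d i =>
    hsym.eigenvectorBasis_apply_self_apply hn d i
  have hAr : ∀ d i, b.repr (d - α • H d) i = (1 - α * l i) * b.repr d i := by
    intro d i
    rw [map_sub, map_smul]
    simp only [PiLp.sub_apply, PiLp.smul_apply, hHr, smul_eq_mul]
    ring
  -- a negative eigenvalue
  obtain ⟨j, hj⟩ : ∃ j, l j < 0 := by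
    by_contra hcon
    push Not at hcon
    have : ⟪v, H v⟫ = ∑ i, l i * (b.repr v i) ^ 2 := by
      rw [← b.repr.inner_map_map, PiLp.inner_apply]
      refine Finset.sum_congr rfl fun i _ => ?_
      rw [hHr]
      simp
      ring
    rw [this] at hv
    exact absurd (Finset.sum_nonneg fun i _ => mul_nonneg (hcon i) (sq_nonneg (b.repr v i))) (not_le.2 hv)
  have hjU : 1 < |1 - α * l j| := by
    have : α * l j < 0 := mul_neg_of_pos_of_neg hα hj
    rw [abs_of_pos (by linarith)]; linarith
  set cu : Fin n → ℝ := fun i => if 1 < |1 - α * l i| then 1 else 0 with hcu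
  set cs : Fin n → ℝ := fun i => if 1 < |1 - α * l i| then 0 else 1 with hcs
  obtain ⟨i₀, hi₀, hmin⟩ := Finset.exists_min_image (Finset.univ.filter fun i => 1 < |1 - α * l i|)
    (fun i => |1 - α * l i|) ⟨j, by simpa using hjU⟩
  simp only [Finset.mem_filter, Finset.mem_univ, true_and] at hi₀ hmin
  have hbj : ∀ i, i ≠ j → b.repr (b j) i = 0 := by
    intro i hi
    rw [b.repr_self]; simp [hi]
  have hP : ∀ s : ℝ, dg b cu (s • b j) = s • b j := by
    intro s
    apply b.repr.injective
    ext i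
    rw [dg_repr, map_smul]
    by_cases hi : i = j
    · subst hi; simp [hcu, hjU]
    · simp [hi]
  have hS : ∀ s : ℝ, dg b cs (s • b j) = 0 := by
    intro s
    apply b.repr.injective
    ext i
    rw [dg_repr, map_smul]
    by_cases hi : i = j
    · subst hi; simp [hcs, hjU]
    · simp [hi]
  have hP1 := hP 1
  have hS1 := hS 1
  rw [one_smul] at hP1 hS1
  refine ⟨dg b cu, dg b cs, |1 - α * l i₀|, b j, hi₀, hP1, hS1, b.orthonormal.ne_zero j, ?_, ?_, ?_, dg_sub b cu, dg_sub b cs, ?_, ?_, hP, hS⟩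
  · intro d
    apply b.repr.injective
    ext i
    rw [map_add]
    simp only [PiLp.add_apply, dg_repr, hcu, hcs]
    split_ifs <;> ring
  · intro d
    conv_rhs => rw [← dg_one b d]
    refine dg_le b fun i => ?_
    simp only [hcu]
    split_ifs <;> simp
  · intro d
    conv_rhs => rw [← dg_one b d]
    refine dg_le b fun i => ?_
    simp only [hcs]
    split_ifs <;> simp
  · intro d
    have h1 : |1 - α * l i₀| * ‖dg b cu d‖ = ‖dg b (fun i => |1 - α * l i₀| * cu i) d‖ := by
      have : dg b (fun i => |1 - α * l i₀| * cu i) d = |1 - α * l i₀| • dg b cu d := by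
        apply b.repr.injective
        ext i
        rw [map_smul]
        simp only [PiLp.smul_apply, dg_repr, smul_eq_mul]
        ring
      rw [this, norm_smul, Real.norm_eq_abs, abs_abs]
    rw [h1]
    refine dg_le b fun i => ?_
    rw [hAr]
    simp only [hcu]
    split_ifs with hi
    · simp only [mul_one, one_mul, abs_mul, abs_abs]
      exact mul_le_mul_of_nonneg_right (hmin i hi) (abs_nonneg _)
    · simp
  · intro d
    refine dg_le b fun i => ?_
    rw [hAr]
    simp only [hcs]
    split_ifs with hi
    · simp
    · simp only [one_mul, abs_mul]
      have := mul_le_mul_of_nonneg_right (not_lt.1 hi) (abs_nonneg (b.repr d i))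
      linarith

/-- one gradient step -/
def gstep {n : ℕ} (f : EV n → ℝ) (α : ℝ) (x : EV n) : EV n := x - α • gradient f x

theorem gstep_strict {n : ℕ} {f : EV n → ℝ} (hf : ∀ x, AnalyticAt ℝ f x) (α : ℝ) (z : EV n) :
    HasStrictFDerivAt (gstep f α) (ContinuousLinearMap.id ℝ (EV n) - α • fderiv ℝ (gradient f) z) z := by
  have h := (gradient_analytic (hf z)).hasStrictFDerivAt
  exact (hasStrictFDerivAt_id z).sub (h.const_smul α)

theorem gstep_cont {n : ℕ} {f : EV n → ℝ} (hf : ∀ x, AnalyticAt ℝ f x) (α : ℝ) : Continuous (gstep f α) :=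
  continuous_iff_continuousAt.2 fun z => (gstep_strict hf α z).continuousAt

theorem local_null {n : ℕ} {f : EV n → ℝ} (hf : ∀ x, AnalyticAt ℝ f x) {z v : EV n}
    (hv : ⟪v, fderiv ℝ (gradient f) z v⟫ < 0) {α : ℝ} (hα : 0 < α) :
    ∃ δ > 0, volume {x | ∀ k : ℕ, (gstep f α)^[k] x ∈ Metric.ball z δ} = 0 := by
  obtain ⟨P, S, μ, e, hμ, -, -, he0, hPS, hPle, hSle, hPsub, hSsub, hPA, hSA, hPs, hSs⟩ :=
    splitting (fderiv ℝ (gradient f) z) (fun v w => hess_symm (hf z) v w) hv hα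
  set H := fderiv ℝ (gradient f) z
  set η := (μ - 1) / 8 with hη
  have hη0 : 0 < η := by rw [hη]; linarith
  have hst := (gstep_strict hf α z).isLittleO.def hη0
  rw [nhds_prod_eq] at hst
  obtain ⟨δ, hδ, hball⟩ : ∃ δ > 0, ∀ x ∈ Metric.ball z δ, ∀ y ∈ Metric.ball z δ,
      ‖gstep f α x - gstep f α y - ((x - y) - α • H (x - y))‖ ≤ η * ‖x - y‖ := by
    obtain ⟨u, hu, w, hw, huw⟩ := Filter.eventually_prod_iff.1 hst
    obtain ⟨δ, hδ, h⟩ := Metric.eventually_nhds_iff_ball.1 (hu.and hw)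
    exact ⟨δ, hδ, fun x hx y hy => by simpa using huw (h x hx).1 (h y hy).2⟩
  refine ⟨δ, hδ, ?_⟩
  set W := {x | ∀ k : ℕ, (gstep f α)^[k] x ∈ Metric.ball z δ} with hW
  have hWm : MeasurableSet W := by
    have : W = ⋂ k : ℕ, ((gstep f α)^[k]) ⁻¹' Metric.ball z δ := by ext x; simp [hW]
    rw [this]
    exact MeasurableSet.iInter fun k =>
      (Metric.isOpen_ball.preimage ((gstep_cont hf α).iterate k)).measurableSet
  -- uniqueness on lines
  have hline : ∀ x ∈ W, ∀ y ∈ W, ∀ s : ℝ, x - y = s • e → s = 0 := by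
    intro x hx y hy s hs
    by_contra hs0
    have hse : 0 < ‖s • e‖ := norm_pos_iff.2 (smul_ne_zero hs0 he0)
    have key : ∀ k : ℕ, ‖S ((gstep f α)^[k] x - (gstep f α)^[k] y)‖ ≤ ‖P ((gstep f α)^[k] x - (gstep f α)^[k] y)‖ ∧
        (1 + 6 * η) ^ k * ‖s • e‖ ≤ ‖P ((gstep f α)^[k] x - (gstep f α)^[k] y)‖ := by
      intro k
      induction k with
      | zero => simp [hs, hPs, hSs]
      | succ k ih =>
        rw [Function.iterate_succ_apply', Function.iterate_succ_apply']
        have hx' := hx k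
        have hy' := hy k
        set X := (gstep f α)^[k] x
        set Y := (gstep f α)^[k] y
        have h1 := hball X hx' Y hy'
        set d := X - Y
        set D := gstep f α X - gstep f α Y
        set A := d - α • H d
        have hd : ‖d‖ ≤ 2 * ‖P d‖ := by
          have := norm_add_le (P d) (S d)
          rw [hPS] at this
          linarith [ih.1]
        have hDA : ‖D - A‖ ≤ 2 * η * ‖P d‖ := by
          have := mul_le_mul_of_nonneg_left hd hη0.le
          linarith
        have hP1 : ‖P A‖ ≤ ‖P D‖ + 2 * η * ‖P d‖ := by
          have a1 := hPle (D - A)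
          rw [hPsub] at a1
          have a2 := norm_sub_norm_le (P A) (P D)
          rw [norm_sub_rev] at a2
          linarith
        have hS1 : ‖S D‖ ≤ ‖S A‖ + 2 * η * ‖P d‖ := by
          have a1 := hSle (D - A)
          rw [hSsub] at a1
          have a2 := norm_sub_norm_le (S D) (S A)
          linarith
        have hP2 := hPA d
        have hS2 := hSA d
        have hP3 : (1 + 6 * η) * ‖P d‖ ≤ ‖P D‖ := by
          have : μ = 1 + 8 * η := by rw [hη]; ring
          rw [this] at hP2
          linarith
        refine ⟨?_, ?_⟩
        · have := ih.1
          nlinarith [norm_nonneg (P d)]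
        · rw [pow_succ]
          have := mul_le_mul_of_nonneg_left ih.2 (by linarith : 0 ≤ 1 + 6 * η)
          linarith
    obtain ⟨k, hk⟩ := pow_unbounded_of_one_lt (2 * δ / ‖s • e‖) (by linarith : 1 < 1 + 6 * η)
    rw [div_lt_iff₀ hse] at hk
    have h1 := (key k).2
    have h2 := hPle ((gstep f α)^[k] x - (gstep f α)^[k] y)
    have h3 := dist_triangle_right ((gstep f α)^[k] x) ((gstep f α)^[k] y) z
    rw [dist_eq_norm] at h3
    have h4 := Metric.mem_ball.1 (hx k)
    have h5 := Metric.mem_ball.1 (hy k)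
    linarith
  refine Measure.addHaar_eq_zero_of_disjoint_translates volume (fun k : ℕ => (1 / (k + 1 : ℝ)) • e) ?_ ?_ hWm
  · refine (Metric.isBounded_closedBall (x := (0 : EV n)) (r := ‖e‖)).subset ?_
    rintro _ ⟨k, rfl⟩
    rw [mem_closedBall_zero_iff, norm_smul, Real.norm_of_nonneg (by positivity)]
    have : 1 / (k + 1 : ℝ) ≤ 1 := by
      rw [div_le_one (by positivity)]
      have : (0 : ℝ) ≤ k := k.cast_nonneg
      linarith
    nlinarith [norm_nonneg e]
  · intro k m hkm
    rw [Function.onFun, Set.disjoint_left]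
    rintro _ ⟨_, rfl, x, hx, rfl⟩ ⟨_, rfl, y, hy, hxy⟩
    apply hkm
    have hxy' : (1 / (m + 1 : ℝ)) • e + y = (1 / (k + 1 : ℝ)) • e + x := hxy
    have h1 := hline x hx y hy (1 / (m + 1 : ℝ) - 1 / (k + 1 : ℝ)) (by
      rw [sub_smul]
      rw [sub_eq_sub_iff_add_eq_add, add_comm x, ← hxy', add_comm])
    have h2 : (1 / (m + 1 : ℝ)) = 1 / (k + 1 : ℝ) := sub_eq_zero.1 h1
    have h3 : (m : ℝ) + 1 = k + 1 := by
      rw [one_div, one_div] at h2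
      exact inv_injective h2
    have h4 : (m : ℝ) = k := by linarith
    exact_mod_cast h4.symm

theorem preimage_null {n : ℕ} {f : EV n → ℝ} (hf : ∀ x, AnalyticAt ℝ f x) {α : ℝ}
    (hα : ∀ᵐ x ∂(volume : Measure (EV n)),
      (ContinuousLinearMap.id ℝ (EV n) - α • fderiv ℝ (gradient f) x).det ≠ 0)
    {B : Set (EV n)} (hB : volume B = 0) : volume (gstep f α ⁻¹' B) = 0 := by
  set D : EV n → (EV n →L[ℝ] EV n) := fun x => ContinuousLinearMap.id ℝ (EV n) - α • fderiv ℝ (gradient f) x with hD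
  set B' := toMeasurable volume B with hB'
  have hB'0 : volume B' = 0 := by rw [hB', measure_toMeasurable, hB]
  have hB'm : MeasurableSet B' := measurableSet_toMeasurable _ _
  have hmain : volume (gstep f α ⁻¹' B' ∩ {x | (D x).det ≠ 0}) = 0 := by
    refine measure_null_of_locally_null _ fun x hx => ?_
    have hst : HasStrictFDerivAt (gstep f α)
        ((D x).toContinuousLinearEquivOfDetNeZero hx.2 : EV n →L[ℝ] EV n) x := by
      rw [ContinuousLinearMap.coe_toContinuousLinearEquivOfDetNeZero]
      exact gstep_strict hf α x
    set Φ := hst.toOpenPartialHomeomorph (gstep f α) with hΦ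
    have hxs : x ∈ Φ.source := hst.mem_toOpenPartialHomeomorph_source
    have hinj : Set.InjOn (gstep f α) Φ.source := Φ.injOn
    have hDc : Continuous fun x => (D x).det := by
      refine ContinuousLinearMap.continuous_det.comp ?_
      refine continuous_const.sub (Continuous.const_smul ?_ α)
      exact continuous_iff_continuousAt.2 fun y => (gradient_analytic (hf y)).fderiv.continuousAt
    set s := gstep f α ⁻¹' B' ∩ {x | (D x).det ≠ 0} ∩ Φ.source with hs
    have hsm : MeasurableSet s :=
      (((gstep_cont hf α).measurable hB'm).inter
        (isOpen_ne_fun hDc continuous_const).measurableSet).inter Φ.open_source.measurableSet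
    refine ⟨s, Filter.inter_mem self_mem_nhdsWithin (mem_nhdsWithin_of_mem_nhds (Φ.open_source.mem_nhds hxs)), ?_⟩
    have h1 := lintegral_abs_det_fderiv_eq_addHaar_image volume hsm
      (fun y _ => (gstep_strict hf α y).hasFDerivAt.hasFDerivWithinAt) (hinj.mono Set.inter_subset_right)
    have h2 : volume (gstep f α '' s) = 0 := by
      refine measure_mono_null ?_ hB'0
      rintro _ ⟨y, hy, rfl⟩
      exact hy.1.1
    rw [h2, lintegral_eq_zero_iff (by
      exact (hDc.abs.measurable).ennreal_ofReal)] at h1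
    rw [Filter.EventuallyEq, ae_restrict_iff' hsm] at h1
    refine measure_mono_null ?_ (ae_iff.1 h1)
    intro y hy
    simp only [Set.mem_ofPred_eq, Classical.not_imp]
    refine ⟨hy, ?_⟩
    have : 0 < |(D y).det| := abs_pos.2 hy.1.2
    simpa using hy.1.2
  have hnull : volume {x | ¬ (D x).det ≠ 0} = 0 := ae_iff.1 hα
  refine measure_mono_null ?_ (measure_union_null hmain hnull)
  intro x hx
  by_cases h : (D x).det ≠ 0
  · exact Or.inl ⟨subset_toMeasurable _ _ hx, h⟩
  · exact Or.inr h

theorem ae_nondeg {n : ℕ} {f : EV n → ℝ} (hf : ∀ x, AnalyticAt ℝ f x) {c : ℝ} (hc : c ≠ 0) :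
    ∀ᵐ α ∂(volume : Measure ℝ), ∀ᵐ x ∂(volume : Measure (EV n)),
      (ContinuousLinearMap.id ℝ (EV n) - (c * α) • fderiv ℝ (gradient f) x).det ≠ 0 := by
  have hcont : Continuous fun p : ℝ × EV n =>
      (ContinuousLinearMap.id ℝ (EV n) - (c * p.1) • fderiv ℝ (gradient f) p.2).det := by
    refine ContinuousLinearMap.continuous_det.comp ?_
    refine continuous_const.sub (Continuous.smul (continuous_const.mul continuous_fst) ?_)
    have : Continuous (fderiv ℝ (gradient f)) :=
      continuous_iff_continuousAt.2 fun y => (gradient_analytic (hf y)).fderiv.continuousAt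
    exact this.comp continuous_snd
  rw [Measure.ae_ae_comm (p := fun (α : ℝ) (x : EV n) =>
    (ContinuousLinearMap.id ℝ (EV n) - (c * α) • fderiv ℝ (gradient f) x).det ≠ 0)
    (isOpen_ne_fun hcont continuous_const).measurableSet]
  refine Eventually.of_forall fun x => ?_
  rw [ae_iff]
  set H := fderiv ℝ (gradient f) x
  have hfin : Set.Finite {l : ℝ | Module.End.HasEigenvalue (H : EV n →ₗ[ℝ] EV n) l} :=
    Module.End.finite_hasEigenvalue _
  refine Set.Finite.measure_zero (Set.Finite.subset (hfin.image fun l => l⁻¹ / c) ?_) _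
  intro α hα
  have hα' : LinearMap.det ((ContinuousLinearMap.id ℝ (EV n) - (c * α) • H : EV n →L[ℝ] EV n) : EV n →ₗ[ℝ] EV n) = 0 := not_not.1 hα
  obtain ⟨v, hv, hv0⟩ := Submodule.exists_mem_ne_zero_of_ne_bot (LinearMap.bot_lt_ker_of_det_eq_zero hα').ne'
  have hv1 : v = (c * α) • H v := by
    have : v - (c * α) • H v = 0 := by simpa using hv
    exact sub_eq_zero.1 this
  have hca : c * α ≠ 0 := by
    intro h0
    rw [h0, zero_smul] at hv1
    exact hv0 hv1
  refine ⟨(c * α)⁻¹, ?_, ?_⟩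
  · refine Module.End.hasEigenvalue_of_hasEigenvector (x := v) ⟨?_, hv0⟩
    rw [Module.End.mem_eigenspace_iff]
    change H v = (c * α)⁻¹ • v
    conv_rhs => rw [hv1]
    rw [smul_smul, inv_mul_cancel₀ hca, one_smul]
  · simp only [inv_inv]
    field_simp

theorem part_two {n : ℕ}
    (f : EV n → ℝ) (hf : ∀ x, AnalyticAt ℝ f x)
    (τ r : ℝ) (hτ : τ ∈ Set.Ioo (0 : ℝ) 1) (hr : r ∈ Set.Ioo (0 : ℝ) 1) :
    (∀ᵐ abar ∂(volume : Measure ℝ), 0 < abar →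
      ∀ᵐ x₀ ∂(volume : Measure (EuclideanSpace ℝ (Fin n))),
        ∀ (x : ℕ → EuclideanSpace ℝ (Fin n)) (a : ℕ → ℝ),
          x 0 = x₀ → StabilizedArmijo f τ r abar x a →
            ∀ xstar : EuclideanSpace ℝ (Fin n), Tendsto x atTop (𝓝 xstar) →
              ∀ v : EuclideanSpace ℝ (Fin n),
                0 ≤ ⟪v, fderiv ℝ (gradient f) xstar v⟫) := by
  have hall : ∀ᵐ abar ∂(volume : Measure ℝ), ∀ m : ℕ, ∀ᵐ x ∂(volume : Measure (EV n)),
      (ContinuousLinearMap.id ℝ (EV n) - (τ ^ m * abar) • fderiv ℝ (gradient f) x).det ≠ 0 :=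
    ae_all_iff.2 fun m => ae_nondeg hf (pow_pos hτ.1 m).ne'
  filter_upwards [hall] with abar hm ha
  set S : Set (EV n) := {z | ∃ v, ⟪v, fderiv ℝ (gradient f) z v⟫ < 0} with hS
  have hloc : ∀ m : ℕ, ∀ z ∈ S, ∃ δ > 0,
      volume {x | ∀ k : ℕ, (gstep f (τ ^ m * abar))^[k] x ∈ Metric.ball z δ} = 0 := by
    rintro m z ⟨v, hv⟩
    exact local_null hf hv (mul_pos (pow_pos hτ.1 m) ha)
  choose! δ hδ hnull using hloc
  have hcov : ∀ m : ℕ, ∃ t ⊆ S, t.Countable ∧ S ⊆ ⋃ z ∈ t, Metric.ball z (δ m z) := fun m =>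
    TopologicalSpace.countable_cover_nhdsWithin fun z hz =>
      mem_nhdsWithin_of_mem_nhds (Metric.ball_mem_nhds z (hδ m z hz))
  choose t htS htc htcov using hcov
  set B0 : Set (EV n) := ⋃ m : ℕ, ⋃ z ∈ t m,
    {x | ∀ k : ℕ, (gstep f (τ ^ m * abar))^[k] x ∈ Metric.ball z (δ m z)} with hB0
  have hB0n : volume B0 = 0 := by
    rw [hB0, measure_iUnion_null_iff]
    intro m
    rw [measure_biUnion_null_iff (htc m)]
    intro z hz
    exact hnull m z (htS m hz)
  let B : ℕ → Set (EV n) := fun j => Nat.rec B0 (fun _ C => ⋃ m : ℕ, gstep f (τ ^ m * abar) ⁻¹' C) j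
  have hBs : ∀ j, B (j + 1) = ⋃ m : ℕ, gstep f (τ ^ m * abar) ⁻¹' (B j) := fun j => rfl
  have hBn : ∀ j, volume (B j) = 0 := by
    intro j
    induction j with
    | zero => exact hB0n
    | succ j ih =>
      rw [hBs, measure_iUnion_null_iff]
      exact fun m => preimage_null hf (hm m) ih
  have hBU : volume (⋃ j, B j) = 0 := measure_iUnion_null_iff.2 hBn
  have hae : ∀ᵐ x₀ ∂(volume : Measure (EV n)), x₀ ∉ ⋃ j, B j := measure_eq_zero_iff_ae_notMem.1 hBU
  filter_upwards [hae] with x₀ hx₀ x a hx0 hSA z hz v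
  by_contra hcon
  push Not at hcon
  apply hx₀
  have hzS : z ∈ S := ⟨v, hcon⟩
  obtain ⟨m, T, hT⟩ := SA.const hf hτ hr.2 ha hSA hz
  obtain ⟨w, hw, hzw⟩ := Set.mem_iUnion₂.1 (htcov m hzS)
  obtain ⟨T', hT'⟩ := eventually_atTop.1 (hz.eventually (Metric.isOpen_ball.mem_nhds hzw))
  have hit : ∀ k, (gstep f (τ ^ m * abar))^[k] (x (max T T')) = x (max T T' + k) := by
    intro k
    induction k with
    | zero => rfl
    | succ k ih =>
      rw [Function.iterate_succ_apply', ih, ← add_assoc, SA.step hSA (max T T' + k),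
        hT (max T T' + k + 1) (by have := le_max_left T T'; omega)]
      rfl
  have hxB : x (max T T') ∈ B0 := by
    refine Set.mem_iUnion.2 ⟨m, Set.mem_iUnion₂.2 ⟨w, hw, fun k => ?_⟩⟩
    rw [hit]
    exact hT' _ (by have := le_max_right T T'; omega)
  obtain ⟨e, -, he⟩ := SA.exps hSA
  have hback : ∀ j ≤ max T T', x (max T T' - j) ∈ B j := by
    intro j
    induction j with
    | zero => intro _; exact hxB
    | succ j ih =>
      intro hj
      have h1 := ih (by omega)
      rw [hBs]
      refine Set.mem_iUnion.2 ⟨e (max T T' - (j + 1) + 1), ?_⟩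
      have h2 : max T T' - j = max T T' - (j + 1) + 1 := by omega
      rw [h2, SA.step hSA, he] at h1
      exact h1
  have := hback (max T T') le_rfl
  rw [Nat.sub_self, hx0] at this
  exact Set.mem_iUnion.2 ⟨_, this⟩

/-- For a real-analytic `f : ℝⁿ → ℝ`: (i) for every initial step size `ᾱ > 0` and every
initial point, the iterates of stabilized Armijo backtracking gradient descent either
leave every compact set (`‖x_t‖ → ∞`) or converge to a point `xstar`, which is then a
critical point of `f`; (ii) moreover, for almost every `ᾱ > 0` and almost every initial
point, if the limit point exists then its Hessian is positive semidefinite. -/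
theorem stabilized_armijo_convergence_analytic {n : ℕ}
    (f : EuclideanSpace ℝ (Fin n) → ℝ) (hf : ∀ x, AnalyticAt ℝ f x)
    (τ r : ℝ) (hτ : τ ∈ Set.Ioo (0 : ℝ) 1) (hr : r ∈ Set.Ioo (0 : ℝ) 1) :
    (∀ abar : ℝ, 0 < abar →
      ∀ (x : ℕ → EuclideanSpace ℝ (Fin n)) (a : ℕ → ℝ),
        StabilizedArmijo f τ r abar x a →
          Tendsto (fun t => ‖x t‖) atTop atTop ∨
          ∃ xstar : EuclideanSpace ℝ (Fin n),
            Tendsto x atTop (𝓝 xstar) ∧ gradient f xstar = 0) ∧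
    (∀ᵐ abar ∂(volume : Measure ℝ), 0 < abar →
      ∀ᵐ x₀ ∂(volume : Measure (EuclideanSpace ℝ (Fin n))),
        ∀ (x : ℕ → EuclideanSpace ℝ (Fin n)) (a : ℕ → ℝ),
          x 0 = x₀ → StabilizedArmijo f τ r abar x a →
            ∀ xstar : EuclideanSpace ℝ (Fin n), Tendsto x atTop (𝓝 xstar) →
              ∀ v : EuclideanSpace ℝ (Fin n),
                0 ≤ ⟪v, fderiv ℝ (gradient f) xstar v⟫) := by
  refine ⟨fun abar ha x a h => ?_, part_two f hf τ r hτ hr⟩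
  by_cases hn : Tendsto (fun t => ‖x t‖) atTop atTop
  · exact Or.inl hn
  · obtain ⟨z, hz⟩ := SA.conv hf hτ hr ha h hn
    exact Or.inr ⟨z, hz, SA.grad_zero hf hτ hr.2 ha h hz⟩
end
end

section
/- Let f : ℝⁿ → ℝ be C² with L-Lipschitz continuous gradient and let 0 < α < 1/L. For x ∈ ℝⁿ, let g_PP(x) denote the unique global minimizer of z ↦ f(z) + ‖z − x‖²/(2α). Then the proximal point algorithm x_{k+1} = g_PP(x_k) avoids the strict saddles of f: the set of initial points x₀ ∈ ℝⁿ such that the sequence (x_k) converges to a strict saddle of f has Lebesgue measure zero. -/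
open MeasureTheory Filter Topology

noncomputable section

/-- A strict saddle of a `C²` function `f : ℝⁿ → ℝ`: the gradient vanishes and the Hessian
(the derivative of the gradient) has a negative eigenvalue. -/
def IsStrictSaddle {n : ℕ} (f : EuclideanSpace ℝ (Fin n) → ℝ)
    (p : EuclideanSpace ℝ (Fin n)) : Prop :=
  gradient f p = 0 ∧
    ∃ μ : ℝ, μ < 0 ∧ ∃ v : EuclideanSpace ℝ (Fin n), v ≠ 0 ∧
      fderiv ℝ (gradient f) p v = μ • v

open scoped RealInnerProductSpace

theorem local_null_s17 {n : ℕ} (h g : EuclideanSpace ℝ (Fin n) → EuclideanSpace ℝ (Fin n))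
    (M : EuclideanSpace ℝ (Fin n) →L[ℝ] EuclideanSpace ℝ (Fin n))
    (p : EuclideanSpace ℝ (Fin n)) (hs : HasStrictFDerivAt h M p)
    (hsym : ∀ v w, ⟪M v, w⟫ = ⟪v, M w⟫) (m : ℝ) (hm0 : 0 ≤ m) (hm1 : m < 1)
    (v : EuclideanSpace ℝ (Fin n)) (hv : v ≠ 0) (hMv : M v = m • v)
    (hgc : Continuous g) (hg : ∀ x, h (g x) = x) :
    ∃ r > 0, volume {x | ∀ k : ℕ, g^[k] x ∈ Metric.closedBall p r} = 0 := by
  -- choose s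
  obtain ⟨s, hs1, hsm, hinj⟩ : ∃ s : ℝ, 1 < s ∧ s * m ^ 2 < 1 ∧
      ∀ w, w - s • M (M w) = 0 → w = 0 := by
    have hfin : {t : ℝ | Module.End.HasEigenvalue
        ((M ∘L M : EuclideanSpace ℝ (Fin n) →L[ℝ] EuclideanSpace ℝ (Fin n)) :
          Module.End ℝ (EuclideanSpace ℝ (Fin n))) t}.Finite := by
      exact Module.End.finite_hasEigenvalue _
    have hinf : (Set.Ioo (m ^ 2) 1).Infinite := Set.Ioo_infinite (by nlinarith)
    obtain ⟨t, ⟨ht1, ht2⟩, hnt⟩ := (hinf.sdiff hfin).nonempty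
    have ht0 : 0 < t := lt_of_le_of_lt (sq_nonneg m) ht1
    refine ⟨t⁻¹, (one_lt_inv₀ ht0).2 ht2, ?_, ?_⟩
    · rw [inv_mul_lt_iff₀ ht0]; simpa using ht1
    · intro w hw
      by_contra hw0
      apply hnt
      refine Module.End.hasEigenvalue_of_hasEigenvector (x := w) ?_
      rw [Module.End.hasEigenvector_iff, Module.End.mem_eigenspace_iff]
      refine ⟨?_, hw0⟩
      have h1 : w = t⁻¹ • M (M w) := sub_eq_zero.1 hw
      have h2 : t • w = M (M w) := by
        conv_lhs => rw [h1]
        rw [smul_smul, mul_inv_cancel₀ ht0.ne', one_smul]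
      simpa using h2.symm
  obtain ⟨ε, hε, hT⟩ : ∃ ε > 0, ∀ w, ε * ‖w‖ ≤ ‖w - s • M (M w)‖ := by
    let T : EuclideanSpace ℝ (Fin n) →L[ℝ] EuclideanSpace ℝ (Fin n) :=
      ContinuousLinearMap.id ℝ _ - s • (M ∘L M)
    have hTk : LinearMap.ker (T : EuclideanSpace ℝ (Fin n) →ₗ[ℝ] EuclideanSpace ℝ (Fin n)) = ⊥ := by
      rw [LinearMap.ker_eq_bot']
      intro w hw
      exact hinj w (by simpa [T] using hw)
    obtain ⟨K, hK, hA⟩ := LinearMap.exists_antilipschitzWith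
      (T : EuclideanSpace ℝ (Fin n) →ₗ[ℝ] EuclideanSpace ℝ (Fin n)) hTk
    refine ⟨(K : ℝ)⁻¹, by positivity, fun w => ?_⟩
    have := hA.le_mul_dist w 0
    rw [inv_mul_le_iff₀ (by positivity)]
    simpa [T] using this
  set K := ‖M‖ with hK
  have hK0 : 0 ≤ K := norm_nonneg _
  have hs0 : 0 < s := by linarith
  set C := 2 * K + 1 + 2 * s * K ^ 3 with hC
  have hCpos : 0 < C := by positivity
  set δ := min 1 (ε ^ 2 / (s * C)) with hδ
  have hδ0 : 0 < δ := by positivity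
  have hδ1 : δ ≤ 1 := min_le_left _ _
  have hδ2 : s * (δ * C) ≤ ε ^ 2 := by
    have : δ ≤ ε ^ 2 / (s * C) := min_le_right _ _
    rw [le_div_iff₀ (by positivity)] at this
    linarith
  have hloc := hs.isLittleO.bound hδ0
  obtain ⟨r₀, hr₀, hball⟩ := Metric.eventually_nhds_iff_ball.1 hloc
  refine ⟨r₀ / 2, by positivity, ?_⟩
  have happ : ∀ x ∈ Metric.closedBall p (r₀ / 2), ∀ y ∈ Metric.closedBall p (r₀ / 2),
      ‖h x - h y - M (x - y)‖ ≤ δ * ‖x - y‖ := by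
    intro x hx y hy
    refine hball (x, y) ?_
    rw [← ball_prod_same]
    rw [Metric.mem_closedBall] at hx hy
    exact ⟨by rw [Metric.mem_ball]; linarith, by rw [Metric.mem_ball]; linarith⟩
  set W := {x | ∀ k : ℕ, g^[k] x ∈ Metric.closedBall p (r₀ / 2)} with hW
  have hWclosed : IsClosed W := by
    have : W = ⋂ k : ℕ, (g^[k]) ⁻¹' Metric.closedBall p (r₀ / 2) := by
      ext x; simp [hW]
    rw [this]
    exact isClosed_iInter fun k => Metric.isClosed_closedBall.preimage (hgc.iterate k)
  let Q : EuclideanSpace ℝ (Fin n) → ℝ := fun w => ‖w‖ ^ 2 - s * ‖M w‖ ^ 2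
  have hstep : ∀ x ∈ Metric.closedBall p (r₀ / 2), ∀ y ∈ Metric.closedBall p (r₀ / 2),
      s * Q (h x - h y) ≤ Q (x - y) := by
    intro x hx y hy
    have he := happ x hx y hy
    set w := x - y
    set e := h x - h y - M w with hee
    have hw : h x - h y = M w + e := by rw [hee]; abel
    rw [hw]
    have hMw : ‖M w‖ ≤ K * ‖w‖ := M.le_opNorm w
    have hMMw : ‖M (M w)‖ ≤ K * (K * ‖w‖) :=
      (M.le_opNorm _).trans (mul_le_mul_of_nonneg_left hMw hK0)
    have hMe : ‖M e‖ ≤ K * (δ * ‖w‖) :=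
      (M.le_opNorm _).trans (mul_le_mul_of_nonneg_left he hK0)
    have i1 : ⟪M w, e⟫ ≤ (K * ‖w‖) * (δ * ‖w‖) :=
      (real_inner_le_norm _ _).trans (mul_le_mul hMw he (norm_nonneg _) (by positivity))
    have i2 : -⟪M (M w), M e⟫ ≤ (K * (K * ‖w‖)) * (K * (δ * ‖w‖)) :=
      (neg_le_abs _).trans ((abs_real_inner_le_norm _ _).trans
        (mul_le_mul hMMw hMe (norm_nonneg _) (by positivity)))
    have i3 : ‖e‖ ^ 2 ≤ δ * ‖w‖ ^ 2 := by
      calc ‖e‖ ^ 2 ≤ (δ * ‖w‖) ^ 2 := by gcongr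
        _ = δ * (δ * ‖w‖ ^ 2) := by ring
        _ ≤ 1 * (δ * ‖w‖ ^ 2) := by gcongr
        _ = _ := one_mul _
    have i4 : (ε * ‖w‖) ^ 2 ≤ ‖w - s • M (M w)‖ ^ 2 := by
      have := hT w
      gcongr
    have e1 : ‖w - s • M (M w)‖ ^ 2 = ‖w‖ ^ 2 - 2 * s * ‖M w‖ ^ 2 + s ^ 2 * ‖M (M w)‖ ^ 2 := by
      rw [norm_sub_sq_real, real_inner_smul_right, ← hsym, real_inner_self_eq_norm_sq, norm_smul,
        mul_pow, Real.norm_eq_abs, sq_abs]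
      ring
    have e2 : Q (M w + e) = ‖M w‖ ^ 2 + 2 * ⟪M w, e⟫ + ‖e‖ ^ 2
        - s * (‖M (M w)‖ ^ 2 + 2 * ⟪M (M w), M e⟫ + ‖M e‖ ^ 2) := by
      simp only [Q, map_add, norm_add_sq_real]
    have b1 : Q (M w + e) ≤ ‖M w‖ ^ 2 - s * ‖M (M w)‖ ^ 2 + δ * C * ‖w‖ ^ 2 := by
      rw [e2, hC]
      have := mul_le_mul_of_nonneg_left i2 hs0.le
      have h3 : 0 ≤ s * ‖M e‖ ^ 2 := by positivity
      linarith
    have b2 := mul_le_mul_of_nonneg_left b1 hs0.le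
    have b3 := mul_le_mul_of_nonneg_right hδ2 (sq_nonneg ‖w‖)
    have e3 : Q w = ‖w‖ ^ 2 - s * ‖M w‖ ^ 2 := rfl
    rw [e3]
    rw [e1, mul_pow] at i4
    linarith
  have hiter : ∀ x ∈ W, ∀ y ∈ W, ∀ k : ℕ, s ^ k * Q (x - y) ≤ Q (g^[k] x - g^[k] y) := by
    intro x hx y hy k
    induction k with
    | zero => simp
    | succ k ih =>
      have := hstep _ (hx (k + 1)) _ (hy (k + 1))
      rw [Function.iterate_succ_apply', Function.iterate_succ_apply', hg, hg] at this
      rw [Function.iterate_succ_apply', Function.iterate_succ_apply', pow_succ]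
      have := mul_le_mul_of_nonneg_left ih hs0.le
      linarith
  have hQle : ∀ x ∈ W, ∀ y ∈ W, Q (x - y) ≤ 0 := by
    intro x hx y hy
    by_contra! hpos
    have hb : ∀ k : ℕ, s ^ k * Q (x - y) ≤ r₀ ^ 2 := by
      intro k
      refine (hiter x hx y hy k).trans ?_
      have h1 : ‖g^[k] x - g^[k] y‖ ≤ r₀ := by
        rw [← dist_eq_norm]
        have := dist_triangle_right (g^[k] x) (g^[k] y) p
        have h1 := Metric.mem_closedBall.1 (hx k)
        have h2 := Metric.mem_closedBall.1 (hy k)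
        linarith
      have h2 : 0 ≤ s * ‖M (g^[k] x - g^[k] y)‖ ^ 2 := by positivity
      have h3 : ‖g^[k] x - g^[k] y‖ ^ 2 ≤ r₀ ^ 2 := by gcongr
      simp only [Q]
      linarith
    obtain ⟨k, hk⟩ := pow_unbounded_of_one_lt (r₀ ^ 2 / Q (x - y)) hs1
    rw [div_lt_iff₀ hpos] at hk
    linarith [hb k]
  have hvn : 0 < ‖v‖ := norm_pos_iff.2 hv
  have hline : ∀ x ∈ W, ∀ y ∈ W, ∀ t : ℝ, x - y = t • v → t = 0 := by
    intro x hx y hy t ht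
    have h1 := hQle x hx y hy
    have h2 : Q (x - y) = t ^ 2 * (1 - s * m ^ 2) * ‖v‖ ^ 2 := by
      simp only [Q, ht, map_smul, hMv, norm_smul, mul_pow, Real.norm_eq_abs, sq_abs]
      ring
    rw [h2] at h1
    by_contra ht0
    have : 0 < t ^ 2 * (1 - s * m ^ 2) * ‖v‖ ^ 2 := by
      have : 0 < 1 - s * m ^ 2 := by linarith
      positivity
    linarith
  refine Measure.addHaar_eq_zero_of_disjoint_translates volume
    (fun k : ℕ => ((k : ℝ) + 1)⁻¹ • v) ?_ ?_ hWclosed.measurableSet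
  · refine (Metric.isBounded_closedBall (x := (0 : EuclideanSpace ℝ (Fin n))) (r := ‖v‖)).subset ?_
    rintro _ ⟨k, rfl⟩
    rw [mem_closedBall_zero_iff, norm_smul]
    have : ‖((k : ℝ) + 1)⁻¹‖ ≤ 1 := by
      rw [Real.norm_of_nonneg (by positivity)]
      exact inv_le_one_of_one_le₀ (by linarith [Nat.cast_nonneg (α := ℝ) k])
    nlinarith
  · intro i j hij
    rw [Function.onFun, Set.disjoint_left]
    rintro z hz1 hz2
    rw [Set.singleton_add, Set.mem_image] at hz1 hz2
    obtain ⟨x, hx, rfl⟩ := hz1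
    obtain ⟨y, hy, hxy⟩ := hz2
    have h1 := hline x hx y hy (((j : ℝ) + 1)⁻¹ - ((i : ℝ) + 1)⁻¹) (by
      rw [sub_smul, sub_eq_sub_iff_add_eq_add]
      rw [hxy]; abel)
    have h2 : ((j : ℝ) + 1)⁻¹ = ((i : ℝ) + 1)⁻¹ := by linarith
    have h3 := inv_injective h2
    apply hij
    have : (i : ℝ) = j := by linarith
    exact_mod_cast this


theorem gradient_contDiff {n : ℕ} (f : EuclideanSpace ℝ (Fin n) → ℝ) (hf : ContDiff ℝ 2 f) :
    ContDiff ℝ 1 (gradient f) := by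
  have h1 : ContDiff ℝ 1 (fderiv ℝ f) := hf.fderiv_right (by norm_num)
  rw [contDiff_euclidean]
  intro i
  have : (fun x => gradient f x i) = fun x => fderiv ℝ f x (EuclideanSpace.single i 1) := by
    ext x
    rw [← inner_gradient_left (𝕜 := ℝ)]
    rw [EuclideanSpace.inner_single_right]; simp
  rw [this]
  exact h1.clm_apply contDiff_const

theorem hessian_symm {n : ℕ} (f : EuclideanSpace ℝ (Fin n) → ℝ) (hf : ContDiff ℝ 2 f)
    (p v w : EuclideanSpace ℝ (Fin n)) :
    ⟪fderiv ℝ (gradient f) p v, w⟫ = ⟪v, fderiv ℝ (gradient f) p w⟫ := by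
  have hG : DifferentiableAt ℝ (gradient f) p :=
    (gradient_contDiff f hf).differentiable (by norm_num) p
  have h1 : DifferentiableAt ℝ (fderiv ℝ f) p :=
    (hf.fderiv_right (m := 1) (by norm_num)).differentiable (by norm_num) p
  have key : ∀ a b, ⟪fderiv ℝ (gradient f) p a, b⟫ = fderiv ℝ (fderiv ℝ f) p a b := by
    intro a b
    have e1 : HasFDerivAt (fun x => ⟪b, gradient f x⟫)
        ((innerSL ℝ b) ∘L fderiv ℝ (gradient f) p) p :=
      (innerSL ℝ b).hasFDerivAt.comp p hG.hasFDerivAt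
    have e2 : HasFDerivAt (fun x => fderiv ℝ f x b)
        ((ContinuousLinearMap.apply ℝ ℝ b) ∘L fderiv ℝ (fderiv ℝ f) p) p :=
      (ContinuousLinearMap.apply ℝ ℝ b).hasFDerivAt.comp p h1.hasFDerivAt
    have e3 : (fun x => ⟪b, gradient f x⟫) = fun x => fderiv ℝ f x b := by
      ext x
      rw [real_inner_comm, inner_gradient_left]
    rw [e3] at e1
    have := congrArg (fun T => T a) (e1.unique e2)
    rw [real_inner_comm]
    simpa using this
  rw [key, real_inner_comm, key]
  exact (hf.contDiffAt.isSymmSndFDerivAt (by simp)) v w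

theorem prox_first_order {n : ℕ} (f : EuclideanSpace ℝ (Fin n) → ℝ) (hf : ContDiff ℝ 2 f)
    (α : ℝ) (hα : 0 < α) (x y : EuclideanSpace ℝ (Fin n))
    (hy : ∀ z, f y + ‖y - x‖ ^ 2 / (2 * α) ≤ f z + ‖z - x‖ ^ 2 / (2 * α)) :
    y + α • gradient f y = x := by
  have hd : HasFDerivAt f (fderiv ℝ f y) y := (hf.differentiable (by norm_num) y).hasFDerivAt
  have h2 : HasFDerivAt (fun z => ‖z - x‖ ^ 2) (2 • (innerSL ℝ (y - x))) y := by
    simpa using ((hasFDerivAt_id y).sub_const x).norm_sq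
  have h3 := hd.add (h2.mul_const (2 * α)⁻¹)
  have hmin : IsLocalMin (fun z => f z + ‖z - x‖ ^ 2 * (2 * α)⁻¹) y :=
    Filter.Eventually.of_forall fun z => by
      simpa [div_eq_mul_inv] using hy z
  have h0 := hmin.hasFDerivAt_eq_zero h3
  have h4 : ∀ w, ⟪y + α • gradient f y - x, w⟫ = 0 := by
    intro w
    have h5 := congrArg (fun T => T w) h0
    simp only [add_apply, _root_.smul_apply, innerSL_apply_apply, smul_eq_mul, zero_apply,
      nsmul_eq_mul] at h5
    rw [← inner_gradient_left (𝕜 := ℝ)] at h5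
    rw [add_sub_right_comm, inner_add_left, real_inner_smul_left]
    push_cast at h5
    field_simp at h5
    linarith
  have := h4 (y + α • gradient f y - x)
  rw [inner_self_eq_zero, sub_eq_zero] at this
  exact this

/-- For `f : ℝⁿ → ℝ` of class `C²` with `L`-Lipschitz gradient and `0 < α < 1/L`, the
proximal point algorithm `x_{k+1} = gPP(x_k)`, where `gPP x` is the (unique) global
minimizer of `z ↦ f(z) + ‖z − x‖²/(2α)`, avoids the strict saddles of `f`: the set of
initial points whose iterates converge to a strict saddle has Lebesgue measure zero. -/
theorem proximal_point_avoids_strict_saddles {n : ℕ}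
    (f : EuclideanSpace ℝ (Fin n) → ℝ) (hf : ContDiff ℝ 2 f)
    (L : ℝ) (hL : 0 < L)
    (hlip : ∀ x y : EuclideanSpace ℝ (Fin n),
      ‖gradient f x - gradient f y‖ ≤ L * ‖x - y‖)
    (α : ℝ) (hα : 0 < α) (hαL : α < 1 / L)
    (gPP : EuclideanSpace ℝ (Fin n) → EuclideanSpace ℝ (Fin n))
    (hgPP : ∀ x z : EuclideanSpace ℝ (Fin n),
      f (gPP x) + ‖gPP x - x‖ ^ 2 / (2 * α) ≤ f z + ‖z - x‖ ^ 2 / (2 * α)) :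
    volume {x₀ : EuclideanSpace ℝ (Fin n) |
      ∃ p, IsStrictSaddle f p ∧
        Tendsto (fun k => gPP^[k] x₀) atTop (𝓝 p)} = 0 := by
  set h : EuclideanSpace ℝ (Fin n) → EuclideanSpace ℝ (Fin n) :=
    fun y => y + α • gradient f y with hh
  have hg : ∀ x, h (gPP x) = x := fun x => prox_first_order f hf α hα x (gPP x) (hgPP x)
  have hαL' : α * L < 1 := by rwa [lt_div_iff₀ hL] at hαL
  have hG := gradient_contDiff f hf
  have hGd : Differentiable ℝ (gradient f) := hG.differentiable (by norm_num)
  have hhd : Differentiable ℝ h := differentiable_id.add (hGd.const_smul α)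
  -- `h` expands distances by at least `1 - α L`
  have hexp : ∀ a b, (1 - α * L) * ‖a - b‖ ≤ ‖h a - h b‖ := by
    intro a b
    have e : a - b = (h a - h b) - α • (gradient f a - gradient f b) := by
      simp only [hh, smul_sub]; abel
    have h1 : ‖a - b‖ ≤ ‖h a - h b‖ + ‖α • (gradient f a - gradient f b)‖ := by
      conv_lhs => rw [e]
      exact norm_sub_le _ _
    rw [norm_smul, Real.norm_of_nonneg hα.le] at h1
    have := mul_le_mul_of_nonneg_left (hlip a b) hα.le
    linarith
  have hgc : Continuous gPP := by
    have : LipschitzWith (Real.toNNReal (1 - α * L)⁻¹) gPP := by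
      refine LipschitzWith.of_dist_le_mul fun x y => ?_
      have hpos : 0 < 1 - α * L := by linarith
      rw [Real.coe_toNNReal _ (by positivity), dist_eq_norm, dist_eq_norm,
        le_inv_mul_iff₀ hpos]
      simpa [hg] using hexp (gPP x) (gPP y)
    exact this.continuous
  -- local statement at each strict saddle
  have hlocal : ∀ p, IsStrictSaddle f p →
      ∃ r > 0, volume {x | ∀ k : ℕ, gPP^[k] x ∈ Metric.closedBall p r} = 0 := by
    rintro p ⟨-, μ, hμ, v, hv, hHv⟩
    have hstrict : HasStrictFDerivAt h
        (ContinuousLinearMap.id ℝ _ + α • fderiv ℝ (gradient f) p) p :=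
      (hasStrictFDerivAt_id p).add
        ((hG.contDiffAt.hasStrictFDerivAt (by norm_num)).const_smul α)
    have hnorm : ‖fderiv ℝ (gradient f) p‖ ≤ L :=
      norm_fderiv_le_of_lip' ℝ hL.le (Filter.Eventually.of_forall fun x => hlip x p)
    have hμL : -μ ≤ L := by
      have h1 := (fderiv ℝ (gradient f) p).le_of_opNorm_le hnorm v
      rw [hHv, norm_smul, Real.norm_of_nonpos hμ.le] at h1
      exact le_of_mul_le_mul_right h1 (norm_pos_iff.2 hv)
    refine local_null_s17 h gPP _ p hstrict ?_ (1 + α * μ) ?_ ?_ v hv ?_ hgc hg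
    · intro a b
      simp only [add_apply, _root_.smul_apply, ContinuousLinearMap.id_apply,
        inner_add_left, inner_add_right, real_inner_smul_left, real_inner_smul_right,
        hessian_symm f hf p a b]
    · have := mul_le_mul_of_nonneg_left hμL hα.le
      linarith
    · have := mul_neg_of_pos_of_neg hα hμ
      linarith
    · simp [hHv, add_smul, smul_smul]
  choose! r hr0 hrnull using hlocal
  -- preimages of null sets under the iterates are null
  have hpre : ∀ (k : ℕ) (W : Set (EuclideanSpace ℝ (Fin n))), volume W = 0 →
      volume ((gPP^[k]) ⁻¹' W) = 0 := by
    intro k W hW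
    have hinv : Function.LeftInverse (h^[k]) (gPP^[k]) := Function.LeftInverse.iterate hg k
    refine measure_mono_null (t := h^[k] '' W) (fun x hx => ⟨gPP^[k] x, hx, hinv x⟩) ?_
    exact addHaar_image_eq_zero_of_differentiableOn_of_addHaar_eq_zero volume
      (hhd.iterate k).differentiableOn hW
  obtain ⟨t, hts, htc, htcov⟩ := TopologicalSpace.countable_cover_nhdsWithin
    (s := {p | IsStrictSaddle f p}) (f := fun p => Metric.ball p (r p))
    (fun p hp => mem_nhdsWithin_of_mem_nhds (Metric.ball_mem_nhds p (hr0 p hp)))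
  refine measure_mono_null (t := ⋃ q ∈ t, ⋃ k : ℕ, (gPP^[k]) ⁻¹'
    {x | ∀ j : ℕ, gPP^[j] x ∈ Metric.closedBall q (r q)}) ?_ ?_
  · rintro x₀ ⟨p, hp, hlim⟩
    obtain ⟨q, hq, hpq⟩ := Set.mem_iUnion₂.1 (htcov hp)
    obtain ⟨N, hN⟩ := eventually_atTop.1
      (hlim.eventually (Metric.isOpen_ball.mem_nhds hpq))
    refine Set.mem_iUnion₂.2 ⟨q, hq, Set.mem_iUnion.2 ⟨N, fun j => ?_⟩⟩
    rw [← Function.iterate_add_apply]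
    exact Metric.ball_subset_closedBall (hN (j + N) (by omega))
  · rw [measure_biUnion_null_iff htc]
    intro q hq
    rw [measure_iUnion_null_iff]
    exact fun k => hpre k _ (hrnull q (hts hq))
end
end
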